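/- Dilute Bose gas theorem: Let v be a potential with scattering length a_v as in the context. Assume that for each ρ > 0 the thermodynamic limit e^B(ρ) = lim_{L→∞} E^B(⌊ρL³⌋, L)/L³ exists. Then for every ε > 0 there exists ρ₀ > 0 such that for all 0 < ρ < ρ₀, | e^B(ρ) − 4π a_v ρ² | ≤ ε ρ². -/

import Mathlib

/-!
STATEMENT 3: Dilute Bose gas theorem.
For a nonnegative, bounded, measurable, radial, compactly supported pair
potential `v` with scattering length `a`: assuming the thermodynamic limit
`e^B(ρ) = lim_{L→∞} E^B(⌊ρL³⌋, L)/L³` exists for each `ρ > 0`, for every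
`ε > 0` there is `ρ₀ > 0` such that for all `0 < ρ < ρ₀`,
`|e^B(ρ) - 4π a ρ²| ≤ ε ρ²`.

Here `E^B(N,L)` is the absolute (no symmetry restriction) ground state energy:
the infimum of the energy quadratic form over normalized wave functions which
are smooth with (compact) support inside the open box `(0,L)^{3N}` (a form
core for the Dirichlet (H¹₀) realization).
-/

open MeasureTheory Real Filter
open scoped RealInnerProductSpace

noncomputable section

abbrev R3 := EuclideanSpace ℝ (Fin 3)

/-- `|∇f|²(x) = ∑_j |∂_j f(x)|²` for a complex-valued function on ℝ³. -/
def gradSq (f : R3 → ℂ) (x : R3) : ℝ :=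
  ∑ j : Fin 3, ‖fderiv ℝ f x (EuclideanSpace.single j 1)‖ ^ 2

/-- The open cube `(0,L)³`. -/
def openCube (L : ℝ) : Set R3 := {x | ∀ j, x j ∈ Set.Ioo 0 L}

/-- Admissible (unsymmetrized) `N`-particle wave functions in `[0,L]³`:
smooth, supported inside the open box (Dirichlet boundary conditions),
and normalized in `L²`. -/
def IsBosonicState (N : ℕ) (L : ℝ) (Ψ : (Fin N → R3) → ℂ) : Prop :=
  ContDiff ℝ (⊤ : ℕ∞) Ψ ∧
  tsupport Ψ ⊆ {X | ∀ i, X i ∈ openCube L} ∧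
  (∫ X : Fin N → R3, ‖Ψ X‖ ^ 2) = 1

/-- The energy of a wave function: kinetic energy plus interaction. -/
def energyForm (N : ℕ) (v : R3 → ℝ) (Ψ : (Fin N → R3) → ℂ) : ℝ :=
  ∫ X : Fin N → R3,
    ((∑ i, gradSq (fun y => Ψ (Function.update X i y)) (X i)) +
      ∑ i, ∑ j, if i < j then v (X i - X j) * ‖Ψ X‖ ^ 2 else 0)

/-- The bosonic (absolute) ground state energy `E^B(N,L)`. -/
def groundEnergyB (N : ℕ) (L : ℝ) (v : R3 → ℝ) : ℝ :=
  sInf {E | ∃ Ψ, IsBosonicState N L Ψ ∧ energyForm N v Ψ = E}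

open scoped Convolution in
/-- Mollification of a compactly supported `C¹` function, with `C¹` control. -/
lemma exists_smooth_C1_approx {g : R3 → ℝ} (hg : ContDiff ℝ 1 g) (hgs : HasCompactSupport g)
    {δ : ℝ} (hδ : 0 < δ) :
    ∃ k : R3 → ℝ, ContDiff ℝ (⊤ : ℕ∞) k ∧ HasCompactSupport k ∧
      (∀ r : ℝ, (∀ x, r ≤ ‖x‖ → g x = 0) → ∀ x, r + 1 ≤ ‖x‖ → k x = 0) ∧
      (∀ x, |k x - g x| ≤ δ) ∧ (∀ x, ‖fderiv ℝ k x - fderiv ℝ g x‖ ≤ δ) ∧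
      ((∀ x, g x ∈ Set.Icc (0 : ℝ) 1) → ∀ x, k x ∈ Set.Icc (0 : ℝ) 1) := by
  have hcont : Continuous g := hg.continuous
  have hdcont : Continuous (fderiv ℝ g) := hg.continuous_fderiv one_ne_zero
  have hdc : HasCompactSupport (fderiv ℝ g) := hgs.fderiv ℝ
  obtain ⟨d1, hd1, H1⟩ := Metric.uniformContinuous_iff.1
    (hcont.uniformContinuous_of_tendsto_cocompact hgs.is_zero_at_infty) δ hδ
  obtain ⟨d2, hd2, H2⟩ := Metric.uniformContinuous_iff.1
    (hdcont.uniformContinuous_of_tendsto_cocompact hdc.is_zero_at_infty) δ hδ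
  have hr : 0 < min (min d1 d2) 1 := by positivity
  set r := min (min d1 d2) 1 with hrdef
  let b : ContDiffBump (0 : R3) := ⟨r / 2, r, by positivity, by linarith⟩
  have hbr : b.rOut = r := rfl
  set k : R3 → ℝ := (b.normed volume ⋆[ContinuousLinearMap.lsmul ℝ ℝ, volume] g) with hk
  have hkd : ∀ x, HasFDerivAt k
      ((b.normed volume ⋆[ContinuousLinearMap.lsmul ℝ ℝ, volume] (fderiv ℝ g)) x) x := by
    intro x
    have := hgs.hasFDerivAt_convolution_right (ContinuousLinearMap.lsmul ℝ ℝ)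
      (μ := volume) (f := b.normed volume)
      (b.continuous_normed.locallyIntegrable) hg x
    exact this
  have hks : HasCompactSupport k :=
    b.hasCompactSupport_normed.convolution _ hgs
  refine ⟨k, ?_, hks, ?_, ?_, ?_, ?_⟩
  · exact b.hasCompactSupport_normed.contDiff_convolution_left _ b.contDiff_normed
      hcont.locallyIntegrable
  · intro s hs x hx
    have : k x = g x := by
      refine b.normed_convolution_eq_right (fun y hy => ?_)
      have h1 : ‖y - x‖ < 1 := by
        have := Metric.mem_ball.1 hy
        rw [dist_eq_norm] at this
        exact this.trans_le (by rw [hbr]; exact min_le_right _ _)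
      have h2 : ‖x‖ ≤ ‖y‖ + ‖y - x‖ := by
        have := norm_sub_le y (y - x); simpa using this
      rw [hs y (by linarith), hs x (by linarith)]
    rw [this, hs x (by linarith)]
  · intro x
    have := b.dist_normed_convolution_le (μ := volume) (x₀ := x) (ε := δ) (g := g)
      hcont.aestronglyMeasurable
      (fun y hy => (H1 ((Metric.mem_ball.1 hy).trans_le
        ((min_le_left _ _).trans (min_le_left _ _)))).le)
    rwa [Real.dist_eq] at this
  · intro x
    rw [(hkd x).fderiv, ← dist_eq_norm]
    exact b.dist_normed_convolution_le (μ := volume) (x₀ := x) (ε := δ) (g := fderiv ℝ g)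
      hdcont.aestronglyMeasurable
      (fun y hy => (H2 ((Metric.mem_ball.1 hy).trans_le
        ((min_le_left _ _).trans (min_le_right _ _)))).le)
  · intro h01 x
    simp only [hk, convolution, ContinuousLinearMap.lsmul_apply, smul_eq_mul]
    refine ⟨integral_nonneg fun t => mul_nonneg (b.nonneg_normed _) (h01 _).1, ?_⟩
    calc ∫ t, b.normed volume t * g (x - t) ≤ ∫ t, b.normed volume t := by
          refine integral_mono_of_nonneg
            (Eventually.of_forall fun t => mul_nonneg (b.nonneg_normed _) (h01 _).1)
            b.integrable_normed (Eventually.of_forall fun t => ?_)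
          exact mul_le_of_le_one_right (b.nonneg_normed _) (h01 _).2
      _ = 1 := b.integral_normed

lemma inner_gradient_eq (f g : R3 → ℝ) (x : R3) :
    ⟪gradient f x, gradient g x⟫ = fderiv ℝ g x (gradient f x) := by
  rw [real_inner_comm, inner_gradient_left]

lemma norm_gradient (f : R3 → ℝ) (x : R3) : ‖gradient f x‖ = ‖fderiv ℝ f x‖ := by
  simp [gradient]

lemma continuous_gradient {f : R3 → ℝ} (hf : ContDiff ℝ 1 f) : Continuous (gradient f) :=
  (InnerProductSpace.toDual ℝ R3).symm.continuous.comp (hf.continuous_fderiv one_ne_zero)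

lemma gradient_fun_mul {f g : R3 → ℝ} {x : R3} (hf : DifferentiableAt ℝ f x)
    (hg : DifferentiableAt ℝ g x) :
    gradient (fun y => f y * g y) x = f x • gradient g x + g x • gradient f x := by
  simp only [gradient]
  rw [fderiv_fun_mul hf hg]
  simp

/-- The scattering equation tested against `C¹` compactly supported functions. -/
lemma scattering_C1 {v φ : R3 → ℝ} (hv_meas : Measurable v)
    (hv_bdd : ∃ C, ∀ x, v x ≤ C) (hv_nonneg : ∀ x, 0 ≤ v x) {R0 : ℝ}
    (hv_supp : ∀ x : R3, R0 < ‖x‖ → v x = 0)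
    (hφ_C1 : ContDiff ℝ 1 φ)
    (hφ_scatt : ∀ g : R3 → ℝ, ContDiff ℝ (⊤ : ℕ∞) g → HasCompactSupport g →
      (∫ x : R3, ⟪gradient φ x, gradient g x⟫) + (1/2) * ∫ x : R3, v x * φ x * g x = 0)
    {g : R3 → ℝ} (hg : ContDiff ℝ 1 g) (hgs : HasCompactSupport g) :
    (∫ x : R3, ⟪gradient φ x, gradient g x⟫) + (1/2) * ∫ x : R3, v x * φ x * g x = 0 := by
  obtain ⟨C, hC⟩ := hv_bdd
  obtain ⟨r, hr⟩ : ∃ r : ℝ, ∀ x, r ≤ ‖x‖ → g x = 0 := by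
    obtain ⟨r, hr⟩ := hgs.isCompact.isBounded.subset_closedBall (0 : R3)
    refine ⟨r + 1, fun x hx => ?_⟩
    by_contra h
    have := hr (subset_tsupport _ h)
    rw [mem_closedBall_zero_iff] at this
    linarith
  set K : Set R3 := Metric.closedBall 0 (|r| + |R0| + 2) with hK
  have hKc : IsCompact K := isCompact_closedBall _ _
  have hgradc := continuous_gradient hφ_C1
  have I1 : IntegrableOn (fun x => ‖gradient φ x‖) K :=
    (hgradc.norm.continuousOn).integrableOn_compact hKc
  have I2 : IntegrableOn (fun x => |v x * φ x|) K := by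
    obtain ⟨B, hB⟩ := hKc.exists_bound_of_continuousOn (f := φ) hφ_C1.continuous.continuousOn
    refine Measure.integrableOn_of_bounded (M := C * B) hKc.measure_lt_top.ne
      ((hv_meas.mul hφ_C1.continuous.measurable).abs.aestronglyMeasurable) ?_
    refine (ae_restrict_iff' hKc.measurableSet).2 (Eventually.of_forall fun x hx => ?_)
    rw [Real.norm_eq_abs, abs_abs, abs_mul, abs_of_nonneg (hv_nonneg x)]
    exact mul_le_mul (hC x) (hB x hx) (abs_nonneg _) ((hv_nonneg x).trans (hC x))
  set A := (∫ x in K, ‖gradient φ x‖) + (∫ x in K, |v x * φ x|) with hA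
  have key : ∀ δ > 0, |(∫ x : R3, ⟪gradient φ x, gradient g x⟫)
      + (1/2) * ∫ x : R3, v x * φ x * g x| ≤ A * δ := by
    intro δ hδ
    obtain ⟨k, hk, hks, hk0, hkg, hkd, -⟩ := exists_smooth_C1_approx hg hgs hδ
    have hk1 : ContDiff ℝ 1 k := hk.of_le (by exact_mod_cast le_top)
    have h0 := hφ_scatt k hk hks
    have grd0 : ∀ f : R3 → ℝ, (∀ x, r + 1 ≤ ‖x‖ → f x = 0) → ∀ x ∉ K, gradient f x = 0 := by
      intro f hf x hx
      have hx' : |r| + |R0| + 2 < ‖x‖ := by simpa [hK] using hx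
      have : f =ᶠ[nhds x] fun _ => 0 := by
        have : ∀ᶠ y in nhds x, |r| + |R0| + 2 < ‖y‖ :=
          continuous_norm.continuousAt.eventually (lt_mem_nhds hx')
        filter_upwards [this] with y hy
        refine hf y ?_
        have := le_abs_self r; have := abs_nonneg R0; linarith
      rw [this.gradient_eq]; simp
    have hg0 : ∀ x, r + 1 ≤ ‖x‖ → g x = 0 := fun x hx => hr x (by linarith)
    have hk0' := hk0 r hr
    have J1 : ∀ f : R3 → ℝ, ContDiff ℝ 1 f → HasCompactSupport f →
        Integrable (fun x => ⟪gradient φ x, gradient f x⟫) := by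
      intro f hf hfs
      refine Continuous.integrable_of_hasCompactSupport
        (hgradc.inner (continuous_gradient hf)) ?_
      refine HasCompactSupport.comp_left (g := fun p => p) ?_ rfl
      have h1 := hfs.fderiv ℝ
      have h2 : HasCompactSupport (gradient f) := by
        have := h1.comp_left (g := (InnerProductSpace.toDual ℝ R3).symm) (map_zero _)
        exact this
      exact h2.mono (fun x hx => by
        intro h; apply hx; simp [h])
    have J2 : ∀ f : R3 → ℝ, Continuous f → HasCompactSupport f →
        Integrable (fun x => v x * φ x * f x) := by
      intro f hf hfs
      have hc : Integrable (fun x => φ x * f x) :=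
        (hφ_C1.continuous.mul hf).integrable_of_hasCompactSupport hfs.mul_left
      have := hc.bdd_mul (c := C) hv_meas.aestronglyMeasurable
        (Eventually.of_forall fun x => by
          rw [Real.norm_eq_abs, abs_of_nonneg (hv_nonneg x)]; exact hC x)
      simpa [mul_assoc] using this
    have e1 : |(∫ x : R3, ⟪gradient φ x, gradient g x⟫) - ∫ x : R3, ⟪gradient φ x, gradient k x⟫|
        ≤ (∫ x in K, ‖gradient φ x‖) * δ := by
      rw [← integral_sub (J1 g hg hgs) (J1 k hk1 hks), ← integral_mul_const,
        ← integral_indicator hKc.measurableSet]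
      rw [← Real.norm_eq_abs]
      refine (norm_integral_le_of_norm_le (g := K.indicator fun x => ‖gradient φ x‖ * δ) ?_ ?_)
      · rw [integrable_indicator_iff hKc.measurableSet]
        exact I1.mul_const δ
      · refine Eventually.of_forall fun x => ?_
        by_cases hx : x ∈ K
        · rw [Set.indicator_of_mem hx, ← inner_sub_right]
          refine (norm_inner_le_norm _ _).trans
            (mul_le_mul_of_nonneg_left ?_ (norm_nonneg _))
          have : gradient g x - gradient k x
              = -((InnerProductSpace.toDual ℝ R3).symm (fderiv ℝ k x - fderiv ℝ g x)) := by
            simp [gradient]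
          rw [this, norm_neg, LinearIsometryEquiv.norm_map]
          exact hkd x
        · rw [Set.indicator_of_notMem hx, grd0 g hg0 x hx, grd0 k hk0' x hx]
          simp
    have e2 : |(∫ x : R3, v x * φ x * g x) - ∫ x : R3, v x * φ x * k x|
        ≤ (∫ x in K, |v x * φ x|) * δ := by
      rw [← integral_sub (J2 g hg.continuous hgs) (J2 k hk1.continuous hks),
        ← integral_mul_const, ← integral_indicator hKc.measurableSet]
      rw [← Real.norm_eq_abs]
      refine (norm_integral_le_of_norm_le (g := K.indicator fun x => |v x * φ x| * δ) ?_ ?_)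
      · rw [integrable_indicator_iff hKc.measurableSet]
        exact I2.mul_const δ
      · refine Eventually.of_forall fun x => ?_
        by_cases hx : x ∈ K
        · rw [Set.indicator_of_mem hx, ← mul_sub, Real.norm_eq_abs, abs_mul]
          refine mul_le_mul_of_nonneg_left ?_ (abs_nonneg _)
          rw [abs_sub_comm]; exact hkg x
        · have hx' : |r| + |R0| + 2 < ‖x‖ := by simpa [hK] using hx
          have := le_abs_self R0; have := abs_nonneg r
          rw [Set.indicator_of_notMem hx, hv_supp x (by linarith)]
          simp
    have p2 : 0 ≤ (∫ x in K, |v x * φ x|) * δ := (abs_nonneg _).trans e2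
    have hgk : (∫ x : R3, ⟪gradient φ x, gradient g x⟫) + (1/2) * ∫ x : R3, v x * φ x * g x
        = ((∫ x : R3, ⟪gradient φ x, gradient g x⟫) - ∫ x : R3, ⟪gradient φ x, gradient k x⟫)
          + (1/2) * ((∫ x : R3, v x * φ x * g x) - ∫ x : R3, v x * φ x * k x) := by
      linarith
    rw [hgk]
    refine (abs_add_le _ _).trans ?_
    rw [abs_mul, abs_of_pos (by norm_num : (0:ℝ) < 1/2), hA, add_mul]
    linarith
  have : |(∫ x : R3, ⟪gradient φ x, gradient g x⟫)
      + (1/2) * ∫ x : R3, v x * φ x * g x| ≤ 0 := by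
    have h1 : Tendsto (fun δ : ℝ => A * δ) (nhdsWithin 0 (Set.Ioi 0)) (nhds (A * 0)) :=
      (continuous_const.mul continuous_id).continuousWithinAt.tendsto
    rw [mul_zero] at h1
    exact ge_of_tendsto h1 (eventually_mem_nhdsWithin.mono fun δ hδ => key δ hδ)
  exact abs_eq_zero.1 (le_antisymm this (abs_nonneg _))

/-- A potential together with its zero-energy scattering solution. -/
structure ScatteringData (v φ : R3 → ℝ) (R0 a : ℝ) : Prop where
  R0_pos : 0 < R0
  meas : Measurable v
  nonneg : ∀ x, 0 ≤ v x
  bdd : ∃ C, ∀ x, v x ≤ C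
  radial : ∀ x y : R3, ‖x‖ = ‖y‖ → v x = v y
  supp : ∀ x : R3, R0 < ‖x‖ → v x = 0
  sol_C1 : ContDiff ℝ 1 φ
  sol_nonneg : ∀ x, 0 ≤ φ x
  sol_le_one : ∀ x, φ x ≤ 1
  sol_eq : ∀ x : R3, R0 ≤ ‖x‖ → φ x = 1 - a / ‖x‖
  scatt : ∀ g : R3 → ℝ, ContDiff ℝ (⊤ : ℕ∞) g → HasCompactSupport g →
      (∫ x : R3, ⟪gradient φ x, gradient g x⟫) + (1/2) * ∫ x : R3, v x * φ x * g x = 0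

/-- A smooth radial cutoff, equal to `1` near the origin and supported in the ball of
radius `R`. -/
def hcut (R : ℝ) (x : R3) : ℝ := smoothTransition (2 - 2 * ‖x‖ ^ 2 / R ^ 2)

/-- The soft potential produced by `hcut` in Dyson's lemma. -/
def softW (a R : ℝ) (x : R3) : ℝ :=
  4 * a / R ^ 2 * deriv smoothTransition (2 - 2 * ‖x‖ ^ 2 / R ^ 2) / ‖x‖

lemma deriv_st_nonneg (t : ℝ) : 0 ≤ deriv smoothTransition t :=
  smoothTransition.monotone.deriv_nonneg

lemma deriv_st_of_neg {t : ℝ} (ht : t < 0) : deriv smoothTransition t = 0 := by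
  have : smoothTransition =ᶠ[nhds t] fun _ => 0 := by
    filter_upwards [gt_mem_nhds ht] with y hy
    exact smoothTransition.zero_of_nonpos hy.le
  rw [this.deriv_eq]; simp

lemma deriv_st_of_gt {t : ℝ} (ht : 1 < t) : deriv smoothTransition t = 0 := by
  have : smoothTransition =ᶠ[nhds t] fun _ => 1 := by
    filter_upwards [lt_mem_nhds ht] with y hy
    exact smoothTransition.one_of_one_le hy.le
  rw [this.deriv_eq]; simp

lemma deriv_st_continuous : Continuous (deriv smoothTransition) :=
  (smoothTransition.contDiff (n := 1)).continuous_deriv le_rfl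

lemma exists_deriv_st_le : ∃ D : ℝ, 0 < D ∧ ∀ t, deriv smoothTransition t ≤ D := by
  obtain ⟨B, hB⟩ := (isCompact_Icc (a := (0:ℝ)) (b := 1)).exists_bound_of_continuousOn
    deriv_st_continuous.continuousOn
  refine ⟨|B| + 1, by positivity, fun t => ?_⟩
  by_cases h0 : t < 0
  · rw [deriv_st_of_neg h0]; positivity
  by_cases h1 : 1 < t
  · rw [deriv_st_of_gt h1]; positivity
  have := hB t ⟨not_lt.1 h0, not_lt.1 h1⟩
  have h2 := le_abs_self (deriv smoothTransition t)
  have h3 := le_abs_self B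
  rw [Real.norm_eq_abs] at this
  linarith

lemma hcut_contDiff (R : ℝ) {n : ℕ∞} : ContDiff ℝ n (hcut R) := by
  unfold hcut
  exact smoothTransition.contDiff.comp
    (contDiff_const.sub (((contDiff_const.mul (contDiff_norm_sq ℝ))).div_const _))

lemma hcut_nonneg (R : ℝ) (x : R3) : 0 ≤ hcut R x := smoothTransition.nonneg _
lemma hcut_le_one (R : ℝ) (x : R3) : hcut R x ≤ 1 := smoothTransition.le_one _

lemma hcut_eq_zero {R : ℝ} (hR : 0 < R) {x : R3} (hx : R ≤ ‖x‖) : hcut R x = 0 := by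
  refine smoothTransition.zero_of_nonpos ?_
  have : R ^ 2 ≤ ‖x‖ ^ 2 := by gcongr
  have h2 : 1 ≤ ‖x‖ ^ 2 / R ^ 2 := by rw [le_div_iff₀ (by positivity)]; linarith
  rw [mul_div_assoc]; linarith

lemma hcut_eq_one {R : ℝ} (hR : 0 < R) {x : R3} (hx : ‖x‖ ≤ R / 2) : hcut R x = 1 := by
  refine smoothTransition.one_of_one_le ?_
  have : ‖x‖ ^ 2 ≤ (R / 2) ^ 2 := by gcongr
  have h2 : ‖x‖ ^ 2 / R ^ 2 ≤ 1 / 4 := by rw [div_le_iff₀ (by positivity)]; linarith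
  rw [mul_div_assoc]; linarith

lemma hcut_hasCompactSupport {R : ℝ} (hR : 0 < R) : HasCompactSupport (hcut R) :=
  HasCompactSupport.intro (isCompact_closedBall (0 : R3) R) fun x hx => by
    refine hcut_eq_zero hR ?_
    have : R < ‖x‖ := by simpa using hx
    exact this.le

lemma gradient_hcut (R : ℝ) (x : R3) :
    gradient (hcut R) x =
      (deriv smoothTransition (2 - 2 * ‖x‖ ^ 2 / R ^ 2) * (-4 / R ^ 2)) • x := by
  have h1 : HasDerivAt smoothTransition (deriv smoothTransition (2 - 2 * ‖x‖ ^ 2 / R ^ 2))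
      (2 - 2 * ‖x‖ ^ 2 / R ^ 2) :=
    ((smoothTransition.contDiff (n := 1)).differentiable (by simp) _).hasDerivAt
  have h2 : HasFDerivAt (fun y : R3 => 2 - 2 * ‖y‖ ^ 2 / R ^ 2)
      ((-4 / R ^ 2) • (innerSL ℝ x)) x := by
    have h3 := (hasStrictFDerivAt_norm_sq x).hasFDerivAt
    have h4 := (h3.const_mul (-(2 / R ^ 2))).const_add 2
    have e : (fun y : R3 => 2 - 2 * ‖y‖ ^ 2 / R ^ 2) =
        fun y : R3 => 2 + -(2 / R ^ 2) * ‖y‖ ^ 2 := by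
      ext y; ring
    rw [e]
    refine h4.congr_fderiv ?_
    ext y; simp; ring
  refine HasGradientAt.gradient ?_
  rw [hasGradientAt_iff_hasFDerivAt]
  refine (h1.comp_hasFDerivAt x h2).congr_fderiv ?_
  ext y
  simp
  ring

lemma gradient_inv_norm {a : ℝ} {φ : R3 → ℝ} {x : R3} (hx : x ≠ 0)
    (h : φ =ᶠ[nhds x] fun y => 1 - a / ‖y‖) : gradient φ x = (a / ‖x‖ ^ 3) • x := by
  have hx' : ‖x‖ ≠ 0 := norm_ne_zero_iff.2 hx
  refine HasGradientAt.gradient (HasGradientAt.congr_of_eventuallyEq ?_ h)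
  rw [hasGradientAt_iff_hasFDerivAt]
  have h1 : HasDerivAt (fun t : ℝ => 1 - a / √t) (a / (2 * ‖x‖ ^ 3)) (‖x‖ ^ 2) := by
    have h3 : ‖x‖ ^ 2 ≠ 0 := pow_ne_zero _ hx'
    have h2 := (Real.hasDerivAt_sqrt h3)
    have hs : √(‖x‖ ^ 2) = ‖x‖ := Real.sqrt_sq (norm_nonneg _)
    rw [hs] at h2
    have h4 := ((h2.inv (by rw [hs]; exact hx')).const_mul a).const_sub 1
    have e : (fun t : ℝ => 1 - a / √t) = fun t => 1 - a * (fun x => √x)⁻¹ t := by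
      ext t; simp [div_eq_mul_inv]
    rw [e]
    refine h4.congr_deriv ?_
    rw [hs]
    field_simp
  have h2 := (hasStrictFDerivAt_norm_sq x).hasFDerivAt
  have h3 := h1.comp_hasFDerivAt x h2
  have e : (fun y : R3 => 1 - a / ‖y‖) =
      (fun t => 1 - a / √t) ∘ fun y : R3 => ‖y‖ ^ 2 := by
    ext y; simp [Real.sqrt_sq (norm_nonneg y)]
  rw [e]
  refine h3.congr_fderiv ?_
  ext y
  simp
  field_simp

section

variable {v φ : R3 → ℝ} {R0 a : ℝ}

namespace ScatteringData

lemma a_nonneg (S : ScatteringData v φ R0 a) : 0 ≤ a := by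
  have hn : ‖(EuclideanSpace.single (0 : Fin 3) R0 : R3)‖ = R0 := by
    simp [abs_of_pos S.R0_pos]
  have h1 := S.sol_eq (EuclideanSpace.single 0 R0) hn.ge
  have h2 := S.sol_le_one (EuclideanSpace.single 0 R0)
  rw [h1, hn] at h2
  have : 0 ≤ a / R0 := by linarith
  have h3 := mul_nonneg this S.R0_pos.le
  rwa [div_mul_cancel₀ _ S.R0_pos.ne'] at h3

lemma gradient_sol (S : ScatteringData v φ R0 a) {x : R3} (hx : R0 < ‖x‖) :
    gradient φ x = (a / ‖x‖ ^ 3) • x := by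
  refine gradient_inv_norm (norm_pos_iff.1 (S.R0_pos.trans hx)) ?_
  filter_upwards [continuous_norm.continuousAt.eventually (lt_mem_nhds hx)] with y hy
  exact S.sol_eq y hy.le

end ScatteringData

lemma softW_nonneg (ha : 0 ≤ a) (R : ℝ) (x : R3) : 0 ≤ softW a R x := by
  unfold softW
  have := deriv_st_nonneg (2 - 2 * ‖x‖ ^ 2 / R ^ 2)
  positivity

lemma deriv_st_eq_zero_of_lt {R : ℝ} (hR : 0 < R) {x : ℝ} (hx0 : 0 ≤ x) (hx : x ≤ R / 2) :
    deriv smoothTransition (2 - 2 * x ^ 2 / R ^ 2) = 0 := by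
  refine deriv_st_of_gt ?_
  have : x ^ 2 ≤ (R / 2) ^ 2 := by gcongr
  have h2 : x ^ 2 / R ^ 2 ≤ 1 / 4 := by rw [div_le_iff₀ (by positivity)]; linarith
  rw [mul_div_assoc]; linarith

lemma deriv_st_eq_zero_of_gt {R : ℝ} (hR : 0 < R) {x : ℝ} (hx : R < x) :
    deriv smoothTransition (2 - 2 * x ^ 2 / R ^ 2) = 0 := by
  refine deriv_st_of_neg ?_
  have : R ^ 2 < x ^ 2 := by gcongr
  have h2 : 1 < x ^ 2 / R ^ 2 := by rw [lt_div_iff₀ (by positivity)]; linarith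
  rw [mul_div_assoc]; linarith

lemma softW_le (ha : 0 ≤ a) {R D : ℝ} (hR : 0 < R) (hD : ∀ t, deriv smoothTransition t ≤ D)
    (x : R3) : softW a R x ≤ 8 * a * D / R ^ 3 := by
  have hD0 : 0 ≤ D := (deriv_st_nonneg 0).trans (hD 0)
  by_cases hx : ‖x‖ ≤ R / 2
  · unfold softW
    rw [deriv_st_eq_zero_of_lt hR (norm_nonneg _) hx]
    simp; positivity
  · push Not at hx
    unfold softW
    have h0 : (0:ℝ) < R / 2 := by linarith
    calc 4 * a / R ^ 2 * deriv smoothTransition (2 - 2 * ‖x‖ ^ 2 / R ^ 2) / ‖x‖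
        ≤ 4 * a / R ^ 2 * D / (R / 2) := by
          have := hD (2 - 2 * ‖x‖ ^ 2 / R ^ 2)
          gcongr
      _ = 8 * a * D / R ^ 3 := by field_simp; ring

lemma softW_eq_zero {R : ℝ} (hR : 0 < R) {x : R3} (hx : R < ‖x‖) : softW a R x = 0 := by
  unfold softW
  rw [deriv_st_eq_zero_of_gt hR hx]; simp

lemma softW_measurable (R : ℝ) : Measurable (softW a R) := by
  unfold softW
  have := deriv_st_continuous.measurable
  fun_prop

namespace ScatteringData

lemma inner_gradient_hcut (S : ScatteringData v φ R0 a) {R : ℝ} (hR : 2 * R0 < R) (x : R3) :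
    ⟪gradient φ x, gradient (hcut R) x⟫ = - softW a R x := by
  have hR' : 0 < R := by have := S.R0_pos; linarith
  rw [gradient_hcut]
  by_cases hx : ‖x‖ ≤ R / 2
  · unfold softW
    rw [deriv_st_eq_zero_of_lt hR' (norm_nonneg _) hx]
    simp
  · push Not at hx
    have hx0 : 0 < ‖x‖ := by linarith
    rw [S.gradient_sol (by linarith), inner_smul_left, inner_smul_right,
      real_inner_self_eq_norm_sq, softW]
    simp
    field_simp

end ScatteringData

lemma integral_softW {R : ℝ} (hR : 0 < R) : ∫ x : R3, softW a R x = 4 * π * a := by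
  have h := integral_fun_norm_addHaar (volume : Measure R3)
    (fun r => 4 * a / R ^ 2 * deriv smoothTransition (2 - 2 * r ^ 2 / R ^ 2) / r)
  have h1 : (volume : Measure R3).real (Metric.ball 0 1) = 4 * π / 3 := by
    rw [measureReal_def, EuclideanSpace.volume_ball_fin_three]
    simp only [ENNReal.ofReal_one, one_pow, one_mul]
    rw [ENNReal.toReal_ofReal (by positivity)]
    ring
  simp only [softW]
  rw [h, h1]
  have h2 : ∫ y in Set.Ioi (0 : ℝ), y ^ (Module.finrank ℝ R3 - 1) •
      (4 * a / R ^ 2 * deriv smoothTransition (2 - 2 * y ^ 2 / R ^ 2) / y) = a := by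
    have e1 : ∀ y ∈ Set.Ioi (0 : ℝ), y ^ (Module.finrank ℝ R3 - 1) •
      (4 * a / R ^ 2 * deriv smoothTransition (2 - 2 * y ^ 2 / R ^ 2) / y)
      = (Set.Ioc 0 (2 * R)).indicator (fun y => a * ((4 * y / R ^ 2)
          * deriv smoothTransition (2 - 2 * y ^ 2 / R ^ 2))) y := by
      intro y hy
      have hy' : 0 < y := hy
      simp only [finrank_euclideanSpace, Fintype.card_fin, smul_eq_mul]
      by_cases hyR : y ≤ 2 * R
      · rw [Set.indicator_of_mem (Set.mem_Ioc.2 ⟨hy', hyR⟩)]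
        rw [show 3 - 1 = 2 from rfl]
        field_simp
      · rw [Set.indicator_of_notMem (fun h => hyR h.2),
          deriv_st_eq_zero_of_gt hR (by linarith)]
        simp
    rw [setIntegral_congr_fun measurableSet_Ioi e1, setIntegral_indicator measurableSet_Ioc]
    have e2 : Set.Ioi (0:ℝ) ∩ Set.Ioc 0 (2 * R) = Set.Ioc 0 (2 * R) := by
      ext y; simp +contextual
    rw [e2, ← intervalIntegral.integral_of_le (by linarith), intervalIntegral.integral_const_mul]
    have e3 : ∫ y in (0:ℝ)..(2 * R), (4 * y / R ^ 2)
          * deriv smoothTransition (2 - 2 * y ^ 2 / R ^ 2)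
        = (fun y => - smoothTransition (2 - 2 * y ^ 2 / R ^ 2)) (2 * R)
          - (fun y => - smoothTransition (2 - 2 * y ^ 2 / R ^ 2)) 0 := by
      refine intervalIntegral.integral_eq_sub_of_hasDerivAt
        (f := fun y => - smoothTransition (2 - 2 * y ^ 2 / R ^ 2))
        (f' := fun y => (4 * y / R ^ 2) * deriv smoothTransition (2 - 2 * y ^ 2 / R ^ 2))
        (fun y _ => ?_) ?_
      · have h1 : HasDerivAt smoothTransition (deriv smoothTransition (2 - 2 * y ^ 2 / R ^ 2))
            (2 - 2 * y ^ 2 / R ^ 2) :=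
          ((smoothTransition.contDiff (n := 1)).differentiable (by simp) _).hasDerivAt
        have h2 : HasDerivAt (fun y : ℝ => 2 - 2 * y ^ 2 / R ^ 2) (-(4 * y / R ^ 2)) y := by
          have h3 := (((hasDerivAt_pow 2 y).const_mul 2).div_const (R ^ 2)).const_sub 2
          refine h3.congr_deriv ?_
          simp; ring
        have h3 := (h1.comp y h2).neg
        refine h3.congr_deriv ?_
        ring
      · refine Continuous.intervalIntegrable ?_ _ _
        have := deriv_st_continuous
        fun_prop
    rw [e3]
    have f1 : smoothTransition (2 - 2 * (2 * R) ^ 2 / R ^ 2) = 0 := by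
      refine smoothTransition.zero_of_nonpos ?_
      have : 2 * (2 * R) ^ 2 / R ^ 2 = 8 := by field_simp; norm_num
      rw [this]; norm_num
    have f2 : smoothTransition (2 - 2 * 0 ^ 2 / R ^ 2) = 1 := by
      refine smoothTransition.one_of_one_le ?_
      simp
    simp only [f1, f2]; ring
  rw [h2]
  simp
  ring

/-- A bounded measurable factor times a compactly supported continuous function. -/
lemma ScatteringData.integrable_mul (S : ScatteringData v φ R0 a) {f : R3 → ℝ}
    (hf : Continuous f) (hfs : HasCompactSupport f) : Integrable (fun x => v x * f x) := by
  obtain ⟨C, hC⟩ := S.bdd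
  exact (hf.integrable_of_hasCompactSupport hfs).bdd_mul (c := C) S.meas.aestronglyMeasurable
    (Eventually.of_forall fun x => by
      rw [Real.norm_eq_abs, abs_of_nonneg (S.nonneg x)]; exact hC x)

lemma softW_continuous_aux (S : ScatteringData v φ R0 a) {R : ℝ} (hR : 2 * R0 < R) :
    Continuous (softW a R) := by
  have h : softW a R = fun x => - ⟪gradient φ x, gradient (hcut R) x⟫ := by
    ext x; rw [S.inner_gradient_hcut hR]; ring
  rw [h]
  exact ((continuous_gradient S.sol_C1).inner
    (continuous_gradient (hcut_contDiff R (n := 1)))).neg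

lemma softW_hasCompactSupport {R : ℝ} (hR : 0 < R) : HasCompactSupport (softW a R) :=
  HasCompactSupport.intro (isCompact_closedBall (0 : R3) R) fun x hx => by
    refine softW_eq_zero hR ?_
    simpa using hx

/-- Dyson's lemma: the kinetic and potential energy in a ball dominate a soft potential. -/
lemma ScatteringData.dyson (S : ScatteringData v φ R0 a) {R : ℝ} (hR : 2 * R0 < R)
    {ψ : R3 → ℝ} (hψ : ContDiff ℝ 1 ψ) :
    ∫ x, softW a R x * ψ x ^ 2 ≤
      ∫ x, hcut R x * (‖fderiv ℝ ψ x‖ ^ 2 + 1 / 2 * v x * ψ x ^ 2) := by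
  have hR' : 0 < R := by have := S.R0_pos; linarith
  have hhc := hcut_contDiff R (n := 1)
  have hhs := hcut_hasCompactSupport hR'
  have Iw : Integrable (fun x => softW a R x * ψ x ^ 2) :=
    ((softW_continuous_aux S hR).mul (hψ.continuous.pow 2)).integrable_of_hasCompactSupport
      (softW_hasCompactSupport hR').mul_right
  have Ik : Integrable (fun x => hcut R x * ‖fderiv ℝ ψ x‖ ^ 2) :=
    (hhc.continuous.mul ((hψ.continuous_fderiv one_ne_zero).norm.pow 2)
      ).integrable_of_hasCompactSupport hhs.mul_right
  have Iv : Integrable (fun x => v x * (hcut R x * ψ x ^ 2)) :=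
    S.integrable_mul (hhc.continuous.mul (hψ.continuous.pow 2)) hhs.mul_right
  have hsplit : (∫ x, hcut R x * (‖fderiv ℝ ψ x‖ ^ 2 + 1 / 2 * v x * ψ x ^ 2))
      = (∫ x, hcut R x * ‖fderiv ℝ ψ x‖ ^ 2) + 1 / 2 * ∫ x, v x * (hcut R x * ψ x ^ 2) := by
    rw [← integral_const_mul, ← integral_add Ik (Iv.const_mul _)]
    congr 1; ext x; ring
  have key : ∀ δ > 0, ∫ x, softW a R x * ψ x ^ 2 ≤ (1 + δ) *
      ∫ x, hcut R x * (‖fderiv ℝ ψ x‖ ^ 2 + 1 / 2 * v x * ψ x ^ 2) := by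
    intro δ hδ
    have hpos : ∀ x, 0 < φ x + δ := fun x => by have := S.sol_nonneg x; linarith
    set g : R3 → ℝ := fun x => (hcut R x * (ψ x * ψ x)) * (φ x + δ)⁻¹ with hg
    have hΦ : ContDiff ℝ 1 (fun x => φ x + δ) := S.sol_C1.add contDiff_const
    have hΦi : ContDiff ℝ 1 (fun x => (φ x + δ)⁻¹) := hΦ.inv fun x => (hpos x).ne'
    have hq : ContDiff ℝ 1 (fun x => ψ x * ψ x) := hψ.mul hψ
    have hgC : ContDiff ℝ 1 g := (hhc.mul hq).mul hΦi
    have hgs : HasCompactSupport g := (hhs.mul_right).mul_right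
    have h0 := scattering_C1 S.meas S.bdd S.nonneg S.supp S.sol_C1 S.scatt hgC hgs
    have dψ : Differentiable ℝ ψ := hψ.differentiable one_ne_zero
    have gradinv : ∀ x, gradient (fun x => (φ x + δ)⁻¹) x
        = (-((φ x + δ) ^ 2)⁻¹) • gradient φ x := by
      intro x
      refine HasGradientAt.gradient ?_
      rw [hasGradientAt_iff_hasFDerivAt]
      have h1 := ((S.sol_C1.differentiable one_ne_zero x).hasFDerivAt.add_const δ)
      have h2 := (hasDerivAt_inv (hpos x).ne').comp_hasFDerivAt x h1
      refine h2.congr_fderiv ?_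
      ext y
      simp
    have gradg : ∀ x, gradient g x = (φ x + δ)⁻¹ • ((ψ x * ψ x) • gradient (hcut R) x
        + (2 * hcut R x * ψ x) • gradient ψ x)
        - (hcut R x * (ψ x * ψ x) * ((φ x + δ) ^ 2)⁻¹) • gradient φ x := by
      intro x
      rw [hg, gradient_fun_mul ((hhc.mul hq).differentiable one_ne_zero x)
        (hΦi.differentiable one_ne_zero x), gradinv,
        gradient_fun_mul (hhc.differentiable one_ne_zero x) (hq.differentiable one_ne_zero x),
        gradient_fun_mul (dψ x) (dψ x)]
      module
    have pt : ∀ x, ⟪gradient φ x, gradient g x⟫ + 1 / 2 * (v x * φ x * g x)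
        ≤ - ((1 + δ)⁻¹ * (softW a R x * ψ x ^ 2))
          + hcut R x * (‖fderiv ℝ ψ x‖ ^ 2 + 1 / 2 * v x * ψ x ^ 2) := by
      intro x
      have hw := S.inner_gradient_hcut hR x
      rw [gradg, inner_sub_right, inner_smul_right, inner_add_right, inner_smul_right,
        inner_smul_right, inner_smul_right, hw, real_inner_self_eq_norm_sq, ← norm_gradient ψ]
      have hh0 := hcut_nonneg R x
      have hw0 := softW_nonneg S.a_nonneg R x
      have hp := hpos x
      have hi : (1 + δ)⁻¹ ≤ (φ x + δ)⁻¹ := by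
        gcongr; exact S.sol_le_one x
      have sq : 0 ≤ ‖gradient ψ x - (ψ x * (φ x + δ)⁻¹) • gradient φ x‖ ^ 2 := by positivity
      rw [norm_sub_sq_real, inner_smul_right, norm_smul, Real.norm_eq_abs, mul_pow, sq_abs,
        real_inner_comm] at sq
      have t1 : (1 + δ)⁻¹ * (softW a R x * ψ x ^ 2) ≤ (φ x + δ)⁻¹ * (softW a R x * ψ x ^ 2) := by
        gcongr
      have t2 : v x * φ x * g x ≤ v x * (hcut R x * ψ x ^ 2) := by
        have : φ x * (φ x + δ)⁻¹ ≤ 1 := by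
          rw [← div_eq_mul_inv, div_le_one hp]; linarith
        calc v x * φ x * g x = v x * (hcut R x * ψ x ^ 2) * (φ x * (φ x + δ)⁻¹) := by
              simp only [hg]; ring
          _ ≤ v x * (hcut R x * ψ x ^ 2) * 1 := by
              refine mul_le_mul_of_nonneg_left this ?_
              have := S.nonneg x
              positivity
          _ = _ := mul_one _
      have t3 := mul_nonneg hh0 sq
      rw [← inv_pow]
      nlinarith [t1, t2, t3]
    have Ig1 : Integrable (fun x => ⟪gradient φ x, gradient g x⟫) := by
      refine Continuous.integrable_of_hasCompactSupport
        ((continuous_gradient S.sol_C1).inner (continuous_gradient hgC)) ?_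
      refine (hgs.fderiv ℝ).mono (fun x hx h => hx ?_)
      simp [gradient, h]
    have Ig2 : Integrable (fun x => v x * φ x * g x) := by
      have := S.integrable_mul (S.sol_C1.continuous.mul hgC.continuous) hgs.mul_left
      simpa [mul_assoc] using this
    have Ir : Integrable (fun x => hcut R x * (‖fderiv ℝ ψ x‖ ^ 2 + 1 / 2 * v x * ψ x ^ 2)) := by
      have := Ik.add (Iv.const_mul (1/2))
      refine this.congr (Eventually.of_forall fun x => ?_)
      simp; ring
    have h1 := integral_mono (Ig1.add (Ig2.const_mul (1/2)))
      ((Iw.const_mul (1 + δ)⁻¹).neg.add Ir) pt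
    have e1 : ∫ x, (fun x => ⟪gradient φ x, gradient g x⟫ + 1 / 2 * (v x * φ x * g x)) x = 0 := by
      rw [← h0, ← integral_const_mul]
      exact integral_add Ig1 (Ig2.const_mul (1/2))
    have e2 : ∫ x, (fun x => - ((1 + δ)⁻¹ * (softW a R x * ψ x ^ 2))
          + hcut R x * (‖fderiv ℝ ψ x‖ ^ 2 + 1 / 2 * v x * ψ x ^ 2)) x
        = - ((1 + δ)⁻¹ * ∫ x, softW a R x * ψ x ^ 2) +
          ∫ x, hcut R x * (‖fderiv ℝ ψ x‖ ^ 2 + 1 / 2 * v x * ψ x ^ 2) := by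
      rw [← integral_const_mul, ← integral_neg]
      exact integral_add (Iw.const_mul (1 + δ)⁻¹).neg Ir
    have h2 : (0:ℝ) ≤ - ((1 + δ)⁻¹ * ∫ x, softW a R x * ψ x ^ 2) +
          ∫ x, hcut R x * (‖fderiv ℝ ψ x‖ ^ 2 + 1 / 2 * v x * ψ x ^ 2) := by
      rw [← e2, ← e1]; exact h1
    have hδ' : (0:ℝ) < 1 + δ := by linarith
    rw [← div_le_iff₀' hδ', div_eq_inv_mul]
    linarith
  have hlim : Tendsto (fun δ : ℝ => (1 + δ) *
      ∫ x, hcut R x * (‖fderiv ℝ ψ x‖ ^ 2 + 1 / 2 * v x * ψ x ^ 2)) (nhdsWithin 0 (Set.Ioi 0))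
      (nhds ((1 + 0) * ∫ x, hcut R x * (‖fderiv ℝ ψ x‖ ^ 2 + 1 / 2 * v x * ψ x ^ 2))) :=
    Continuous.continuousWithinAt (by fun_prop)
  rw [add_zero, one_mul] at hlim
  exact ge_of_tendsto hlim (eventually_mem_nhdsWithin.mono fun δ hδ => key δ hδ)

/-- `ℝ≥0∞` version of Dyson's lemma. -/
lemma ScatteringData.dyson_lintegral (S : ScatteringData v φ R0 a) {R : ℝ} (hR : 2 * R0 < R)
    {ψ : R3 → ℝ} (hψ : ContDiff ℝ 1 ψ) (z : R3) :
    ∫⁻ x, ENNReal.ofReal (softW a R (x - z) * ψ x ^ 2) ≤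
      ∫⁻ x, ENNReal.ofReal
        (hcut R (x - z) * (‖fderiv ℝ ψ x‖ ^ 2 + 1 / 2 * v (x - z) * ψ x ^ 2)) := by
  have hR' : 0 < R := by have := S.R0_pos; linarith
  have hhc := hcut_contDiff R (n := 1)
  have hhs := hcut_hasCompactSupport hR'
  set χ : R3 → ℝ := fun x => ψ (x + z) with hχ
  have hχC : ContDiff ℝ 1 χ := hψ.comp (contDiff_id.add contDiff_const)
  have hd : ∀ x, fderiv ℝ χ x = fderiv ℝ ψ (x + z) := fun x => fderiv_comp_add_right z
  have Iw : Integrable (fun x => softW a R x * χ x ^ 2) :=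
    ((softW_continuous_aux S hR).mul (hχC.continuous.pow 2)).integrable_of_hasCompactSupport
      (softW_hasCompactSupport hR').mul_right
  have Ik : Integrable (fun x => hcut R x * ‖fderiv ℝ χ x‖ ^ 2) :=
    (hhc.continuous.mul ((hχC.continuous_fderiv one_ne_zero).norm.pow 2)
      ).integrable_of_hasCompactSupport hhs.mul_right
  have Iv : Integrable (fun x => v x * (hcut R x * χ x ^ 2)) :=
    S.integrable_mul (hhc.continuous.mul (hχC.continuous.pow 2)) hhs.mul_right
  have Ir : Integrable (fun x => hcut R x * (‖fderiv ℝ χ x‖ ^ 2 + 1 / 2 * v x * χ x ^ 2)) := by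
    have := Ik.add (Iv.const_mul (1/2))
    refine this.congr (Eventually.of_forall fun x => ?_)
    simp; ring
  have h1 := ENNReal.ofReal_le_ofReal (S.dyson hR hχC)
  rw [ofReal_integral_eq_lintegral_ofReal Iw (Eventually.of_forall fun x => mul_nonneg
      (softW_nonneg S.a_nonneg R x) (sq_nonneg _)),
    ofReal_integral_eq_lintegral_ofReal Ir (Eventually.of_forall fun x => mul_nonneg
      (hcut_nonneg R x) (by have := S.nonneg x; positivity))] at h1
  rw [← lintegral_add_right_eq_self _ z,
    ← lintegral_add_right_eq_self (fun x => ENNReal.ofReal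
        (hcut R (x - z) * (‖fderiv ℝ ψ x‖ ^ 2 + 1 / 2 * v (x - z) * ψ x ^ 2))) z]
  simp only [hd] at h1
  simpa [hχ] using h1


end

section Poincare

variable {E : Type*} [NormedAddCommGroup E] [NormedSpace ℝ E]

/-- Cauchy–Schwarz along half of a segment. -/
lemma sq_sub_midpoint_le {f : E → ℝ} (hf : ContDiff ℝ 1 f) {G : E → ℝ} (hG : Continuous G)
    {K : Set E} (hK : Convex ℝ K)
    (hfG : ∀ x ∈ K, ∀ y ∈ K, ∀ z ∈ K, (fderiv ℝ f x (y - z)) ^ 2 ≤ G x)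
    {x y : E} (hx : x ∈ K) (hy : y ∈ K) :
    (f x - f (y + (1 / 2 : ℝ) • (x - y))) ^ 2 ≤
      1 / 2 * ∫ t in (1 / 2 : ℝ)..1, G (y + t • (x - y)) := by
  set u : ℝ → ℝ := fun t => fderiv ℝ f (y + t • (x - y)) (x - y) with hu
  have hu_cont : Continuous u := by
    have := hf.continuous_fderiv one_ne_zero
    fun_prop
  have hline : ∀ t : ℝ, HasDerivAt (fun t : ℝ => f (y + t • (x - y))) (u t) t := by
    intro t
    have h1 : HasDerivAt (fun t : ℝ => y + t • (x - y)) (x - y) t := by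
      simpa using ((hasDerivAt_id t).smul_const (x - y)).const_add y
    exact (hf.differentiable one_ne_zero _).hasFDerivAt.comp_hasDerivAt t h1
  have hftc : ∫ t in (1 / 2 : ℝ)..1, u t = f x - f (y + (1 / 2 : ℝ) • (x - y)) := by
    rw [intervalIntegral.integral_eq_sub_of_hasDerivAt (fun t _ => hline t)
      (hu_cont.intervalIntegrable _ _)]
    simp
  set m := ∫ t in (1 / 2 : ℝ)..1, u t with hm
  have hpos : 0 ≤ ∫ t in (1 / 2 : ℝ)..1, (u t - 2 * m) ^ 2 :=
    intervalIntegral.integral_nonneg (by norm_num) fun t _ => sq_nonneg _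
  have hexp : ∫ t in (1 / 2 : ℝ)..1, (u t - 2 * m) ^ 2 =
      (∫ t in (1 / 2 : ℝ)..1, u t ^ 2) - 2 * m ^ 2 := by
    have e : ∀ t, (u t - 2 * m) ^ 2 = u t ^ 2 - (4 * m * u t - 4 * m ^ 2) := fun t => by ring
    simp_rw [e]
    rw [intervalIntegral.integral_sub, intervalIntegral.integral_sub,
      intervalIntegral.integral_const_mul, intervalIntegral.integral_const, ← hm]
    · simp; ring
    all_goals exact Continuous.intervalIntegrable (by fun_prop) _ _
  have hmono : ∫ t in (1 / 2 : ℝ)..1, u t ^ 2 ≤ ∫ t in (1 / 2 : ℝ)..1, G (y + t • (x - y)) := by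
    refine intervalIntegral.integral_mono_on (by norm_num)
      (Continuous.intervalIntegrable (by fun_prop) _ _)
      (Continuous.intervalIntegrable (by fun_prop) _ _) fun t ht => ?_
    refine hfG _ ?_ x hx y hy
    have h1 := hK hy hx (a := 1 - t) (b := t) (by linarith [ht.2]) (by linarith [ht.1]) (by ring)
    convert h1 using 1
    module
  rw [← hftc]
  linarith

variable [MeasurableSpace E] [BorelSpace E] [FiniteDimensional ℝ E]
  (μ : Measure E) [μ.IsAddHaarMeasure]

/-- Change of variables for contractions of a convex set towards one of its points. -/
lemma lintegral_contract_le {K : Set E} (hK : Convex ℝ K) (hKm : MeasurableSet K)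
    {G : E → ENNReal} (hG : Measurable G) {y : E} (hy : y ∈ K) {t : ℝ}
    (ht : 1 / 2 ≤ t) (ht1 : t ≤ 1) :
    ∫⁻ x in K, G (y + t • (x - y)) ∂μ ≤ 2 ^ (Module.finrank ℝ E) * ∫⁻ x in K, G x ∂μ := by
  have ht0 : 0 < t := by linarith
  rw [← lintegral_indicator hKm, ← lintegral_indicator hKm]
  have hFm : Measurable (K.indicator G) := hG.indicator hKm
  calc ∫⁻ x, K.indicator (fun x => G (y + t • (x - y))) x ∂μ
      ≤ ∫⁻ x, K.indicator G (t • x + (y - t • y)) ∂μ := by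
        refine lintegral_mono fun x => ?_
        by_cases hx : x ∈ K
        · have e : y + t • (x - y) = t • x + (y - t • y) := by module
          have hmem : t • x + (y - t • y) ∈ K := by
            have := hK hy hx (a := 1 - t) (b := t) (by linarith) ht0.le (by ring)
            convert this using 1
            module
          rw [Set.indicator_of_mem hx, Set.indicator_of_mem hmem, e]
        · rw [Set.indicator_of_notMem hx]; exact zero_le
    _ = ∫⁻ z, K.indicator G (z + (y - t • y)) ∂(Measure.map (t • ·) μ) := by
        rw [lintegral_map (by fun_prop) (by fun_prop)]
    _ = ENNReal.ofReal |(t ^ Module.finrank ℝ E)⁻¹| * ∫⁻ z, K.indicator G z ∂μ := by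
        rw [Measure.map_addHaar_smul μ ht0.ne', lintegral_smul_measure,
          lintegral_add_right_eq_self (K.indicator G)]
        simp
    _ ≤ 2 ^ (Module.finrank ℝ E) * ∫⁻ z, K.indicator G z ∂μ := by
        gcongr
        rw [abs_of_pos (by positivity), ← inv_pow, ENNReal.ofReal_pow (by positivity)]
        gcongr
        rw [ENNReal.ofReal_le_iff_le_toReal (by simp)]
        simp only [ENNReal.toReal_ofNat]
        rw [inv_le_comm₀ ht0 (by norm_num)]
        linarith

/-- A Poincaré inequality on convex sets of finite volume. -/
theorem poincare_convex {K : Set E} (hK : Convex ℝ K) (hKm : MeasurableSet K)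
    (h0 : μ K ≠ 0) (htop : μ K ≠ ⊤)
    {f : E → ℝ} (hf : ContDiff ℝ 1 f) {G : E → ℝ} (hG : Continuous G) (hG0 : ∀ x, 0 ≤ G x)
    (hfG : ∀ x ∈ K, ∀ y ∈ K, ∀ z ∈ K, (fderiv ℝ f x (y - z)) ^ 2 ≤ G x) :
    ∃ c : ℝ, ∫⁻ x in K, ENNReal.ofReal ((f x - c) ^ 2) ∂μ ≤
      2 ^ (Module.finrank ℝ E) * ∫⁻ x in K, ENNReal.ofReal (G x) ∂μ := by
  set C : ENNReal := 2 ^ (Module.finrank ℝ E) * ∫⁻ x in K, ENNReal.ofReal (G x) ∂μ with hC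
  set ν := μ.restrict K with hν
  have hνs : SFinite ν := inferInstance
  have hGm : Measurable fun x => ENNReal.ofReal (G x) := hG.measurable.ennreal_ofReal
  have hfc := hf.continuous
  -- the half-segment bound, integrated
  have hhalf : ∫⁻ y, ∫⁻ x, ENNReal.ofReal ((f x - f (y + (1 / 2 : ℝ) • (x - y))) ^ 2) ∂ν ∂ν
      ≤ ENNReal.ofReal (1 / 4) * (C * μ K) := by
    calc ∫⁻ y, ∫⁻ x, ENNReal.ofReal ((f x - f (y + (1 / 2 : ℝ) • (x - y))) ^ 2) ∂ν ∂ν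
        ≤ ∫⁻ y, ENNReal.ofReal (1 / 4) * C ∂ν := by
          refine setLIntegral_mono' hKm fun y hy => ?_
          calc ∫⁻ x, ENNReal.ofReal ((f x - f (y + (1 / 2 : ℝ) • (x - y))) ^ 2) ∂ν
              ≤ ∫⁻ x, ENNReal.ofReal (1 / 2) * (∫⁻ t in Set.Ioc (1 / 2 : ℝ) 1,
                  ENNReal.ofReal (G (y + t • (x - y)))) ∂ν := by
                refine setLIntegral_mono' hKm fun x hx => ?_
                have h1 := sq_sub_midpoint_le hf hG hK hfG hx hy
                refine (ENNReal.ofReal_le_ofReal h1).trans ?_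
                rw [ENNReal.ofReal_mul (by norm_num), intervalIntegral.integral_of_le (by norm_num),
                  ofReal_integral_eq_lintegral_ofReal _ (Eventually.of_forall fun t => hG0 _)]
                exact (Continuous.integrableOn_Icc (by fun_prop)).mono_set Set.Ioc_subset_Icc_self
            _ = ENNReal.ofReal (1 / 2) * ∫⁻ t in Set.Ioc (1 / 2 : ℝ) 1, ∫⁻ x,
                  ENNReal.ofReal (G (y + t • (x - y))) ∂ν := by
                have hm : Measurable (Function.uncurry fun (x : E) (t : ℝ) =>
                    ENNReal.ofReal (G (y + t • (x - y)))) := by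
                  simp only [Function.uncurry_def]
                  exact (Continuous.measurable (by fun_prop)).ennreal_ofReal
                have m1 : Measurable fun x => ∫⁻ t in Set.Ioc (1 / 2 : ℝ) 1,
                    ENNReal.ofReal (G (y + t • (x - y))) := hm.lintegral_prod_right'
                rw [lintegral_const_mul _ m1,
                  lintegral_lintegral_swap hm.aemeasurable]
            _ ≤ ENNReal.ofReal (1 / 2) * ∫⁻ t in Set.Ioc (1 / 2 : ℝ) 1, C := by
                gcongr ENNReal.ofReal (1 / 2) * ?_
                refine setLIntegral_mono' measurableSet_Ioc fun t ht => ?_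
                exact lintegral_contract_le μ hK hKm hGm hy ht.1.le ht.2
            _ = ENNReal.ofReal (1 / 4) * C := by
                rw [setLIntegral_const, Real.volume_Ioc, mul_comm C, ← mul_assoc,
                  ← ENNReal.ofReal_mul (by norm_num)]
                norm_num
      _ = _ := by rw [lintegral_const, hν, Measure.restrict_apply_univ, mul_assoc]
  have hmain : ∫⁻ y, ∫⁻ x, ENNReal.ofReal ((f x - f y) ^ 2) ∂ν ∂ν ≤ C * μ K := by
    have hm : Measurable (Function.uncurry fun (y x : E) =>
        ENNReal.ofReal ((f x - f (y + (1 / 2 : ℝ) • (x - y))) ^ 2)) := by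
        simp only [Function.uncurry_def]
        exact (Continuous.measurable (by fun_prop)).ennreal_ofReal
    have hm' : Measurable (Function.uncurry fun (y x : E) =>
        ENNReal.ofReal ((f y - f (x + (1 / 2 : ℝ) • (y - x))) ^ 2)) := by
        simp only [Function.uncurry_def]
        exact (Continuous.measurable (by fun_prop)).ennreal_ofReal
    calc ∫⁻ y, ∫⁻ x, ENNReal.ofReal ((f x - f y) ^ 2) ∂ν ∂ν
        ≤ ∫⁻ y, ∫⁻ x, (2 * ENNReal.ofReal ((f x - f (y + (1 / 2 : ℝ) • (x - y))) ^ 2)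
            + 2 * ENNReal.ofReal ((f y - f (x + (1 / 2 : ℝ) • (y - x))) ^ 2)) ∂ν ∂ν := by
          refine lintegral_mono fun y => lintegral_mono fun x => ?_
          have e : x + (1 / 2 : ℝ) • (y - x) = y + (1 / 2 : ℝ) • (x - y) := by module
          rw [e, show (2 : ENNReal) = ENNReal.ofReal 2 by simp,
            ← ENNReal.ofReal_mul (by norm_num), ← ENNReal.ofReal_mul (by norm_num),
            ← ENNReal.ofReal_add (by positivity) (by positivity)]
          refine ENNReal.ofReal_le_ofReal ?_
          set z := f (y + (1 / 2 : ℝ) • (x - y))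
          nlinarith [sq_nonneg ((f x - z) + (f y - z))]
      _ = 4 * ∫⁻ y, ∫⁻ x, ENNReal.ofReal ((f x - f (y + (1 / 2 : ℝ) • (x - y))) ^ 2) ∂ν ∂ν := by
          have e1 : ∀ y, ∫⁻ x, (2 * ENNReal.ofReal ((f x - f (y + (1 / 2 : ℝ) • (x - y))) ^ 2)
            + 2 * ENNReal.ofReal ((f y - f (x + (1 / 2 : ℝ) • (y - x))) ^ 2)) ∂ν =
            2 * ∫⁻ x, ENNReal.ofReal ((f x - f (y + (1 / 2 : ℝ) • (x - y))) ^ 2) ∂ν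
            + 2 * ∫⁻ x, ENNReal.ofReal ((f y - f (x + (1 / 2 : ℝ) • (y - x))) ^ 2) ∂ν := by
            intro y
            have m1 : Measurable fun x =>
                ENNReal.ofReal ((f x - f (y + (1 / 2 : ℝ) • (x - y))) ^ 2) :=
              (Continuous.measurable (by fun_prop)).ennreal_ofReal
            have m2 : Measurable fun x =>
                ENNReal.ofReal ((f y - f (x + (1 / 2 : ℝ) • (y - x))) ^ 2) :=
              (Continuous.measurable (by fun_prop)).ennreal_ofReal
            rw [lintegral_add_left (m1.const_mul _), lintegral_const_mul _ m1,
              lintegral_const_mul _ m2]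
          simp_rw [e1]
          have m1 : Measurable fun y =>
              ∫⁻ x, ENNReal.ofReal ((f x - f (y + (1 / 2 : ℝ) • (x - y))) ^ 2) ∂ν :=
            hm.lintegral_prod_right'
          have m2 : Measurable fun y =>
              ∫⁻ x, ENNReal.ofReal ((f y - f (x + (1 / 2 : ℝ) • (y - x))) ^ 2) ∂ν :=
            hm'.lintegral_prod_right'
          rw [lintegral_add_left (m1.const_mul _), lintegral_const_mul _ m1,
            lintegral_const_mul _ m2, lintegral_lintegral_swap hm'.aemeasurable, ← add_mul]
          norm_num
      _ ≤ 4 * (ENNReal.ofReal (1 / 4) * (C * μ K)) := by gcongr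
      _ = C * μ K := by
          rw [← mul_assoc, show (4 : ENNReal) = ENNReal.ofReal 4 by simp,
            ← ENNReal.ofReal_mul (by norm_num)]
          norm_num
  have hmm : Measurable fun y => ∫⁻ x, ENNReal.ofReal ((f x - f y) ^ 2) ∂ν := by
    have hm : Measurable (Function.uncurry fun (y x : E) => ENNReal.ofReal ((f x - f y) ^ 2)) := by
        simp only [Function.uncurry_def]
        exact (Continuous.measurable (by fun_prop)).ennreal_ofReal
    exact hm.lintegral_prod_right'
  obtain ⟨y, -, hy⟩ := exists_le_setLAverage h0 htop hmm.aemeasurable.restrict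
  refine ⟨f y, hy.trans ?_⟩
  rw [setLAverage_eq]
  exact ENNReal.div_le_of_le_mul hmain

end Poincare

section Config

variable {ι : Type*} [Fintype ι] [DecidableEq ι]

/-- Kinetic energy density of the `i`-th particle. -/
def kin (i : ι) (Ψ : (ι → R3) → ℝ) (X : ι → R3) : ℝ :=
  ‖fderiv ℝ (fun y => Ψ (Function.update X i y)) (X i)‖ ^ 2

/-- The half-open cube with corner `c` and side `ℓ`. -/
def cube (c : R3) (ℓ : ℝ) : Set R3 := {x | ∀ j, x j ∈ Set.Ico (c j) (c j + ℓ)}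

lemma kin_nonneg (i : ι) (Ψ : (ι → R3) → ℝ) (X : ι → R3) : 0 ≤ kin i Ψ X := sq_nonneg _

lemma fderiv_update_eq {Ψ : (ι → R3) → ℝ} (hΨ : ContDiff ℝ 1 Ψ) (X : ι → R3) (i : ι) (y : R3) :
    fderiv ℝ (fun y => Ψ (Function.update X i y)) y =
      (fderiv ℝ Ψ (Function.update X i y)).comp
        (ContinuousLinearMap.single ℝ (fun _ => R3) i) := by
  have h1 := hasFDerivAt_update (𝕜 := ℝ) X (i := i) y
  have h2 := (hΨ.differentiable one_ne_zero (Function.update X i y)).hasFDerivAt.comp y h1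
  refine h2.fderiv.trans ?_
  congr 1
  ext z j
  by_cases hj : j = i
  · subst hj; simp
  · simp [hj]

lemma kin_eq {Ψ : (ι → R3) → ℝ} (hΨ : ContDiff ℝ 1 Ψ) (X : ι → R3) (i : ι) :
    kin i Ψ X = ‖(fderiv ℝ Ψ X).comp (ContinuousLinearMap.single ℝ (fun _ => R3) i)‖ ^ 2 := by
  rw [kin, fderiv_update_eq hΨ, Function.update_eq_self]

lemma kin_update (i : ι) (Ψ : (ι → R3) → ℝ) (X : ι → R3) (y : R3) :
    kin i Ψ (Function.update X i y) = ‖fderiv ℝ (fun y => Ψ (Function.update X i y)) y‖ ^ 2 := by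
  simp [kin]

lemma continuous_kin {Ψ : (ι → R3) → ℝ} (hΨ : ContDiff ℝ 1 Ψ) (i : ι) :
    Continuous (kin i Ψ) := by
  have h : kin i Ψ = fun X =>
      ‖(fderiv ℝ Ψ X).comp (ContinuousLinearMap.single ℝ (fun _ => R3) i)‖ ^ 2 := by
    ext X; exact kin_eq hΨ X i
  rw [h]
  exact ((hΨ.continuous_fderiv one_ne_zero).clm_comp continuous_const).norm.pow 2

lemma contDiff_comp_update {Ψ : (ι → R3) → ℝ} (hΨ : ContDiff ℝ 1 Ψ) (X : ι → R3) (i : ι) :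
    ContDiff ℝ 1 (fun y => Ψ (Function.update X i y)) :=
  hΨ.comp (contDiff_update 1 X i)

lemma fderiv_apply_sq_le {Ψ : (ι → R3) → ℝ} (hΨ : ContDiff ℝ 1 Ψ) (X W : ι → R3) {M : ℝ}
    (hM : ∀ i, ‖W i‖ ^ 2 ≤ M) :
    (fderiv ℝ Ψ X W) ^ 2 ≤ Fintype.card ι * M * ∑ i, kin i Ψ X := by
  have h1 : fderiv ℝ Ψ X W = ∑ i, (fderiv ℝ Ψ X).comp
      (ContinuousLinearMap.single ℝ (fun _ => R3) i) (W i) := by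
    have : W = ∑ i, Pi.single i (W i) := (Finset.univ_sum_single W).symm
    conv_lhs => rw [this]
    simp
  rw [h1, mul_assoc, Finset.mul_sum]
  refine (sq_sum_le_card_mul_sum_sq).trans ?_
  rw [Finset.card_univ]
  gcongr with i
  rw [kin_eq hΨ, mul_comm, ← sq_abs]
  have h2 := ContinuousLinearMap.le_opNorm ((fderiv ℝ Ψ X).comp
      (ContinuousLinearMap.single ℝ (fun _ => R3) i)) (W i)
  rw [Real.norm_eq_abs] at h2
  calc _ ≤ (‖(fderiv ℝ Ψ X).comp (ContinuousLinearMap.single ℝ (fun _ => R3) i)‖ * ‖W i‖) ^ 2 := by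
        gcongr
    _ ≤ _ := by rw [mul_pow]; gcongr; exact hM i

lemma lintegral_le_of_slice {α : Type*} [MeasurableSpace α] (μ : ι → Measure α)
    [∀ i, SigmaFinite (μ i)] (i : ι) {f g : (ι → α) → ENNReal}
    (hf : Measurable f) (hg : Measurable g)
    (h : ∀ X, ∫⁻ y, f (Function.update X i y) ∂μ i ≤ ∫⁻ y, g (Function.update X i y) ∂μ i) :
    ∫⁻ X, f X ∂Measure.pi μ ≤ ∫⁻ X, g X ∂Measure.pi μ := by
  refine lintegral_le_of_lmarginal_le {i} hf hg fun X => ?_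
  simpa [lmarginal_singleton] using h X

lemma measurableSet_cube (c : R3) (ℓ : ℝ) : MeasurableSet (cube c ℓ) := by
  have : cube c ℓ = ⋂ j, {x : R3 | x j ∈ Set.Ico (c j) (c j + ℓ)} := by
    ext x; simp [cube]
  rw [this]
  exact MeasurableSet.iInter fun j => measurableSet_Ico.preimage (by fun_prop)

lemma convex_cube (c : R3) (ℓ : ℝ) : Convex ℝ (cube c ℓ) := by
  intro x hx y hy a b ha hb hab j
  have := convex_Ico (𝕜 := ℝ) (c j) (c j + ℓ) (hx j) (hy j) ha hb hab
  simpa using this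

lemma volume_cube (c : R3) {ℓ : ℝ} (hℓ : 0 ≤ ℓ) : volume (cube c ℓ) = ENNReal.ofReal (ℓ ^ 3) := by
  have e : cube c ℓ = (MeasurableEquiv.toLp 2 (Fin 3 → ℝ)).symm ⁻¹'
      (Set.pi Set.univ fun j => Set.Ico (c j) (c j + ℓ)) := by
    ext x; simp [cube]
  rw [e, (EuclideanSpace.volume_preserving_symm_measurableEquiv_toLp (Fin 3)).measure_preimage
    (MeasurableSet.univ_pi fun j => measurableSet_Ico).nullMeasurableSet, volume_pi,
    Measure.pi_pi]
  simp [Real.volume_Ico, ENNReal.ofReal_pow hℓ]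

lemma norm_sub_sq_le_of_mem_cube {c : R3} {ℓ : ℝ} {x y : R3} (hx : x ∈ cube c ℓ)
    (hy : y ∈ cube c ℓ) : ‖x - y‖ ^ 2 ≤ 3 * ℓ ^ 2 := by
  rw [EuclideanSpace.norm_sq_eq]
  calc ∑ j, ‖(x - y) j‖ ^ 2 ≤ ∑ j : Fin 3, ℓ ^ 2 := by
        gcongr with j
        have h1 := hx j
        have h2 := hy j
        simp only [Set.mem_Ico] at h1 h2
        simp only [PiLp.sub_apply, Real.norm_eq_abs, abs_le]
        constructor <;> linarith
    _ = 3 * ℓ ^ 2 := by simp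

/-- Configurations with all particles in a cube. -/
abbrev cubeMeasure (ι : Type*) [Fintype ι] (c : R3) (ℓ : ℝ) : Measure (ι → R3) :=
  Measure.pi fun _ => volume.restrict (cube c ℓ)

lemma cubeMeasure_eq (c : R3) (ℓ : ℝ) :
    cubeMeasure ι c ℓ = volume.restrict (Set.univ.pi fun _ => cube c ℓ) := by
  rw [cubeMeasure, volume_pi, Measure.restrict_pi_pi]

lemma cubeMeasure_univ (c : R3) {ℓ : ℝ} (hℓ : 0 ≤ ℓ) :
    cubeMeasure ι c ℓ Set.univ = ENNReal.ofReal (ℓ ^ 3) ^ Fintype.card ι := by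
  rw [cubeMeasure, Measure.pi_univ]
  simp [volume_cube c hℓ]

/-- Poincaré inequality for configurations in a cube. -/
lemma poincare_cube {Ψ : (ι → R3) → ℝ} (hΨ : ContDiff ℝ 1 Ψ) (c : R3) {ℓ : ℝ} (hℓ : 0 < ℓ) :
    ∃ s : ℝ, ∫⁻ X, ENNReal.ofReal ((Ψ X - s) ^ 2) ∂cubeMeasure ι c ℓ ≤
      ENNReal.ofReal (2 ^ (3 * Fintype.card ι) * (Fintype.card ι * (3 * ℓ ^ 2))) *
        ∫⁻ X, ENNReal.ofReal (∑ i, kin i Ψ X) ∂cubeMeasure ι c ℓ := by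
  have hk : Continuous fun X => ∑ i, kin i Ψ X :=
    continuous_finsetSum _ fun i _ => continuous_kin hΨ i
  have hk0 : ∀ X, 0 ≤ ∑ i, kin i Ψ X := fun X => Finset.sum_nonneg fun i _ => kin_nonneg i Ψ X
  have hvol : volume (Set.univ.pi fun _ : ι => cube c ℓ) =
      ENNReal.ofReal (ℓ ^ 3) ^ Fintype.card ι := by
    rw [volume_pi, Measure.pi_pi]; simp [volume_cube c hℓ.le]
  obtain ⟨s, hs⟩ := poincare_convex (volume : Measure (ι → R3))
    (K := Set.univ.pi fun _ => cube c ℓ) (convex_pi fun _ _ => convex_cube c ℓ)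
    (MeasurableSet.univ_pi fun _ => measurableSet_cube c ℓ)
    (by rw [hvol]; exact pow_ne_zero _ (by simp; positivity)) (by rw [hvol]; finiteness) hΨ
    (G := fun X => Fintype.card ι * (3 * ℓ ^ 2) * ∑ i, kin i Ψ X)
    (by fun_prop) (fun X => mul_nonneg (by positivity) (hk0 X))
    (fun X _ Y hY Z hZ => fderiv_apply_sq_le hΨ X (Y - Z) fun i =>
      norm_sub_sq_le_of_mem_cube (hY i (Set.mem_univ _)) (hZ i (Set.mem_univ _)))
  refine ⟨s, ?_⟩
  rw [cubeMeasure_eq]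
  refine hs.trans (le_of_eq ?_)
  have hdim : Module.finrank ℝ (ι → R3) = 3 * Fintype.card ι := by
    rw [Module.finrank_pi_fintype]; simp [mul_comm]
  rw [hdim, ENNReal.ofReal_mul (by positivity), mul_assoc]
  congr 1
  · rw [ENNReal.ofReal_pow (by norm_num)]; simp
  · rw [← lintegral_const_mul _ hk.measurable.ennreal_ofReal]
    congr 1
    ext X
    rw [ENNReal.ofReal_mul (by positivity)]

end Config

section

variable {v φ : R3 → ℝ} {R0 a : ℝ}

/-- The part of `cube c ℓ` at distance at least `R` from its faces. -/
def innerCube (c : R3) (ℓ R : ℝ) : Set R3 := cube (c + WithLp.toLp 2 fun _ => R) (ℓ - 2 * R)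

lemma mem_cube_of_norm_le {c : R3} {ℓ R : ℝ} {y z : R3} (hz : z ∈ innerCube c ℓ R)
    (h : ‖y - z‖ ≤ R) : y ∈ cube c ℓ := by
  intro m
  have h1 := hz m
  have h2 : |y m - z m| ≤ R := (PiLp.norm_apply_le (y - z) m).trans h
  rw [abs_le] at h2
  simp only [Set.mem_Ico, PiLp.add_apply] at h1 ⊢
  constructor <;> linarith

lemma innerCube_subset {c : R3} {ℓ R : ℝ} (hR : 0 ≤ R) : innerCube c ℓ R ⊆ cube c ℓ :=
  fun z hz => mem_cube_of_norm_le hz (by simpa using hR)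

lemma volume_cube_diff_innerCube (c : R3) {ℓ θ : ℝ} (hℓ : 0 < ℓ) (hθ : 0 < θ) (hθ' : θ < 1 / 2) :
    volume (cube c ℓ \ innerCube c ℓ (θ * ℓ)) ≤ ENNReal.ofReal (6 * θ) * ENNReal.ofReal (ℓ ^ 3) := by
  have hR : 0 < θ * ℓ := by positivity
  have h2 : 0 ≤ ℓ - 2 * (θ * ℓ) := by nlinarith
  rw [measure_sdiff (innerCube_subset hR.le) (measurableSet_cube _ _).nullMeasurableSet
    (by rw [innerCube, volume_cube _ h2]; finiteness), volume_cube c hℓ.le, innerCube,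
    volume_cube _ h2, ← ENNReal.ofReal_sub _ (by positivity), ← ENNReal.ofReal_mul (by positivity)]
  refine ENNReal.ofReal_le_ofReal ?_
  have : ℓ ^ 3 - (ℓ - 2 * (θ * ℓ)) ^ 3 = ℓ ^ 3 * (6 * θ - 12 * θ ^ 2 + 8 * θ ^ 3) := by ring
  rw [this, mul_comm]
  gcongr
  nlinarith [sq_nonneg θ]

lemma volume_ball_le (z : R3) {ℓ θ : ℝ} (hℓ : 0 < ℓ) (hθ : 0 < θ) :
    volume (Metric.ball z (2 * (θ * ℓ))) ≤
      ENNReal.ofReal (64 * θ ^ 3) * ENNReal.ofReal (ℓ ^ 3) := by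
  rw [EuclideanSpace.volume_ball_fin_three, ← ENNReal.ofReal_pow (by positivity),
    ← ENNReal.ofReal_mul (by positivity), ← ENNReal.ofReal_mul (by positivity)]
  refine ENNReal.ofReal_le_ofReal ?_
  have h1 := Real.pi_le_four
  calc (2 * (θ * ℓ)) ^ 3 * (π * 4 / 3) = 8 * (π * 4 / 3) * (θ ^ 3 * ℓ ^ 3) := by ring
    _ ≤ 64 * (θ ^ 3 * ℓ ^ 3) := by gcongr; linarith
    _ = _ := by ring

/-- Several disjoint Dyson balls inside a cube. -/
lemma ScatteringData.dyson_cube (S : ScatteringData v φ R0 a) {R : ℝ} (hR : 2 * R0 < R)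
    {ψ : R3 → ℝ} (hψ : ContDiff ℝ 1 ψ) {ι : Type*} (J : Finset ι) (z : ι → R3) {c : R3} {ℓ : ℝ}
    (hin : ∀ j ∈ J, z j ∈ innerCube c ℓ R)
    (hsep : ∀ j ∈ J, ∀ k ∈ J, k ≠ j → 2 * R ≤ ‖z k - z j‖) :
    ∫⁻ y in cube c ℓ, ENNReal.ofReal (∑ j ∈ J, softW a R (y - z j) * ψ y ^ 2) ≤
      ∫⁻ y in cube c ℓ, ENNReal.ofReal (‖fderiv ℝ ψ y‖ ^ 2 +
        1 / 2 * ∑ j ∈ J, v (y - z j) * ψ y ^ 2) := by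
  have hR' : 0 < R := by have := S.R0_pos; linarith
  have hψm := hψ.continuous.measurable
  have hfm := (hψ.continuous_fderiv one_ne_zero).norm.measurable
  have hsm := softW_measurable (a := a) R
  have hhm := (hcut_contDiff R (n := 1)).continuous.measurable
  have hvm := S.meas
  have hs0 := softW_nonneg S.a_nonneg R
  have hv0 := S.nonneg
  have hh0 := hcut_nonneg R
  calc ∫⁻ y in cube c ℓ, ENNReal.ofReal (∑ j ∈ J, softW a R (y - z j) * ψ y ^ 2)
      ≤ ∫⁻ y, ENNReal.ofReal (∑ j ∈ J, softW a R (y - z j) * ψ y ^ 2) :=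
        setLIntegral_le_lintegral _ _
    _ = ∑ j ∈ J, ∫⁻ y, ENNReal.ofReal (softW a R (y - z j) * ψ y ^ 2) := by
        rw [← lintegral_finsetSum _ fun j _ => by fun_prop]
        congr 1; ext y
        rw [ENNReal.ofReal_sum_of_nonneg fun j _ => mul_nonneg (hs0 _) (sq_nonneg _)]
    _ ≤ ∑ j ∈ J, ∫⁻ y, ENNReal.ofReal
          (hcut R (y - z j) * (‖fderiv ℝ ψ y‖ ^ 2 + 1 / 2 * v (y - z j) * ψ y ^ 2)) := by
        exact Finset.sum_le_sum fun j _ => S.dyson_lintegral hR hψ (z j)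
    _ = ∫⁻ y, ENNReal.ofReal (∑ j ∈ J,
          hcut R (y - z j) * (‖fderiv ℝ ψ y‖ ^ 2 + 1 / 2 * v (y - z j) * ψ y ^ 2)) := by
        rw [← lintegral_finsetSum _ fun j _ => by fun_prop]
        congr 1; ext y
        rw [ENNReal.ofReal_sum_of_nonneg fun j _ => mul_nonneg (hh0 _) (by
          have := hv0 (y - z j); positivity)]
    _ ≤ ∫⁻ y in cube c ℓ, ENNReal.ofReal (‖fderiv ℝ ψ y‖ ^ 2 +
        1 / 2 * ∑ j ∈ J, v (y - z j) * ψ y ^ 2) := by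
        rw [← lintegral_indicator (measurableSet_cube c ℓ)]
        refine lintegral_mono fun y => ?_
        by_cases hy : ∃ j ∈ J, ‖y - z j‖ < R
        · obtain ⟨j, hj, hyj⟩ := hy
          rw [Set.indicator_of_mem (mem_cube_of_norm_le (hin j hj) hyj.le)]
          refine ENNReal.ofReal_le_ofReal ?_
          rw [Finset.sum_eq_single_of_mem j hj]
          · have h1 : v (y - z j) * ψ y ^ 2 ≤ ∑ j ∈ J, v (y - z j) * ψ y ^ 2 :=
              Finset.single_le_sum (f := fun j => v (y - z j) * ψ y ^ 2)
                (fun k _ => mul_nonneg (hv0 _) (sq_nonneg _)) hj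
            have h2 : 0 ≤ ‖fderiv ℝ ψ y‖ ^ 2 + 1 / 2 * v (y - z j) * ψ y ^ 2 := by
              have := hv0 (y - z j); positivity
            calc _ ≤ 1 * (‖fderiv ℝ ψ y‖ ^ 2 + 1 / 2 * v (y - z j) * ψ y ^ 2) := by
                  gcongr; exact hcut_le_one _ _
              _ ≤ _ := by linarith
          · intro k hk hkj
            have h1 := hsep j hj k hk hkj
            have h2 : ‖z k - z j‖ ≤ ‖y - z j‖ + ‖y - z k‖ := by
              rw [show z k - z j = (y - z j) - (y - z k) by abel]
              exact norm_sub_le _ _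
            rw [hcut_eq_zero hR' (by linarith), zero_mul]
        · push Not at hy
          rw [Finset.sum_eq_zero fun j hj => by rw [hcut_eq_zero hR' (hy j hj), zero_mul]]
          simp

lemma ScatteringData.lintegral_softW_cube (S : ScatteringData v φ R0 a) {R : ℝ} (hR : 2 * R0 < R)
    {z c : R3} {ℓ : ℝ} (hz : z ∈ innerCube c ℓ R) :
    ENNReal.ofReal (4 * π * a) ≤ ∫⁻ y in cube c ℓ, ENNReal.ofReal (softW a R (y - z)) := by
  have hR' : 0 < R := by have := S.R0_pos; linarith
  rw [← integral_softW (a := a) hR', ofReal_integral_eq_lintegral_ofReal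
    ((softW_continuous_aux S hR).integrable_of_hasCompactSupport (softW_hasCompactSupport hR'))
    (Eventually.of_forall fun x => softW_nonneg S.a_nonneg R x),
    ← lintegral_sub_right_eq_self _ z, ← lintegral_indicator (measurableSet_cube c ℓ)]
  refine lintegral_mono fun y => ?_
  by_cases hy : ‖y - z‖ ≤ R
  · rw [Set.indicator_of_mem (mem_cube_of_norm_le hz hy)]
  · rw [softW_eq_zero hR' (not_le.1 hy)]; simp

section Config

variable {ι : Type*} [Fintype ι] [DecidableEq ι]

/-- The interaction energy of a configuration. -/
def pairPot (v : R3 → ℝ) (X : ι → R3) : ℝ :=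
  ∑ i, 1 / 2 * ∑ j ∈ Finset.univ.erase i, v (X i - X j)

/-- Energy density of a wave function. -/
def energyDensity (v : R3 → ℝ) (Ψ : (ι → R3) → ℝ) (X : ι → R3) : ℝ :=
  ∑ i, kin i Ψ X + pairPot v X * Ψ X ^ 2

/-- Configurations in which particle `j` is away from the faces of the cube and from all other
particles except possibly `i`. -/
def goodSet (c : R3) (ℓ R : ℝ) (i j : ι) : Set (ι → R3) :=
  {X | X j ∈ innerCube c ℓ R ∧ ∀ k, k ≠ i → k ≠ j → 2 * R ≤ ‖X k - X j‖}

/-- The soft potential obtained from Dyson's lemma. -/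
def softPot (a : ℝ) (c : R3) (ℓ R : ℝ) (i : ι) (X : ι → R3) : ℝ :=
  ∑ j ∈ Finset.univ.erase i, (goodSet c ℓ R i j).indicator (fun X => softW a R (X i - X j)) X

lemma measurableSet_goodSet (c : R3) (ℓ R : ℝ) (i j : ι) :
    MeasurableSet (goodSet c ℓ R i j) := by
  have : goodSet c ℓ R i j = (fun X : ι → R3 => X j) ⁻¹' innerCube c ℓ R ∩
      ⋂ k, {X | k ≠ i → k ≠ j → 2 * R ≤ ‖X k - X j‖} := by
    ext X; simp [goodSet]
  rw [this]
  refine ((measurableSet_cube _ _).preimage (measurable_pi_apply j)).inter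
    (MeasurableSet.iInter fun k => ?_)
  by_cases h : k ≠ i ∧ k ≠ j
  · simp only [ne_eq, h.1, not_false_eq_true, h.2, forall_const]
    exact measurableSet_le measurable_const (by fun_prop)
  · have : {X : ι → R3 | k ≠ i → k ≠ j → 2 * R ≤ ‖X k - X j‖} = Set.univ := by
      ext X; simp only [Set.mem_ofPred_eq, Set.mem_univ, iff_true]
      exact fun h1 h2 => absurd ⟨h1, h2⟩ h
    rw [this]; exact MeasurableSet.univ

lemma update_mem_goodSet {c : R3} {ℓ R : ℝ} {i j : ι} (hij : j ≠ i) {X : ι → R3} {y : R3} :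
    Function.update X i y ∈ goodSet c ℓ R i j ↔ X ∈ goodSet c ℓ R i j := by
  simp only [goodSet, Set.mem_ofPred_eq, Function.update_of_ne hij]
  refine and_congr_right fun _ => forall_congr' fun k => ?_
  refine imp_congr_right fun hk => ?_
  rw [Function.update_of_ne hk]

lemma measurable_softPot (c : R3) (ℓ R : ℝ) (i : ι) : Measurable (softPot (ι := ι) a c ℓ R i) := by
  unfold softPot
  refine Finset.measurable_sum _ fun j _ => Measurable.indicator ?_ (measurableSet_goodSet _ _ _ _ _)
  have := softW_measurable (a := a) R
  fun_prop

lemma softPot_nonneg (ha : 0 ≤ a) (c : R3) (ℓ R : ℝ) (i : ι) (X : ι → R3) :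
    0 ≤ softPot a c ℓ R i X :=
  Finset.sum_nonneg fun j _ => Set.indicator_nonneg (fun _ _ => softW_nonneg ha _ _) _

lemma ScatteringData.lintegral_softPot_le (S : ScatteringData v φ R0 a) {R : ℝ} (hR : 2 * R0 < R)
    (c : R3) (ℓ : ℝ) {Ψ : (ι → R3) → ℝ} (hΨ : ContDiff ℝ 1 Ψ) :
    ∫⁻ X, ENNReal.ofReal ((∑ i, softPot a c ℓ R i X) * Ψ X ^ 2) ∂cubeMeasure ι c ℓ ≤
      ∫⁻ X, ENNReal.ofReal (energyDensity v Ψ X) ∂cubeMeasure ι c ℓ := by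
  classical
  have hv0 := S.nonneg
  have hvm := S.meas
  have hΨm := hΨ.continuous.measurable
  have hkm : ∀ i, Measurable (kin i Ψ) := fun i => (continuous_kin hΨ i).measurable
  have hsm : ∀ i, Measurable (softPot (ι := ι) a c ℓ R i) := measurable_softPot c ℓ R
  have e1 : ∀ X, ENNReal.ofReal ((∑ i, softPot a c ℓ R i X) * Ψ X ^ 2) =
      ∑ i, ENNReal.ofReal (softPot a c ℓ R i X * Ψ X ^ 2) := fun X => by
    rw [Finset.sum_mul, ENNReal.ofReal_sum_of_nonneg fun i _ =>
      mul_nonneg (softPot_nonneg S.a_nonneg _ _ _ _ _) (sq_nonneg _)]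
  have e2 : ∀ X, ENNReal.ofReal (energyDensity v Ψ X) =
      ∑ i, ENNReal.ofReal (kin i Ψ X +
        1 / 2 * (∑ j ∈ Finset.univ.erase i, v (X i - X j)) * Ψ X ^ 2) := fun X => by
    rw [energyDensity, pairPot, Finset.sum_mul, ← Finset.sum_add_distrib,
      ENNReal.ofReal_sum_of_nonneg fun i _ => add_nonneg (kin_nonneg _ _ _)
        (mul_nonneg (mul_nonneg (by norm_num) (Finset.sum_nonneg fun j _ => hv0 _)) (sq_nonneg _))]
  have m1 : ∀ i, Measurable fun X => ENNReal.ofReal (softPot a c ℓ R i X * Ψ X ^ 2) :=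
    fun i => by fun_prop
  have m2 : ∀ i, Measurable fun X => ENNReal.ofReal (kin i Ψ X +
      1 / 2 * (∑ j ∈ Finset.univ.erase i, v (X i - X j)) * Ψ X ^ 2) := fun i => by fun_prop
  simp_rw [e1, e2]
  rw [lintegral_finsetSum _ fun i _ => m1 i, lintegral_finsetSum _ fun i _ => m2 i]
  refine Finset.sum_le_sum fun i _ => ?_
  refine lintegral_le_of_slice _ i (m1 i) (m2 i) fun X => ?_
  set J := (Finset.univ.erase i).filter fun j => X ∈ goodSet c ℓ R i j with hJ
  have hJi : ∀ j ∈ J, j ≠ i := fun j hj => by simp [hJ] at hj; exact hj.1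
  have h1 := S.dyson_cube hR (contDiff_comp_update hΨ X i) J X (c := c) (ℓ := ℓ)
    (fun j hj => by simp only [hJ, Finset.mem_filter] at hj; exact hj.2.1)
    (fun j hj k hk hkj => by
      simp only [hJ, Finset.mem_filter] at hj
      exact hj.2.2 k (hJi k hk) hkj)
  have e3 : ∀ y, softPot a c ℓ R i (Function.update X i y) * Ψ (Function.update X i y) ^ 2 =
      ∑ j ∈ J, softW a R (y - X j) * Ψ (Function.update X i y) ^ 2 := by
    intro y
    rw [softPot, Finset.sum_mul, hJ, Finset.sum_filter]
    refine Finset.sum_congr rfl fun j hj => ?_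
    have hji : j ≠ i := Finset.ne_of_mem_erase hj
    by_cases h : X ∈ goodSet c ℓ R i j
    · rw [if_pos h, Set.indicator_of_mem ((update_mem_goodSet hji).2 h)]
      simp [Function.update_of_ne hji]
    · rw [if_neg h, Set.indicator_of_notMem (fun h' => h ((update_mem_goodSet hji).1 h')), zero_mul]
  simp_rw [e3]
  refine h1.trans (lintegral_mono fun y => ENNReal.ofReal_le_ofReal ?_)
  rw [kin_update, mul_assoc, Finset.sum_mul]
  gcongr
  have hs : ∑ j ∈ J, v (y - X j) * Ψ (Function.update X i y) ^ 2 ≤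
      ∑ j ∈ Finset.univ.erase i, v (y - X j) * Ψ (Function.update X i y) ^ 2 :=
    Finset.sum_le_sum_of_subset_of_nonneg (Finset.filter_subset _ _)
      fun j _ _ => mul_nonneg (hv0 _) (sq_nonneg _)
  refine hs.trans (le_of_eq (Finset.sum_congr rfl fun j hj => ?_))
  rw [Function.update_self, Function.update_of_ne (Finset.ne_of_mem_erase hj)]

/-- Most configurations are good. -/
lemma le_measure_goodSet (c : R3) {ℓ θ : ℝ} (hℓ : 0 < ℓ) (hθ : 0 < θ) (hθ' : θ < 1 / 2)
    {i j : ι} (hx : 6 * θ + Fintype.card ι * (64 * θ ^ 3) ≤ 1) :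
    ENNReal.ofReal (1 - (6 * θ + Fintype.card ι * (64 * θ ^ 3))) * cubeMeasure ι c ℓ Set.univ ≤
      cubeMeasure ι c ℓ (goodSet c ℓ (θ * ℓ) i j) := by
  set μ := cubeMeasure ι c ℓ with hμ
  set x := 6 * θ + Fintype.card ι * (64 * θ ^ 3) with hxdef
  have hQ : volume (cube c ℓ) = ENNReal.ofReal (ℓ ^ 3) := volume_cube c hℓ.le
  have hμfin : μ Set.univ ≠ ⊤ := by rw [hμ, cubeMeasure_univ c hℓ.le]; finiteness
  have slice : ∀ (k : ι) (s : Set (ι → R3)) (q : ℝ), MeasurableSet s → 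
      (∀ X, volume ({y | Function.update X k y ∈ s} ∩ cube c ℓ) ≤
        ENNReal.ofReal q * ENNReal.ofReal (ℓ ^ 3)) → μ s ≤ ENNReal.ofReal q * μ Set.univ := by
    intro k s q hs h
    rw [← lintegral_indicator_one hs, ← setLIntegral_const, setLIntegral_univ]
    refine lintegral_le_of_slice _ k (measurable_one.indicator hs) measurable_const fun X => ?_
    have hsm : MeasurableSet {y | Function.update X k y ∈ s} :=
      hs.preimage (measurable_update X)
    have e : ∀ y, s.indicator (1 : (ι → R3) → ENNReal) (Function.update X k y) =
        {y | Function.update X k y ∈ s}.indicator 1 y := fun y => rfl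
    simp_rw [e]
    rw [lintegral_indicator_one hsm, Measure.restrict_apply hsm, lintegral_const,
      Measure.restrict_apply_univ, hQ]
    exact h X
  have hmI : MeasurableSet {X : ι → R3 | X j ∉ innerCube c ℓ (θ * ℓ)} :=
    ((measurableSet_cube _ _).preimage (measurable_pi_apply j)).compl
  have hmB : ∀ k, MeasurableSet {X : ι → R3 | k ≠ j ∧ ‖X k - X j‖ < 2 * (θ * ℓ)} := fun k =>
    (MeasurableSet.const _).inter (measurableSet_lt
      ((measurable_pi_apply k).sub (measurable_pi_apply j)).norm measurable_const)
  have h1 : μ {X | X j ∉ innerCube c ℓ (θ * ℓ)} ≤ ENNReal.ofReal (6 * θ) * μ Set.univ := by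
    refine slice j _ _ hmI fun X => ?_
    refine le_trans (measure_mono ?_) (volume_cube_diff_innerCube c hℓ hθ hθ')
    rintro y ⟨hy, hyc⟩
    simp only [Set.mem_ofPred_eq, Function.update_self] at hy
    exact ⟨hyc, hy⟩
  have h2 : ∀ k, μ {X | k ≠ j ∧ ‖X k - X j‖ < 2 * (θ * ℓ)} ≤
      ENNReal.ofReal (64 * θ ^ 3) * μ Set.univ := by
    intro k
    refine slice k _ _ (hmB k) fun X => ?_
    refine le_trans (measure_mono ?_) (volume_ball_le (X j) hℓ hθ)
    rintro y ⟨⟨hkj, hy⟩, -⟩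
    rw [Function.update_self, Function.update_of_ne hkj.symm] at hy
    simpa [dist_eq_norm] using hy
  have hcover : Set.univ ⊆ goodSet c ℓ (θ * ℓ) i j ∪ ({X | X j ∉ innerCube c ℓ (θ * ℓ)} ∪
      ⋃ k, {X : ι → R3 | k ≠ j ∧ ‖X k - X j‖ < 2 * (θ * ℓ)}) := by
    intro X _
    by_contra h
    simp only [Set.mem_union, Set.mem_ofPred_eq, Set.mem_iUnion, not_or, not_exists, not_not,
      not_and, not_lt] at h
    exact h.1 ⟨h.2.1, fun k _ hk => h.2.2 k hk⟩
  have h3 : μ Set.univ ≤ μ (goodSet c ℓ (θ * ℓ) i j) + ENNReal.ofReal x * μ Set.univ := by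
    calc μ Set.univ ≤ _ := measure_mono hcover
      _ ≤ μ (goodSet c ℓ (θ * ℓ) i j) + (μ {X | X j ∉ innerCube c ℓ (θ * ℓ)} +
          ∑ k, μ {X : ι → R3 | k ≠ j ∧ ‖X k - X j‖ < 2 * (θ * ℓ)}) := by
          refine (measure_union_le _ _).trans ?_
          gcongr
          refine (measure_union_le _ _).trans ?_
          gcongr
          exact measure_iUnion_fintype_le _ _
      _ ≤ μ (goodSet c ℓ (θ * ℓ) i j) + (ENNReal.ofReal (6 * θ) * μ Set.univ +
          ∑ _k : ι, ENNReal.ofReal (64 * θ ^ 3) * μ Set.univ) := by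
          gcongr with k
          exact h2 k
      _ = _ := by
          rw [Finset.sum_const, nsmul_eq_mul, Finset.card_univ, hxdef,
            ENNReal.ofReal_add (by positivity) (by positivity),
            ENNReal.ofReal_mul (p := (Fintype.card ι : ℝ)) (by positivity),
            ENNReal.ofReal_natCast]
          ring
  have hxfin : ENNReal.ofReal x * μ Set.univ ≠ ⊤ := ENNReal.mul_ne_top (by simp) hμfin
  refine (ENNReal.add_le_add_iff_right hxfin).1 (le_trans (le_of_eq ?_) h3)
  rw [← add_mul, ← ENNReal.ofReal_add (by linarith) (by positivity)]
  simp

lemma ScatteringData.le_lintegral_softPot (S : ScatteringData v φ R0 a) (c : R3) {ℓ θ : ℝ}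
    (hℓ : 0 < ℓ) (hθ : 0 < θ) (hθ' : θ < 1 / 2) (hR : 2 * R0 < θ * ℓ)
    (hx : 6 * θ + Fintype.card ι * (64 * θ ^ 3) ≤ 1) :
    ENNReal.ofReal (4 * π * a * (Fintype.card ι * (Fintype.card ι - 1)) / ℓ ^ 3 *
        (1 - (6 * θ + Fintype.card ι * (64 * θ ^ 3)))) * cubeMeasure ι c ℓ Set.univ ≤
      ∫⁻ X, ENNReal.ofReal (∑ i, softPot a c ℓ (θ * ℓ) i X) ∂cubeMeasure ι c ℓ := by
  set μ := cubeMeasure ι c ℓ with hμ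
  set R := θ * ℓ with hRdef
  set p := 1 - (6 * θ + Fintype.card ι * (64 * θ ^ 3)) with hp
  have hp0 : 0 ≤ p := by linarith
  have ha := S.a_nonneg
  have hQ : volume (cube c ℓ) = ENNReal.ofReal (ℓ ^ 3) := volume_cube c hℓ.le
  have hsm := softW_measurable (a := a) R
  have pair : ∀ i j : ι, j ≠ i → ENNReal.ofReal (4 * π * a / ℓ ^ 3) * (ENNReal.ofReal p * μ Set.univ)
      ≤ ∫⁻ X, ENNReal.ofReal ((goodSet c ℓ R i j).indicator
        (fun X => softW a R (X i - X j)) X) ∂μ := by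
    intro i j hij
    have hgm := measurableSet_goodSet c ℓ R i j
    calc _ ≤ ENNReal.ofReal (4 * π * a / ℓ ^ 3) * μ (goodSet c ℓ R i j) := by
          gcongr; exact le_measure_goodSet c hℓ hθ hθ' hx
      _ = ∫⁻ X, (goodSet c ℓ R i j).indicator (fun _ => ENNReal.ofReal (4 * π * a / ℓ ^ 3)) X ∂μ := by
          rw [lintegral_indicator_const hgm]
      _ ≤ _ := by
          refine lintegral_le_of_slice _ i (measurable_const.indicator hgm)
            (Measurable.ennreal_ofReal (Measurable.indicator (by fun_prop) hgm)) fun X => ?_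
          by_cases h : X ∈ goodSet c ℓ R i j
          · simp_rw [Set.indicator_of_mem ((update_mem_goodSet hij).2 h)]
            rw [lintegral_const, Measure.restrict_apply_univ, hQ,
              ← ENNReal.ofReal_mul (by positivity), div_mul_cancel₀ _ (by positivity)]
            simp only [Function.update_self, Function.update_of_ne hij]
            exact S.lintegral_softW_cube hR h.1
          · have h' : ∀ y, Function.update X i y ∉ goodSet c ℓ R i j := fun y hy =>
              h ((update_mem_goodSet hij).1 hy)
            simp_rw [Set.indicator_of_notMem (h' _)]
            simp
  have hind : ∀ (i j : ι) (X : ι → R3), 0 ≤ (goodSet c ℓ R i j).indicator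
      (fun X => softW a R (X i - X j)) X := fun i j X =>
    Set.indicator_nonneg (fun _ _ => softW_nonneg ha _ _) _
  have e1 : ∀ X : ι → R3, ENNReal.ofReal (∑ i, softPot a c ℓ R i X) =
      ∑ i, ∑ j ∈ Finset.univ.erase i, ENNReal.ofReal ((goodSet c ℓ R i j).indicator
        (fun X => softW a R (X i - X j)) X) := fun X => by
    rw [ENNReal.ofReal_sum_of_nonneg fun i _ => softPot_nonneg ha _ _ _ _ _]
    refine Finset.sum_congr rfl fun i _ => ?_
    rw [softPot, ENNReal.ofReal_sum_of_nonneg fun j _ => hind i j X]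
  have hmij : ∀ i j : ι, Measurable fun X : ι → R3 =>
      ENNReal.ofReal ((goodSet c ℓ R i j).indicator (fun X => softW a R (X i - X j)) X) :=
    fun i j => Measurable.ennreal_ofReal
      (Measurable.indicator (by fun_prop) (measurableSet_goodSet c ℓ R i j))
  simp_rw [e1]
  rw [lintegral_finsetSum _ fun i _ => Finset.measurable_sum _ fun j _ => hmij i j]
  calc _ = ∑ i : ι, ∑ j ∈ Finset.univ.erase i,
        ENNReal.ofReal (4 * π * a / ℓ ^ 3) * (ENNReal.ofReal p * μ Set.univ) := by
        have hc : ∀ i : ι, ((Finset.univ.erase i).card : ENNReal) =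
            ENNReal.ofReal (Fintype.card ι - 1) := by
          intro i
          have hpos : 1 ≤ Fintype.card ι := Fintype.card_pos_iff.2 ⟨i⟩
          rw [Finset.card_erase_of_mem (Finset.mem_univ i), Finset.card_univ,
            ← ENNReal.ofReal_natCast, Nat.cast_sub hpos, Nat.cast_one]
        simp_rw [Finset.sum_const, nsmul_eq_mul, hc]
        rw [Finset.sum_const, nsmul_eq_mul, Finset.card_univ, ← ENNReal.ofReal_natCast]
        rcases isEmpty_or_nonempty ι with he | hne
        · simp
        have hpos : (1:ℝ) ≤ Fintype.card ι := by exact_mod_cast Fintype.card_pos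
        rw [show 4 * π * a * (Fintype.card ι * (Fintype.card ι - 1)) / ℓ ^ 3 * p =
          Fintype.card ι * ((Fintype.card ι - 1) * ((4 * π * a / ℓ ^ 3) * p)) by ring,
          ENNReal.ofReal_mul (by positivity), ENNReal.ofReal_mul (by linarith),
          ENNReal.ofReal_mul (by positivity)]
        ring
    _ ≤ _ := by
        gcongr with i
        rw [lintegral_finsetSum _ fun j _ => hmij i j]
        exact Finset.sum_le_sum fun j hj => pair i j (Finset.ne_of_mem_erase hj)

end Config

lemma box_bound_aux {E T P B A X M w wm p s κ δ C : ℝ} (hκ : 0 < κ) (hδ : κ = δ / 8) (hδ1 : δ < 1)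
    (hM : 0 ≤ M) (hX : 0 ≤ X) (hw : 0 ≤ w) (hp : 1 - κ ≤ p)
    (hC : (w * (1 + 1 / κ) + wm / κ) * C ≤ κ) (hwm : 0 ≤ wm)
    (h1 : A ≤ (1 + κ) * s ^ 2 * M + (1 + 1 / κ) * X)
    (h2 : (1 - κ) * s ^ 2 * B ≤ P + wm / κ * X) (h3 : w * p * M ≤ B) (h4 : X ≤ C * T)
    (h5 : T ≤ E) (h6 : P ≤ E) (hT : 0 ≤ T) : w * (1 - δ) * A ≤ E := by
  have hκ8 : κ < 1 / 8 := by linarith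
  have hsw : 0 ≤ s ^ 2 * w * M := by positivity
  have i1 : w * (1 - δ) * A ≤ (1 - δ) * (1 + κ) * (s ^ 2 * w * M) + w * (1 + 1 / κ) * X := by
    have : w * (1 - δ) * A ≤ w * (1 - δ) * ((1 + κ) * s ^ 2 * M + (1 + 1 / κ) * X) :=
      mul_le_mul_of_nonneg_left h1 (mul_nonneg hw (by linarith))
    have h' : 0 ≤ δ * (w * (1 + 1 / κ) * X) :=
      mul_nonneg (by linarith) (by positivity)
    linarith
  have i2 : (1 - δ) * (1 + κ) * (s ^ 2 * w * M) ≤ (1 - κ) ^ 2 * (1 - κ) * (s ^ 2 * w * M) := by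
    refine mul_le_mul_of_nonneg_right ?_ hsw
    rw [show δ = 8 * κ by linarith]
    nlinarith [mul_nonneg (sq_nonneg κ) (show 0 ≤ 1 - κ by linarith), sq_nonneg κ]
  have i3 : (1 - κ) ^ 2 * (1 - κ) * (s ^ 2 * w * M) ≤ (1 - κ) ^ 2 * s ^ 2 * B := by
    have : w * (1 - κ) * M ≤ B := le_trans (by gcongr) h3
    calc _ = (1 - κ) ^ 2 * s ^ 2 * (w * (1 - κ) * M) := by ring
      _ ≤ _ := by gcongr
  have i4 : (1 - κ) ^ 2 * s ^ 2 * B ≤ (1 - κ) * P + wm / κ * X := by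
    have := mul_le_mul_of_nonneg_left h2 (show 0 ≤ 1 - κ by linarith)
    have h' : 0 ≤ κ * (wm / κ * X) := by positivity
    linarith
  have i5 : (w * (1 + 1 / κ) + wm / κ) * X ≤ κ * T := by
    calc _ ≤ (w * (1 + 1 / κ) + wm / κ) * (C * T) := by gcongr
      _ = ((w * (1 + 1 / κ) + wm / κ) * C) * T := by ring
      _ ≤ _ := by gcongr
  have i6 : (1 - κ) * P ≤ (1 - κ) * E := mul_le_mul_of_nonneg_left h6 (by linarith)
  have i7 : κ * T ≤ κ * E := mul_le_mul_of_nonneg_left h5 hκ.le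
  linarith

lemma pairPot_nonneg {ι : Type*} [Fintype ι] [DecidableEq ι] (hv : ∀ x, 0 ≤ v x) (X : ι → R3) :
    0 ≤ pairPot v X :=
  Finset.sum_nonneg fun _ _ => mul_nonneg (by norm_num) (Finset.sum_nonneg fun _ _ => hv _)

set_option maxHeartbeats 1000000 in
/-- Lower bound on the energy of few particles in a large cube, without boundary conditions. -/
theorem ScatteringData.exists_box_bound (S : ScatteringData v φ R0 a) (n₀ : ℕ) {δ : ℝ} (hδ : 0 < δ)
    (hδ1 : δ < 1) : ∃ ℓ₀ > 0, ∀ ℓ ≥ ℓ₀, ∀ (ι : Type) [Fintype ι] [DecidableEq ι],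
      Fintype.card ι ≤ n₀ → ∀ (c : R3) (Ψ : (ι → R3) → ℝ), ContDiff ℝ 1 Ψ →
      ENNReal.ofReal (4 * π * a * (Fintype.card ι * (Fintype.card ι - 1)) / ℓ ^ 3 * (1 - δ)) *
        ∫⁻ X, ENNReal.ofReal (Ψ X ^ 2) ∂cubeMeasure ι c ℓ ≤
      ∫⁻ X, ENNReal.ofReal (energyDensity v Ψ X) ∂cubeMeasure ι c ℓ := by
  obtain ⟨D, hD0, hD⟩ := exists_deriv_st_le
  have ha := S.a_nonneg
  have hR0 := S.R0_pos
  set κ := δ / 8 with hκ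
  have hκ0 : 0 < κ := by positivity
  set θ := κ / (70 * (n₀ + 1)) with hθ
  have hθ0 : 0 < θ := by positivity
  have hθ1 : θ < 1 / 2 := by
    rw [hθ, div_lt_iff₀ (by positivity)]
    nlinarith [(Nat.cast_nonneg n₀ : (0:ℝ) ≤ n₀)]
  have hθκ : 70 * (n₀ + 1) * θ = κ := by rw [hθ]; field_simp
  set K := (4 * π * a * (n₀ * n₀) * (1 + 1 / κ) + n₀ * n₀ * (8 * a * D / θ ^ 3) / κ) *
    (2 ^ (3 * n₀) * (n₀ * 3)) with hK
  have hK0 : 0 ≤ K := by positivity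
  refine ⟨2 * R0 / θ + 1 + K / κ, by positivity, fun ℓ hℓ₀ ι _ _ hn c Ψ hΨ => ?_⟩
  have hℓ : 0 < ℓ := lt_of_lt_of_le (by positivity) hℓ₀
  have hR : 2 * R0 < θ * ℓ := by
    have : 2 * R0 / θ < ℓ := by
      have : 0 ≤ K / κ := by positivity
      linarith
    rw [div_lt_iff₀ hθ0] at this
    linarith
  have hKℓ : K / ℓ ≤ κ := by
    rw [div_le_iff₀ hℓ, ← div_le_iff₀' hκ0]
    have : 0 ≤ 2 * R0 / θ := by positivity
    linarith
  have hKe : (4 * π * a * (n₀ * n₀) / ℓ ^ 3 * (1 + 1 / κ) +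
      n₀ * n₀ * (8 * a * D / (θ * ℓ) ^ 3) / κ) * (2 ^ (3 * n₀) * (n₀ * (3 * ℓ ^ 2))) = K / ℓ := by
    clear_value κ θ
    rw [hK]
    field_simp
  clear_value K
  set μ := cubeMeasure ι c ℓ with hμ
  set n : ℝ := (Fintype.card ι : ℝ) with hndef
  have hnn : n ≤ n₀ := Nat.cast_le.2 hn
  have hn0 : 0 ≤ n := Nat.cast_nonneg _
  have hnn1 : 0 ≤ n * (n - 1) := by
    rcases Nat.eq_zero_or_pos (Fintype.card ι) with h | h
    · simp [hndef, h]
    · have : (1:ℝ) ≤ n := by rw [hndef]; exact_mod_cast h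
      exact mul_nonneg hn0 (by linarith)
  by_cases hE : ∫⁻ X, ENNReal.ofReal (energyDensity v Ψ X) ∂μ = ⊤
  · rw [hE]; exact le_top
  have hkm : ∀ i, Measurable (kin i Ψ) := fun i => (continuous_kin hΨ i).measurable
  have hΨm := hΨ.continuous.measurable
  have hsm : ∀ i, Measurable (softPot (ι := ι) a c ℓ (θ * ℓ) i) := measurable_softPot c ℓ _
  have hT : ∫⁻ X, ENNReal.ofReal (∑ i, kin i Ψ X) ∂μ ≤
      ∫⁻ X, ENNReal.ofReal (energyDensity v Ψ X) ∂μ := by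
    refine lintegral_mono fun X => ENNReal.ofReal_le_ofReal ?_
    have := pairPot_nonneg S.nonneg X
    rw [energyDensity]
    nlinarith [mul_nonneg this (sq_nonneg (Ψ X))]
  have hP := S.lintegral_softPot_le hR c ℓ hΨ
  have hx0 : 6 * θ + n * (64 * θ ^ 3) ≤ κ := by
    have h1 : θ ^ 3 ≤ θ := pow_le_of_le_one hθ0.le (by linarith) (by norm_num)
    have h2 : n * (64 * θ ^ 3) ≤ n₀ * (64 * θ) := by gcongr
    rw [← hθκ]
    nlinarith [mul_nonneg (Nat.cast_nonneg n₀ : (0:ℝ) ≤ n₀) hθ0.le]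
  have hB := S.le_lintegral_softPot (ι := ι) c hℓ hθ0 hθ1 hR (by linarith)
  obtain ⟨s, hs⟩ := poincare_cube hΨ c hℓ
  set w := 4 * π * a * (n * (n - 1)) / ℓ ^ 3 with hw
  have hw0 : 0 ≤ w := by positivity
  have hwle : w ≤ 4 * π * a * (n₀ * n₀) / ℓ ^ 3 := by
    have hnm : n * (n - 1) ≤ n₀ * n₀ := by nlinarith
    rw [hw]
    gcongr
  set wm := n * n * (8 * a * D / (θ * ℓ) ^ 3) with hwm
  set W : (ι → R3) → ℝ := fun X => ∑ i, softPot a c ℓ (θ * ℓ) i X with hW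
  have hW0 : ∀ X, 0 ≤ W X := fun X => Finset.sum_nonneg fun i _ => softPot_nonneg ha _ _ _ _ _
  have hWm : Measurable W := Finset.measurable_sum _ fun i _ => hsm i
  have hWle : ∀ X, W X ≤ wm := by
    intro X
    have h8 : 0 ≤ 8 * a * D / (θ * ℓ) ^ 3 := by positivity
    calc W X ≤ ∑ _i : ι, ∑ _j : ι, 8 * a * D / (θ * ℓ) ^ 3 := by
          refine Finset.sum_le_sum fun i _ => ?_
          refine le_trans (Finset.sum_le_sum fun j _ => ?_)
            (Finset.sum_le_sum_of_subset_of_nonneg (Finset.erase_subset i _) fun _ _ _ => h8)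
          refine Set.indicator_le' (fun _ _ => ?_) (fun _ _ => h8) X
          exact softW_le ha (by positivity) hD _
      _ = wm := by simp [hwm, hndef]; ring
  set CP := 2 ^ (3 * Fintype.card ι) * (n * (3 * ℓ ^ 2)) with hCP
  -- finiteness
  have hTf : ∫⁻ X, ENNReal.ofReal (∑ i, kin i Ψ X) ∂μ ≠ ⊤ := ne_top_of_le_ne_top hE hT
  have hPf : ∫⁻ X, ENNReal.ofReal (W X * Ψ X ^ 2) ∂μ ≠ ⊤ := ne_top_of_le_ne_top hE hP
  have hXf : ∫⁻ X, ENNReal.ofReal ((Ψ X - s) ^ 2) ∂μ ≠ ⊤ :=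
    ne_top_of_le_ne_top (by finiteness) hs
  have hMf : μ Set.univ ≠ ⊤ := by rw [hμ, cubeMeasure_univ c hℓ.le]; finiteness
  have h1 : ∫⁻ X, ENNReal.ofReal (Ψ X ^ 2) ∂μ ≤ ENNReal.ofReal ((1 + κ) * s ^ 2) * μ Set.univ +
      ENNReal.ofReal (1 + 1 / κ) * ∫⁻ X, ENNReal.ofReal ((Ψ X - s) ^ 2) ∂μ := by
    rw [← lintegral_const, ← lintegral_const_mul _ (by fun_prop),
      ← lintegral_add_left measurable_const]
    refine lintegral_mono fun X => ?_
    rw [← ENNReal.ofReal_mul (by positivity), ← ENNReal.ofReal_add (by positivity) (by positivity)]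
    refine ENNReal.ofReal_le_ofReal ?_
    have : (1 + κ) * s ^ 2 + (1 + 1 / κ) * (Ψ X - s) ^ 2 - Ψ X ^ 2 =
      (κ * s - (Ψ X - s)) ^ 2 / κ := by field_simp; ring
    have h' : 0 ≤ (κ * s - (Ψ X - s)) ^ 2 / κ := by positivity
    linarith
  have h2 : ENNReal.ofReal ((1 - κ) * s ^ 2) * ∫⁻ X, ENNReal.ofReal (W X) ∂μ ≤
      ∫⁻ X, ENNReal.ofReal (W X * Ψ X ^ 2) ∂μ +
      ENNReal.ofReal (wm / κ) * ∫⁻ X, ENNReal.ofReal ((Ψ X - s) ^ 2) ∂μ := by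
    rw [← lintegral_const_mul _ (by fun_prop), ← lintegral_const_mul _ (by fun_prop),
      ← lintegral_add_left (by fun_prop)]
    refine lintegral_mono fun X => ?_
    have hk1 : 0 ≤ 1 - κ := by linarith
    have hw1 := hW0 X
    have hw2 := hWle X
    rw [← ENNReal.ofReal_mul (by positivity), ← ENNReal.ofReal_mul (by positivity),
      ← ENNReal.ofReal_add (by positivity) (by positivity)]
    refine ENNReal.ofReal_le_ofReal ?_
    have e : W X * Ψ X ^ 2 + W X / κ * (Ψ X - s) ^ 2 - (1 - κ) * s ^ 2 * W X =
      W X * ((κ * s + (Ψ X - s)) ^ 2 / κ + (Ψ X - s) ^ 2) := by field_simp; ring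
    have h' : 0 ≤ W X * ((κ * s + (Ψ X - s)) ^ 2 / κ + (Ψ X - s) ^ 2) := by positivity
    have h'' : W X / κ * (Ψ X - s) ^ 2 ≤ wm / κ * (Ψ X - s) ^ 2 := by gcongr
    linarith
  have hAf : ∫⁻ X, ENNReal.ofReal (Ψ X ^ 2) ∂μ ≠ ⊤ := ne_top_of_le_ne_top (by finiteness) h1
  have hBf : ∫⁻ X, ENNReal.ofReal (W X) ∂μ ≠ ⊤ := by
    refine ne_top_of_le_ne_top (b := ENNReal.ofReal wm * μ Set.univ) (by finiteness) ?_
    rw [← lintegral_const]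
    exact lintegral_mono fun X => ENNReal.ofReal_le_ofReal (hWle X)
  generalize ∫⁻ X, ENNReal.ofReal (energyDensity v Ψ X) ∂μ = E at *
  generalize ∫⁻ X, ENNReal.ofReal (∑ i, kin i Ψ X) ∂μ = T at *
  generalize ∫⁻ X, ENNReal.ofReal (W X * Ψ X ^ 2) ∂μ = P at *
  generalize ∫⁻ X, ENNReal.ofReal ((Ψ X - s) ^ 2) ∂μ = Y at *
  generalize ∫⁻ X, ENNReal.ofReal (W X) ∂μ = B at *
  generalize ∫⁻ X, ENNReal.ofReal (Ψ X ^ 2) ∂μ = A at *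
  generalize μ Set.univ = M at *
  lift E to NNReal using hE
  lift T to NNReal using hTf
  lift P to NNReal using hPf
  lift Y to NNReal using hXf
  lift B to NNReal using hBf
  lift A to NNReal using hAf
  lift M to NNReal using hMf
  have hk1 : 0 ≤ 1 - κ := by linarith
  have hwm0 : 0 ≤ wm := by positivity
  have hp0 : 0 ≤ 1 - (6 * θ + n * (64 * θ ^ 3)) := by linarith
  simp only [← ENNReal.ofReal_coe_nnreal] at *
  rw [← ENNReal.ofReal_mul (mul_nonneg hw0 (by linarith)), ENNReal.ofReal_le_ofReal_iff E.coe_nonneg]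
  rw [ENNReal.ofReal_le_ofReal_iff E.coe_nonneg] at hT hP
  rw [← ENNReal.ofReal_mul (by positivity), ENNReal.ofReal_le_ofReal_iff B.coe_nonneg] at hB
  rw [← ENNReal.ofReal_mul (by positivity), ENNReal.ofReal_le_ofReal_iff (by positivity)] at hs
  rw [← ENNReal.ofReal_mul (by positivity), ← ENNReal.ofReal_mul (by positivity),
    ← ENNReal.ofReal_add (by positivity) (by positivity),
    ENNReal.ofReal_le_ofReal_iff (by positivity)] at h1
  rw [← ENNReal.ofReal_mul (by positivity), ← ENNReal.ofReal_mul (by positivity),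
    ← ENNReal.ofReal_add (by positivity) (by positivity),
    ENNReal.ofReal_le_ofReal_iff (by positivity)] at h2
  refine box_bound_aux hκ0 hκ hδ1 M.coe_nonneg Y.coe_nonneg hw0 (by linarith) ?_ hwm0 h1 h2 hB hs hT hP T.coe_nonneg
  refine le_trans ?_ hKℓ
  calc (w * (1 + 1 / κ) + wm / κ) * CP
      ≤ (4 * π * a * (n₀ * n₀) / ℓ ^ 3 * (1 + 1 / κ) +
        n₀ * n₀ * (8 * a * D / (θ * ℓ) ^ 3) / κ) * (2 ^ (3 * n₀) * (n₀ * (3 * ℓ ^ 2))) := by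
        have h2n : (2:ℝ) ^ (3 * Fintype.card ι) ≤ 2 ^ (3 * n₀) :=
          pow_le_pow_right₀ (by norm_num) (by omega)
        rw [hwm, hCP]
        gcongr
    _ = K / ℓ := hKe

/-- Particles distributed among boxes can be grouped into clusters of at most `2 * p` particles,
each contained in one box, such that the number of pairs in clusters is large. -/
lemma exists_clusters {ι β : Type*} [DecidableEq ι] [DecidableEq β] (α : ι → β) (p : ℕ)
    (hp : 0 < p) (S : Finset ι) : ∃ P : Finset (Finset ι),
      (∀ T ∈ P, T ⊆ S ∧ T.card ≤ 2 * p ∧ ∀ i ∈ T, ∀ j ∈ T, α i = α j) ∧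
      (P : Set (Finset ι)).PairwiseDisjoint id ∧
      (2 * p - 1) * (S.card : ℝ) - p ^ 2 * (S.image α).card ≤
        ∑ T ∈ P, (T.card : ℝ) * (T.card - 1) := by
  induction S using Finset.strongInduction with
  | H S ih =>
  rcases S.eq_empty_or_nonempty with rfl | ⟨i₀, hi₀⟩
  · exact ⟨∅, by simp⟩
  set F := S.filter fun i => α i = α i₀ with hF
  have hFS : F ⊆ S := Finset.filter_subset _ _
  have hiF : i₀ ∈ F := by simp [hF, hi₀]
  obtain ⟨T, hTF, hTne, hTc, hT⟩ : ∃ T ⊆ F, T.Nonempty ∧ T.card ≤ 2 * p ∧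
      (2 * p - 1) * (T.card : ℝ) + p ^ 2 * ((S \ T).image α).card - p ^ 2 * (S.image α).card ≤
        (T.card : ℝ) * (T.card - 1) := by
    by_cases h : F.card ≤ 2 * p
    · refine ⟨F, subset_rfl, ⟨i₀, hiF⟩, h, ?_⟩
      have h1 : (S \ F).image α ⊂ S.image α := by
        refine (Finset.ssubset_iff_of_subset (Finset.image_subset_image Finset.sdiff_subset)).2
          ⟨α i₀, Finset.mem_image_of_mem _ hi₀, ?_⟩
        simp only [Finset.mem_image, Finset.mem_sdiff, not_exists, not_and, and_imp]
        intro x hx hxF hxα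
        exact hxF (by simp [hF, hx, hxα])
      have h2 : (((S \ F).image α).card : ℝ) + 1 ≤ (S.image α).card := by
        exact_mod_cast Finset.card_lt_card h1
      have h3 : (p:ℝ) ^ 2 * (((S \ F).image α).card + 1) ≤ p ^ 2 * (S.image α).card := by gcongr
      nlinarith [sq_nonneg ((F.card : ℝ) - p)]
    · obtain ⟨T, hTF, hTc⟩ := Finset.exists_subset_card_eq (not_le.1 h).le
      refine ⟨T, hTF, Finset.card_pos.1 (by omega), hTc.le, ?_⟩
      have h2 : (((S \ T).image α).card : ℝ) ≤ (S.image α).card := by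
        exact_mod_cast Finset.card_le_card (Finset.image_subset_image Finset.sdiff_subset)
      have h3 : (p:ℝ) ^ 2 * ((S \ T).image α).card ≤ p ^ 2 * (S.image α).card := by gcongr
      rw [hTc]; push_cast; nlinarith
  obtain ⟨P, hP, hPd, hPs⟩ := ih (S \ T)
    (Finset.sdiff_ssubset (hTF.trans hFS) hTne)
  have hdis : ∀ T' ∈ P, Disjoint T T' := fun T' hT' =>
    Finset.disjoint_of_subset_right (hP T' hT').1 Finset.disjoint_sdiff
  have hTP : T ∉ P := fun h => hTne.ne_empty (disjoint_self.1 (hdis T h))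
  refine ⟨insert T P, ?_, ?_, ?_⟩
  · intro T' hT'
    rcases Finset.mem_insert.1 hT' with rfl | hT'
    · refine ⟨hTF.trans hFS, hTc, fun i hi j hj => ?_⟩
      have hi' := hTF hi
      have hj' := hTF hj
      simp only [hF, Finset.mem_filter] at hi' hj'
      rw [hi'.2, hj'.2]
    · exact ⟨(hP T' hT').1.trans Finset.sdiff_subset, (hP T' hT').2⟩
  · rw [Finset.coe_insert]
    exact hPd.insert fun T' hT' _ => hdis T' hT'
  · rw [Finset.sum_insert hTP]
    have hc : ((S \ T).card : ℝ) = S.card - T.card := by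
      rw [Finset.card_sdiff_of_subset (hTF.trans hFS),
        Nat.cast_sub (Finset.card_le_card (hTF.trans hFS))]
    rw [hc] at hPs
    linarith

section

variable {ι : Type*} [Fintype ι] [DecidableEq ι]

/-- Energy density of the particles in `T`. -/
def clusterEnergy (v : R3 → ℝ) (T : Finset ι) (Ψ : (ι → R3) → ℝ) (X : ι → R3) : ℝ :=
  ∑ i ∈ T, (kin i Ψ X + 1 / 2 * (∑ j ∈ T.erase i, v (X i - X j)) * Ψ X ^ 2)

lemma clusterEnergy_nonneg (hv : ∀ x, 0 ≤ v x) (T : Finset ι) (Ψ : (ι → R3) → ℝ) (X : ι → R3) :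
    0 ≤ clusterEnergy v T Ψ X :=
  Finset.sum_nonneg fun i _ => add_nonneg (kin_nonneg _ _ _)
    (mul_nonneg (mul_nonneg (by norm_num) (Finset.sum_nonneg fun _ _ => hv _)) (sq_nonneg _))

lemma sum_clusterEnergy_le (hv : ∀ x, 0 ≤ v x) {P : Finset (Finset ι)}
    (hP : (P : Set (Finset ι)).PairwiseDisjoint id) (Ψ : (ι → R3) → ℝ) (X : ι → R3) :
    ∑ T ∈ P, clusterEnergy v T Ψ X ≤ energyDensity v Ψ X := by
  set g : ι → ℝ := fun i =>
    kin i Ψ X + 1 / 2 * (∑ j ∈ Finset.univ.erase i, v (X i - X j)) * Ψ X ^ 2 with hg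
  have hg0 : ∀ i, 0 ≤ g i := fun i => add_nonneg (kin_nonneg _ _ _)
    (mul_nonneg (mul_nonneg (by norm_num) (Finset.sum_nonneg fun _ _ => hv _)) (sq_nonneg _))
  calc ∑ T ∈ P, clusterEnergy v T Ψ X ≤ ∑ T ∈ P, ∑ i ∈ T, g i := by
        refine Finset.sum_le_sum fun T _ => Finset.sum_le_sum fun i _ => ?_
        simp only [hg]
        gcongr
        exact fun j _ _ => hv _
        exact Finset.subset_univ T
    _ = ∑ i ∈ P.biUnion id, g i := (Finset.sum_biUnion hP).symm
    _ ≤ ∑ i, g i := Finset.sum_le_sum_of_subset_of_nonneg (Finset.subset_univ _)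
        fun i _ _ => hg0 i
    _ = energyDensity v Ψ X := by
        rw [energyDensity, pairPot, Finset.sum_mul, ← Finset.sum_add_distrib]

lemma measurable_clusterEnergy (hv : Measurable v) (T : Finset ι) {Ψ : (ι → R3) → ℝ}
    (hΨ : ContDiff ℝ 1 Ψ) : Measurable (clusterEnergy v T Ψ) := by
  have hkm : ∀ i, Measurable (kin i Ψ) := fun i => (continuous_kin hΨ i).measurable
  have hΨm := hΨ.continuous.measurable
  unfold clusterEnergy
  fun_prop

lemma updateFinset_update (X : ι → R3) (T : Finset ι) (Y : T → R3) (i : T) (y : R3) :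
    Function.updateFinset X T (Function.update Y i y) =
      Function.update (Function.updateFinset X T Y) i y := by
  ext1 j
  by_cases hj : j ∈ T
  · by_cases hji : j = i
    · subst hji; simp [Function.updateFinset]
    · have : (⟨j, hj⟩ : T) ≠ i := fun h => hji (by rw [← h])
      simp [Function.updateFinset, hj, Function.update_of_ne hji, Function.update_of_ne this]
  · have hji : j ≠ i := fun h => hj (by rw [h]; exact i.2)
    simp [Function.updateFinset, hj, Function.update_of_ne hji]

lemma contDiff_updateFinset (X : ι → R3) (T : Finset ι) :
    ContDiff ℝ 1 fun Y : T → R3 => Function.updateFinset X T Y := by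
  rw [contDiff_pi]
  intro j
  by_cases hj : j ∈ T
  · simp only [Function.updateFinset, hj, dif_pos]; fun_prop
  · simp only [Function.updateFinset, hj, dif_neg, not_false_eq_true]; fun_prop

lemma energyDensity_updateFinset (v : R3 → ℝ) (T : Finset ι) (Ψ : (ι → R3) → ℝ) (X : ι → R3)
    (Y : T → R3) : energyDensity v (fun Y : T → R3 => Ψ (Function.updateFinset X T Y)) Y =
      clusterEnergy v T Ψ (Function.updateFinset X T Y) := by
  have hY : ∀ i : T, Function.updateFinset X T Y i = Y i := fun i => by
    simp [Function.updateFinset]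
  rw [energyDensity, pairPot, Finset.sum_mul, ← Finset.sum_add_distrib, clusterEnergy,
    ← Finset.sum_coe_sort T]
  refine Finset.sum_congr rfl fun i _ => ?_
  congr 1
  · simp only [kin, updateFinset_update, hY]
  · congr 2
    rw [Finset.sum_erase_eq_sub (Finset.mem_univ i), Finset.sum_erase_eq_sub i.2,
      ← Finset.sum_coe_sort T]
    simp only [hY]

/-- Lower bound for a cluster of particles in one cube. -/
lemma lintegral_clusterEnergy_ge (hv : Measurable v) (c : ι → R3) (ℓ : ℝ) (T : Finset ι)
    (hT : ∀ i ∈ T, ∀ j ∈ T, c i = c j) {Ψ : (ι → R3) → ℝ} (hΨ : ContDiff ℝ 1 Ψ) {w : ENNReal}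
    (hbox : ∀ (d : R3) (Φ : (T → R3) → ℝ), ContDiff ℝ 1 Φ →
      w * ∫⁻ Y, ENNReal.ofReal (Φ Y ^ 2) ∂cubeMeasure T d ℓ ≤
        ∫⁻ Y, ENNReal.ofReal (energyDensity v Φ Y) ∂cubeMeasure T d ℓ) :
    w * ∫⁻ X, ENNReal.ofReal (Ψ X ^ 2) ∂Measure.pi (fun i => volume.restrict (cube (c i) ℓ)) ≤
      ∫⁻ X, ENNReal.ofReal (clusterEnergy v T Ψ X)
        ∂Measure.pi (fun i => volume.restrict (cube (c i) ℓ)) := by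
  have hΨm := hΨ.continuous.measurable
  have m1 : Measurable fun X => ENNReal.ofReal (Ψ X ^ 2) := by fun_prop
  rw [← lintegral_const_mul _ m1]
  refine lintegral_le_of_lmarginal_le T (m1.const_mul _)
    (measurable_clusterEnergy hv T hΨ).ennreal_ofReal fun X => ?_
  obtain ⟨d, hd⟩ : ∃ d, ∀ i : T, c i = d := by
    rcases T.eq_empty_or_nonempty with rfl | ⟨i₀, hi₀⟩
    · exact ⟨0, fun i => absurd i.2 (Finset.notMem_empty _)⟩
    · exact ⟨c i₀, fun i => hT i i.2 i₀ hi₀⟩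
  have m2 : Measurable fun Y : T → R3 => ENNReal.ofReal (Ψ (Function.updateFinset X T Y) ^ 2) :=
    m1.comp (contDiff_updateFinset X T).continuous.measurable
  have h := hbox d _ (hΨ.comp (contDiff_updateFinset X T))
  simp only [lmarginal, hd]
  rw [lintegral_const_mul _ m2]
  refine h.trans (le_of_eq ?_)
  refine lintegral_congr fun Y => ?_
  rw [← energyDensity_updateFinset]
  rfl

end

/-- Corner of the cell with index `b`. -/
def corner {m : ℕ} (ℓ : ℝ) (b : Fin 3 → Fin m) : R3 := WithLp.toLp 2 fun j => ((b j : ℕ) : ℝ) * ℓ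

lemma mem_cube_corner {m : ℕ} {ℓ : ℝ} (hℓ : 0 < ℓ) (b : Fin 3 → Fin m) (x : R3) :
    x ∈ cube (corner ℓ b) ℓ ↔ ∀ j, ⌊x j / ℓ⌋ = ((b j : ℕ) : ℤ) := by
  refine forall_congr' fun j => ?_
  rw [Int.floor_eq_iff, le_div_iff₀ hℓ, div_lt_iff₀ hℓ, Set.mem_Ico, corner]
  simp only [Int.cast_natCast, add_mul, one_mul]

lemma mem_cube_zero_iff {m : ℕ} {ℓ : ℝ} (hℓ : 0 < ℓ) (x : R3) :
    x ∈ cube 0 (m * ℓ) ↔ ∃ b : Fin 3 → Fin m, x ∈ cube (corner ℓ b) ℓ := by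
  simp_rw [mem_cube_corner hℓ]
  constructor
  · intro hx
    have h : ∀ j, ∃ b : Fin m, ⌊x j / ℓ⌋ = ((b : ℕ) : ℤ) := by
      intro j
      have h1 := hx j
      simp only [PiLp.zero_apply, zero_add, Set.mem_Ico] at h1
      have h2 : 0 ≤ ⌊x j / ℓ⌋ := Int.floor_nonneg.2 (div_nonneg h1.1 hℓ.le)
      have h3 : ⌊x j / ℓ⌋ < m := by
        rw [Int.floor_lt, div_lt_iff₀ hℓ]; exact_mod_cast h1.2
      exact ⟨⟨⌊x j / ℓ⌋.toNat, by omega⟩, by simp [h2]⟩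
    choose b hb using h
    exact ⟨b, hb⟩
  · rintro ⟨b, hb⟩ j
    have h1 := hb j
    rw [Int.floor_eq_iff, le_div_iff₀ hℓ, div_lt_iff₀ hℓ] at h1
    push_cast at h1
    have h2 : ((b j : ℕ) : ℝ) + 1 ≤ m := by exact_mod_cast (b j).2
    simp only [PiLp.zero_apply, zero_add, Set.mem_Ico]
    refine ⟨le_trans (by positivity) h1.1, h1.2.trans_le (by gcongr)⟩

lemma lintegral_tiling {ι : Type*} [Fintype ι] [DecidableEq ι] (m : ℕ) {ℓ : ℝ} (hℓ : 0 < ℓ)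
    (f : (ι → R3) → ENNReal) :
    ∫⁻ X, f X ∂cubeMeasure ι 0 (m * ℓ) = ∑ α : ι → Fin 3 → Fin m,
      ∫⁻ X, f X ∂Measure.pi fun i => volume.restrict (cube (corner ℓ (α i)) ℓ) := by
  have hU : (Set.univ.pi fun _ : ι => cube 0 (m * ℓ)) =
      ⋃ α : ι → Fin 3 → Fin m, Set.univ.pi fun i => cube (corner ℓ (α i)) ℓ := by
    ext X
    simp only [Set.mem_univ_pi, Set.mem_iUnion, mem_cube_zero_iff hℓ]
    exact Classical.skolem
  rw [cubeMeasure_eq, hU, lintegral_iUnion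
    (fun α => MeasurableSet.univ_pi fun i => measurableSet_cube _ _), tsum_fintype]
  · refine Finset.sum_congr rfl fun α _ => ?_
    rw [volume_pi, Measure.restrict_pi_pi]
  · intro α β hαβ
    rw [Function.onFun, Set.disjoint_left]
    intro X h1 h2
    refine hαβ (funext fun i => funext fun j => ?_)
    have h3 := (mem_cube_corner hℓ _ _).1 (h1 i (Set.mem_univ i)) j
    have h4 := (mem_cube_corner hℓ _ _).1 (h2 i (Set.mem_univ i)) j
    rw [h3] at h4
    exact Fin.ext (by exact_mod_cast h4)

/-- Lower bound on the energy of `p * m ^ 3` particles in a cube of side `m * ℓ`. -/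
theorem ScatteringData.exists_lower_bound (S : ScatteringData v φ R0 a) {p : ℕ} (hp : 0 < p)
    {δ : ℝ} (hδ : 0 < δ) (hδ1 : δ < 1) : ∃ ℓ₀ > 0, ∀ ℓ ≥ ℓ₀, ∀ m : ℕ,
      ∀ (ι : Type) [Fintype ι] [DecidableEq ι], Fintype.card ι = p * m ^ 3 →
      ∀ Ψ : (ι → R3) → ℝ, ContDiff ℝ 1 Ψ →
      ENNReal.ofReal (4 * π * a * (1 - δ) / ℓ ^ 3 * (p * (p - 1) * m ^ 3)) *
        ∫⁻ X, ENNReal.ofReal (Ψ X ^ 2) ∂cubeMeasure ι 0 (m * ℓ) ≤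
      ∫⁻ X, ENNReal.ofReal (energyDensity v Ψ X) ∂cubeMeasure ι 0 (m * ℓ) := by
  obtain ⟨ℓ₀, hℓ₀, hbox⟩ := S.exists_box_bound (2 * p) hδ hδ1
  refine ⟨ℓ₀, hℓ₀, fun ℓ hℓ m ι _ _ hι Ψ hΨ => ?_⟩
  have hℓ0 : 0 < ℓ := hℓ₀.trans_le hℓ
  have ha := S.a_nonneg
  have hδ' : 0 ≤ 1 - δ := by linarith
  rw [lintegral_tiling m hℓ0, lintegral_tiling m hℓ0, Finset.mul_sum]
  refine Finset.sum_le_sum fun α _ => ?_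
  obtain ⟨P, hP, hPd, hPs⟩ := exists_clusters α p hp Finset.univ
  set μ := Measure.pi fun i => volume.restrict (cube (corner ℓ (α i)) ℓ)
  have hn : ∀ T : Finset ι, 0 ≤ (T.card : ℝ) * (T.card - 1) := fun T => by
    rcases Nat.eq_zero_or_pos T.card with h | h
    · simp [h]
    · have : (1:ℝ) ≤ T.card := by exact_mod_cast h
      exact mul_nonneg (by linarith) (by linarith)
  have hsum : p * (p - 1) * (m:ℝ) ^ 3 ≤ ∑ T ∈ P, (T.card : ℝ) * (T.card - 1) := by
    refine le_trans ?_ hPs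
    have h1 : ((Finset.univ.image α).card : ℝ) ≤ m ^ 3 := by
      have := Finset.card_le_univ (Finset.univ.image α)
      simp only [Fintype.card_fun, Fintype.card_fin] at this
      exact_mod_cast this
    rw [Finset.card_univ, hι]
    push_cast
    nlinarith [mul_le_mul_of_nonneg_left h1 (sq_nonneg (p:ℝ))]
  calc _ ≤ ENNReal.ofReal (∑ T ∈ P, 4 * π * a * (T.card * (T.card - 1)) / ℓ ^ 3 * (1 - δ)) *
        ∫⁻ X, ENNReal.ofReal (Ψ X ^ 2) ∂μ := by
        gcongr
        calc _ ≤ 4 * π * a * (1 - δ) / ℓ ^ 3 * ∑ T ∈ P, (T.card : ℝ) * (T.card - 1) := by gcongr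
          _ = _ := by rw [Finset.mul_sum]; exact Finset.sum_congr rfl fun T _ => by ring
    _ = ∑ T ∈ P, ENNReal.ofReal (4 * π * a * (T.card * (T.card - 1)) / ℓ ^ 3 * (1 - δ)) *
        ∫⁻ X, ENNReal.ofReal (Ψ X ^ 2) ∂μ := by
        rw [ENNReal.ofReal_sum_of_nonneg fun T _ => by have := hn T; positivity, Finset.sum_mul]
    _ ≤ ∑ T ∈ P, ∫⁻ X, ENNReal.ofReal (clusterEnergy v T Ψ X) ∂μ := by
        refine Finset.sum_le_sum fun T hT => ?_
        refine lintegral_clusterEnergy_ge S.meas (fun i => corner ℓ (α i)) ℓ T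
          (fun i hi j hj => by rw [(hP T hT).2.2 i hi j hj]) hΨ fun d Φ hΦ => ?_
        have h := hbox ℓ hℓ T (by simpa using (hP T hT).2.1) d Φ hΦ
        simpa only [Fintype.card_coe] using h
    _ = ∫⁻ X, ENNReal.ofReal (∑ T ∈ P, clusterEnergy v T Ψ X) ∂μ := by
        rw [← lintegral_finsetSum _ fun T _ =>
          (measurable_clusterEnergy S.meas T hΨ).ennreal_ofReal]
        refine lintegral_congr fun X => ?_
        rw [ENNReal.ofReal_sum_of_nonneg fun T _ => clusterEnergy_nonneg S.nonneg T Ψ X]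
    _ ≤ _ := lintegral_mono fun X =>
        ENNReal.ofReal_le_ofReal (sum_clusterEnergy_le S.nonneg hPd Ψ X)

lemma norm_sq_eq_sum_apply_single (A : R3 →L[ℝ] ℝ) :
    ‖A‖ ^ 2 = ∑ j : Fin 3, A (EuclideanSpace.single j 1) ^ 2 := by
  rw [← (InnerProductSpace.toDual ℝ R3).symm.norm_map, EuclideanSpace.norm_sq_eq]
  refine Finset.sum_congr rfl fun j _ => ?_
  rw [← InnerProductSpace.toDual_symm_apply (𝕜 := ℝ), EuclideanSpace.inner_single_right]
  simp

lemma gradSq_eq {f : R3 → ℂ} {x : R3} (hf : DifferentiableAt ℝ f x) :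
    gradSq f x = ‖fderiv ℝ (fun y => (f y).re) x‖ ^ 2 + ‖fderiv ℝ (fun y => (f y).im) x‖ ^ 2 := by
  have hre : fderiv ℝ (fun y => (f y).re) x = Complex.reCLM.comp (fderiv ℝ f x) :=
    (Complex.reCLM.hasFDerivAt.comp x hf.hasFDerivAt).fderiv
  have him : fderiv ℝ (fun y => (f y).im) x = Complex.imCLM.comp (fderiv ℝ f x) :=
    (Complex.imCLM.hasFDerivAt.comp x hf.hasFDerivAt).fderiv
  rw [norm_sq_eq_sum_apply_single, norm_sq_eq_sum_apply_single, gradSq, ← Finset.sum_add_distrib]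
  refine Finset.sum_congr rfl fun j _ => ?_
  rw [hre, him, Complex.sq_norm, Complex.normSq_apply]
  simp [sq]

/-- The interaction as a sum over ordered pairs. -/
lemma pairPot_eq_sum_lt (hv : ∀ x y : R3, ‖x‖ = ‖y‖ → v x = v y) {N : ℕ} (X : Fin N → R3) :
    pairPot v X = ∑ i, ∑ j, if i < j then v (X i - X j) else 0 := by
  set A := ∑ i, ∑ j, if i < j then v (X i - X j) else 0 with hA
  have h1 : ∑ i, ∑ j ∈ Finset.univ.erase i, v (X i - X j) =
      ∑ i, ∑ j, ((if i < j then v (X i - X j) else 0) + if j < i then v (X j - X i) else 0) := by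
    refine Finset.sum_congr rfl fun i _ => ?_
    rw [← Finset.add_sum_erase Finset.univ _ (Finset.mem_univ i)]
    simp only [lt_self_iff_false, if_false, add_zero, zero_add]
    refine Finset.sum_congr rfl fun j hj => ?_
    rcases lt_or_gt_of_ne (Finset.ne_of_mem_erase hj) with h | h
    · rw [if_neg h.asymm, if_pos h, zero_add, hv _ _ (norm_sub_rev _ _)]
    · rw [if_pos h, if_neg h.asymm, add_zero]
  have h2 : ∑ i, ∑ j, (if j < i then v (X j - X i) else 0) = A := Finset.sum_comm
  simp_rw [Finset.sum_add_distrib] at h1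
  rw [h2, ← hA] at h1
  rw [pairPot, ← Finset.mul_sum, h1]
  ring

lemma energyForm_integrand_eq (hv : ∀ x y : R3, ‖x‖ = ‖y‖ → v x = v y) {N : ℕ}
    {Ψ : (Fin N → R3) → ℂ} (hΨ : Differentiable ℝ Ψ) (X : Fin N → R3) :
    ((∑ i, gradSq (fun y => Ψ (Function.update X i y)) (X i)) +
      ∑ i, ∑ j, if i < j then v (X i - X j) * ‖Ψ X‖ ^ 2 else 0) =
    energyDensity v (fun X => (Ψ X).re) X + energyDensity v (fun X => (Ψ X).im) X := by
  have h1 : ∀ i, gradSq (fun y => Ψ (Function.update X i y)) (X i) =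
      kin i (fun X => (Ψ X).re) X + kin i (fun X => (Ψ X).im) X := fun i =>
    gradSq_eq ((hΨ _).comp _ (hasFDerivAt_update (𝕜 := ℝ) X (X i)).differentiableAt)
  have h2 : (∑ i, ∑ j, if i < j then v (X i - X j) * ‖Ψ X‖ ^ 2 else 0) =
      pairPot v X * ((Ψ X).re ^ 2 + (Ψ X).im ^ 2) := by
    have h3 : ‖Ψ X‖ ^ 2 = (Ψ X).re ^ 2 + (Ψ X).im ^ 2 := by
      rw [Complex.sq_norm, Complex.normSq_apply]; ring
    rw [pairPot_eq_sum_lt hv, h3, Finset.sum_mul]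
    refine Finset.sum_congr rfl fun i _ => ?_
    rw [Finset.sum_mul]
    exact Finset.sum_congr rfl fun j _ => by split_ifs <;> ring
  simp_rw [h1, h2, Finset.sum_add_distrib, energyDensity]
  ring

section

variable {ι : Type*} [Fintype ι] [DecidableEq ι]

lemma energyDensity_nonneg (hv : ∀ x, 0 ≤ v x) (Ψ : (ι → R3) → ℝ) (X : ι → R3) :
    0 ≤ energyDensity v Ψ X :=
  add_nonneg (Finset.sum_nonneg fun i _ => kin_nonneg i Ψ X)
    (mul_nonneg (pairPot_nonneg hv X) (sq_nonneg _))

lemma measurable_pairPot (hv : Measurable v) : Measurable (pairPot (ι := ι) v) := by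
  unfold pairPot; fun_prop

lemma integrable_energyDensity (hv : Measurable v) (hv0 : ∀ x, 0 ≤ v x) (hvb : ∃ C, ∀ x, v x ≤ C)
    {Ψ : (ι → R3) → ℝ} (hΨ : ContDiff ℝ 1 Ψ) (hc : HasCompactSupport Ψ) :
    Integrable (energyDensity v Ψ) := by
  obtain ⟨C, hC⟩ := hvb
  refine Integrable.add (integrable_finsetSum _ fun i _ => ?_) ?_
  · refine (continuous_kin hΨ i).integrable_of_hasCompactSupport ?_
    refine (hc.fderiv (𝕜 := ℝ)).mono fun X hX => ?_
    rw [Function.mem_support, kin_eq hΨ] at hX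
    rw [Function.mem_support]
    intro h
    rw [h] at hX
    simp at hX
  · have h1 : Integrable fun X => Ψ X ^ 2 :=
      (hΨ.continuous.pow 2).integrable_of_hasCompactSupport
        (hc.mono fun X hX => by rw [Function.mem_support] at hX ⊢; simpa using hX)
    refine h1.bdd_mul (c := ∑ i : ι, 1 / 2 * ∑ _j ∈ Finset.univ.erase i, C)
      (measurable_pairPot hv).aestronglyMeasurable (ae_of_all _ fun X => ?_)
    rw [Real.norm_of_nonneg (pairPot_nonneg hv0 X)]
    unfold pairPot
    gcongr
    exact hC _

end

lemma IsBosonicState.hasCompactSupport {N : ℕ} {L : ℝ} {Ψ : (Fin N → R3) → ℂ}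
    (h : IsBosonicState N L Ψ) : HasCompactSupport Ψ := by
  refine IsCompact.of_isClosed_subset
    (isCompact_univ_pi fun _ : Fin N => isCompact_closedBall (0 : R3) (3 * |L|))
    (isClosed_tsupport _) fun X hX => ?_
  rw [Set.mem_univ_pi]
  intro i
  rw [mem_closedBall_zero_iff]
  refine abs_le_of_sq_le_sq' ?_ (by positivity) |>.2
  rw [EuclideanSpace.norm_sq_eq, Fin.sum_univ_three]
  have hj : ∀ j, ‖X i j‖ ^ 2 ≤ |L| ^ 2 := fun j => by
    have h1 := h.2.1 hX i j
    gcongr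
    rw [Real.norm_of_nonneg h1.1.le]
    exact h1.2.le.trans (le_abs_self L)
  nlinarith [hj 0, hj 1, hj 2, sq_nonneg |L|]

lemma ScatteringData.energyForm_ge (S : ScatteringData v φ R0 a) {N : ℕ} {L w : ℝ}
    (hlow : ∀ Φ : (Fin N → R3) → ℝ, ContDiff ℝ 1 Φ →
      ENNReal.ofReal w * ∫⁻ X, ENNReal.ofReal (Φ X ^ 2) ∂cubeMeasure (Fin N) 0 L ≤
      ∫⁻ X, ENNReal.ofReal (energyDensity v Φ X) ∂cubeMeasure (Fin N) 0 L)
    {Ψ : (Fin N → R3) → ℂ} (hΨ : IsBosonicState N L Ψ) : w ≤ energyForm N v Ψ := by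
  have hd : ContDiff ℝ 1 Ψ := hΨ.1.of_le (by exact_mod_cast le_top)
  have hc := hΨ.hasCompactSupport
  have dre : ContDiff ℝ 1 fun X => (Ψ X).re := Complex.reCLM.contDiff.comp hd
  have dim : ContDiff ℝ 1 fun X => (Ψ X).im := Complex.imCLM.contDiff.comp hd
  have cre : HasCompactSupport fun X => (Ψ X).re := hc.comp_left (g := Complex.re) rfl
  have cim : HasCompactSupport fun X => (Ψ X).im := hc.comp_left (g := Complex.im) rfl
  have ire := integrable_energyDensity S.meas S.nonneg S.bdd dre cre
  have iim := integrable_energyDensity S.meas S.nonneg S.bdd dim cim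
  have n0 := energyDensity_nonneg (ι := Fin N) S.nonneg
  have mre := dre.continuous.measurable
  have mim := dim.continuous.measurable
  have hE : ENNReal.ofReal (energyForm N v Ψ) =
      (∫⁻ X, ENNReal.ofReal (energyDensity v (fun X => (Ψ X).re) X)) +
        ∫⁻ X, ENNReal.ofReal (energyDensity v (fun X => (Ψ X).im) X) := by
    rw [energyForm]
    simp_rw [energyForm_integrand_eq S.radial (hd.differentiable one_ne_zero)]
    rw [integral_add ire iim, ENNReal.ofReal_add (integral_nonneg (n0 _)) (integral_nonneg (n0 _)),
      ofReal_integral_eq_lintegral_ofReal ire (ae_of_all _ (n0 _)),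
      ofReal_integral_eq_lintegral_ofReal iim (ae_of_all _ (n0 _))]
  have hone : ENNReal.ofReal 1 = ∫⁻ X, ENNReal.ofReal ((Ψ X).re ^ 2) ∂cubeMeasure (Fin N) 0 L +
      ∫⁻ X, ENNReal.ofReal ((Ψ X).im ^ 2) ∂cubeMeasure (Fin N) 0 L := by
    rw [← lintegral_add_left (by fun_prop), cubeMeasure_eq, ← lintegral_indicator
      (MeasurableSet.univ_pi fun _ => measurableSet_cube _ _), ← hΨ.2.2,
      ofReal_integral_eq_lintegral_ofReal]
    · refine lintegral_congr fun X => ?_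
      have hn : ENNReal.ofReal (‖Ψ X‖ ^ 2) =
          ENNReal.ofReal ((Ψ X).re ^ 2) + ENNReal.ofReal ((Ψ X).im ^ 2) := by
        rw [← ENNReal.ofReal_add (sq_nonneg _) (sq_nonneg _), Complex.sq_norm,
          Complex.normSq_apply]
        congr 1; ring
      by_cases hX : X ∈ tsupport Ψ
      · rw [Set.indicator_of_mem, hn]
        intro i _ j
        have := hΨ.2.1 hX i j
        simpa using ⟨this.1.le, this.2⟩
      · rw [image_eq_zero_of_notMem_tsupport hX]
        have hz := image_eq_zero_of_notMem_tsupport hX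
        by_cases hX' : X ∈ Set.univ.pi fun _ : Fin N => cube 0 L
        · rw [Set.indicator_of_mem hX', hz]; simp
        · rw [Set.indicator_of_notMem hX']; simp
    · exact (hd.continuous.norm.pow 2).integrable_of_hasCompactSupport
        (hc.mono fun X hX => by rw [Function.mem_support] at hX ⊢; simpa using hX)
    · exact ae_of_all _ fun X => sq_nonneg _
  have hE0 : 0 ≤ energyForm N v Ψ := by
    rw [energyForm]
    simp_rw [energyForm_integrand_eq S.radial (hd.differentiable one_ne_zero)]
    exact integral_nonneg fun X => add_nonneg (n0 _ _) (n0 _ _)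
  have key : ENNReal.ofReal w ≤ ENNReal.ofReal (energyForm N v Ψ) := by
    calc ENNReal.ofReal w = ENNReal.ofReal w * ENNReal.ofReal 1 := by simp
      _ ≤ _ := by
        rw [hone, hE, mul_add]
        refine add_le_add ((hlow _ dre).trans ?_) ((hlow _ dim).trans ?_)
        all_goals
          rw [cubeMeasure_eq]
          exact setLIntegral_le_lintegral _ _
  exact (ENNReal.ofReal_le_ofReal_iff hE0).1 key

lemma ScatteringData.integral_sol (S : ScatteringData v φ R0 a) :
    1 / 2 * ∫ x, v x * φ x = 4 * π * a := by
  have hR0 := S.R0_pos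
  have hR : 2 * R0 < 3 * R0 := by linarith
  have hR' : 0 < 3 * R0 := by linarith
  have h := S.scatt (hcut (3 * R0)) (hcut_contDiff _) (hcut_hasCompactSupport hR')
  simp_rw [S.inner_gradient_hcut hR] at h
  rw [integral_neg, integral_softW hR'] at h
  have e : ∀ x, v x * φ x * hcut (3 * R0) x = v x * φ x := fun x => by
    by_cases hx : R0 < ‖x‖
    · rw [S.supp x hx]; ring
    · rw [hcut_eq_one hR' (by linarith), mul_one]
  simp_rw [e] at h
  linarith

lemma ScatteringData.exists_C1_trial (S : ScatteringData v φ R0 a) {δ : ℝ} (hδ : 0 < δ) :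
    ∃ g : R3 → ℝ, ContDiff ℝ 1 g ∧ HasCompactSupport g ∧ (∀ x, g x ∈ Set.Icc (0:ℝ) 1) ∧
      ∫ x, (‖fderiv ℝ g x‖ ^ 2 + 1 / 2 * v x * (1 - g x) ^ 2) ≤ 4 * π * a + δ := by
  obtain ⟨D, hD0, hD⟩ := exists_deriv_st_le
  have hR0 := S.R0_pos
  have ha := S.a_nonneg
  set R := 2 * R0 + 1 + 64 * a ^ 2 * D ^ 2 * (4 * π / 3) / δ with hRdef
  have hK0 : 0 ≤ 64 * a ^ 2 * D ^ 2 * (4 * π / 3) / δ := by positivity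
  have hR : 2 * R0 < R := by linarith
  have hR' : 0 < R := by linarith
  have hKR : 64 * a ^ 2 * D ^ 2 * (4 * π / 3) / R ≤ δ := by
    rw [div_le_iff₀ hR', ← div_le_iff₀' hδ]; linarith
  have hχ := hcut_contDiff R (n := 1)
  have hχ1 : ContDiff ℝ 1 (hcut R) := hχ
  have hφ := S.sol_C1
  have hχc := hcut_hasCompactSupport hR'
  set ω : R3 → ℝ := fun x => 1 - φ x with hω
  have hω1 : ContDiff ℝ 1 ω := contDiff_const.sub hφ
  have hω0 : ∀ x, 0 ≤ ω x := fun x => sub_nonneg.2 (S.sol_le_one x)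
  have hω2 : ∀ x, ω x ≤ 1 := fun x => by have := S.sol_nonneg x; simp only [hω]; linarith
  have gω : ∀ x, gradient ω x = - gradient φ x := fun x => by
    simp only [gradient, hω]; rw [fderiv_const_sub, map_neg]
  set g : R3 → ℝ := fun x => hcut R x * (hcut R x * ω x) with hg
  have hg1 : ContDiff ℝ 1 g := hχ1.mul (hχ1.mul hω1)
  have hgc : HasCompactSupport g := hχc.mul_right
  have dχ : ∀ x, DifferentiableAt ℝ (hcut R) x := fun x => hχ1.differentiable one_ne_zero x
  have dω : ∀ x, DifferentiableAt ℝ ω x := fun x => hω1.differentiable one_ne_zero x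
  have hk1 : ContDiff ℝ 1 fun x => hcut R x * ω x := hχ1.mul hω1
  have hkc : HasCompactSupport fun x => hcut R x * ω x := hχc.mul_right
  refine ⟨fun x => hcut R x * ω x, hk1, hkc, fun x =>
    ⟨mul_nonneg (hcut_nonneg R x) (hω0 x), mul_le_one₀ (hcut_le_one R x) (hω0 x) (hω2 x)⟩, ?_⟩
  have hv1 : ∀ x, v x * hcut R x = v x := fun x => by
    by_cases hx : R0 < ‖x‖
    · rw [S.supp x hx]; ring
    · rw [hcut_eq_one hR' (by linarith), mul_one]
  have pw : ∀ x, ‖fderiv ℝ (fun x => hcut R x * ω x) x‖ ^ 2 +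
      1 / 2 * v x * (1 - hcut R x * ω x) ^ 2 = - ⟪gradient φ x, gradient g x⟫ +
        ω x ^ 2 * ‖gradient (hcut R) x‖ ^ 2 + 1 / 2 * (v x * φ x ^ 2) := by
    intro x
    have e1 : 1 / 2 * v x * (1 - hcut R x * ω x) ^ 2 = 1 / 2 * (v x * φ x ^ 2) := by
      have : φ x = 1 - ω x := by simp [hω]
      rw [this]
      linear_combination (-(ω x) + 1 / 2 * (ω x) ^ 2 * (1 + hcut R x)) * hv1 x
    have hh : DifferentiableAt ℝ (fun y => hcut R y * ω y) x := (dχ x).mul (dω x)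
    rw [e1, ← norm_gradient, gradient_fun_mul (dχ x) (dω x), hg,
      gradient_fun_mul (f := hcut R) (g := fun y => hcut R y * ω y) (dχ x) hh,
      gradient_fun_mul (dχ x) (dω x), gω,
      ← real_inner_self_eq_norm_sq, ← real_inner_self_eq_norm_sq]
    simp only [inner_add_left, inner_add_right, inner_smul_left, inner_smul_right, smul_neg,
      inner_neg_left, inner_neg_right, smul_add, RCLike.conj_to_real]
    rw [real_inner_comm (gradient φ x) (gradient (hcut R) x)]
    ring
  simp_rw [pw]
  have i1 : Integrable fun x => ⟪gradient φ x, gradient g x⟫ := by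
    refine ((continuous_gradient hφ).inner (continuous_gradient hg1)).integrable_of_hasCompactSupport
      ((hgc.fderiv (𝕜 := ℝ)).mono fun x hx => ?_)
    rw [Function.mem_support] at hx ⊢
    intro h0; apply hx; rw [inner_gradient_eq, h0]; simp
  have cg : Continuous fun x => ω x ^ 2 * ‖gradient (hcut R) x‖ ^ 2 :=
    (hω1.continuous.pow 2).mul ((continuous_gradient hχ1).norm.pow 2)
  have hz : ∀ x, x ∉ Metric.closedBall (0:R3) R →
      ω x ^ 2 * ‖gradient (hcut R) x‖ ^ 2 = 0 := fun x hx => by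
    have : R < ‖x‖ := by simpa using hx
    rw [gradient_hcut, deriv_st_eq_zero_of_gt hR' this]; simp
  have i2 : Integrable fun x => ω x ^ 2 * ‖gradient (hcut R) x‖ ^ 2 :=
    cg.integrable_of_hasCompactSupport (HasCompactSupport.intro (isCompact_closedBall _ _) hz)
  have i3 : ∀ F : R3 → ℝ, Continuous F → Integrable fun x => v x * F x := fun F hF => by
    have := S.integrable_mul (hF.mul hχ1.continuous) hχc.mul_left
    refine this.congr (ae_of_all _ fun x => ?_)
    simp only [Pi.mul_apply]
    rw [mul_comm (F x), ← mul_assoc, hv1]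
  have i4 := i3 (fun x => φ x ^ 2) (hφ.continuous.pow 2)
  have i5 := i3 φ hφ.continuous
  have i1n : Integrable fun x => -⟪gradient φ x, gradient g x⟫ := i1.neg
  have i12 : Integrable fun x => -⟪gradient φ x, gradient g x⟫ +
      ω x ^ 2 * ‖gradient (hcut R) x‖ ^ 2 := i1n.add i2
  rw [integral_add i12 (i4.const_mul _), integral_add i1n i2, integral_neg,
    integral_const_mul]
  have hs := scattering_C1 S.meas S.bdd S.nonneg S.supp S.sol_C1 S.scatt hg1 hgc
  have e2 : ∀ x, v x * φ x * g x = v x * φ x - v x * φ x ^ 2 := fun x => by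
    have : φ x = 1 - ω x := by simp [hω]
    rw [hg, this]
    simp only
    linear_combination (1 - ω x) * ω x * (1 + hcut R x) * hv1 x
  simp_rw [e2] at hs
  rw [integral_sub i5 i4] at hs
  have hsol := S.integral_sol
  have hsmall : ∫ x, ω x ^ 2 * ‖gradient (hcut R) x‖ ^ 2 ≤ δ := by
    rw [← setIntegral_eq_integral_of_forall_compl_eq_zero hz]
    refine le_trans (le_abs_self _) ?_
    have hb : ∀ x ∈ Metric.closedBall (0:R3) R,
        ‖ω x ^ 2 * ‖gradient (hcut R) x‖ ^ 2‖ ≤ 64 * a ^ 2 * D ^ 2 / R ^ 4 := by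
      intro x hx
      rw [mem_closedBall_zero_iff] at hx
      rw [Real.norm_of_nonneg (by positivity)]
      by_cases hx2 : ‖x‖ ≤ R / 2
      · rw [gradient_hcut, deriv_st_eq_zero_of_lt hR' (norm_nonneg x) hx2]
        rw [zero_mul, zero_smul, norm_zero, zero_pow two_ne_zero, mul_zero]
        positivity
      · have hx3 : R / 2 < ‖x‖ := not_le.1 hx2
        have h1 : ω x ≤ 2 * a / R := by
          simp only [hω]
          rw [S.sol_eq x (by linarith), sub_sub_cancel, div_le_div_iff₀ (by linarith) hR']
          nlinarith
        have h2 : ‖gradient (hcut R) x‖ ≤ 4 * D / R := by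
          rw [gradient_hcut, norm_smul, Real.norm_eq_abs, abs_mul,
            abs_of_nonneg (deriv_st_nonneg _), abs_div, abs_neg, abs_of_pos (by norm_num : (0:ℝ) < 4),
            abs_of_pos (by positivity)]
          calc _ ≤ D * (4 / R ^ 2) * R := by gcongr; exact hD _
            _ = _ := by field_simp
        calc _ ≤ (2 * a / R) ^ 2 * (4 * D / R) ^ 2 := by
              gcongr; exact hω0 x
          _ = _ := by field_simp; ring
    refine (norm_setIntegral_le_of_norm_le_const (by
      exact measure_closedBall_lt_top) hb).trans ?_
    have hvol : volume.real (Metric.closedBall (0:R3) R) = R ^ 3 * (π * 4 / 3) := by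
      rw [Measure.real, EuclideanSpace.volume_closedBall_fin_three, ENNReal.toReal_mul,
        ENNReal.toReal_pow, ENNReal.toReal_ofReal hR'.le, ENNReal.toReal_ofReal (by positivity)]
    rw [hvol]
    refine le_trans (le_of_eq ?_) hKR
    field_simp
  linarith

lemma ScatteringData.integrable_trial (S : ScatteringData v φ R0 a) {h : R3 → ℝ}
    (h1 : ContDiff ℝ 1 h) (hc : HasCompactSupport h) :
    Integrable fun x => ‖fderiv ℝ h x‖ ^ 2 + 1 / 2 * v x * (1 - h x) ^ 2 := by
  have hR0 := S.R0_pos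
  have hχ1 : ContDiff ℝ 1 (hcut (3 * R0)) := hcut_contDiff (3 * R0) (n := 1)
  have h2 : Continuous fun x => (1 - h x) ^ 2 * hcut (3 * R0) x :=
    ((continuous_const.sub h1.continuous).pow 2).mul hχ1.continuous
  have h3 : HasCompactSupport fun x => (1 - h x) ^ 2 * hcut (3 * R0) x :=
    (hcut_hasCompactSupport (by linarith : 0 < 3 * R0)).mul_left
  refine Integrable.add ?_ ?_
  · refine ((h1.continuous_fderiv one_ne_zero).norm.pow 2).integrable_of_hasCompactSupport
      ((hc.fderiv (𝕜 := ℝ)).mono fun x hx => ?_)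
    rw [Function.mem_support] at hx ⊢
    intro h0; apply hx; simp [h0]
  · refine ((S.integrable_mul h2 h3).const_mul (1 / 2)).congr (ae_of_all _ fun x => ?_)
    simp only
    by_cases hx : R0 < ‖x‖
    · rw [S.supp x hx]; ring
    · rw [hcut_eq_one (by linarith) (by linarith)]; ring

/-- A smooth even trial function for the two-body problem. -/
lemma ScatteringData.exists_trial (S : ScatteringData v φ R0 a) {δ : ℝ} (hδ : 0 < δ) :
    ∃ f : R3 → ℝ, ContDiff ℝ (⊤ : ℕ∞) f ∧ HasCompactSupport (fun x => 1 - f x) ∧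
      (∀ x, f x ∈ Set.Icc (0:ℝ) 1) ∧ (∀ x, f (-x) = f x) ∧
      ∫ x, (‖fderiv ℝ f x‖ ^ 2 + 1 / 2 * v x * f x ^ 2) ≤ 4 * π * a + δ := by
  obtain ⟨g, hg, hgc, hg01, hgE⟩ := S.exists_C1_trial (half_pos hδ)
  obtain ⟨C, hC⟩ := S.bdd
  have hC0 : 0 ≤ C := (S.nonneg 0).trans (hC 0)
  obtain ⟨G, hG⟩ := (hg.continuous_fderiv one_ne_zero).bounded_above_of_compact_support
    (hgc.fderiv (𝕜 := ℝ))
  have hG0 : 0 ≤ G := (norm_nonneg _).trans (hG 0)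
  obtain ⟨r, hr0, hr⟩ : ∃ r > 0, ∀ x, r ≤ ‖x‖ → g x = 0 ∧ v x = 0 := by
    obtain ⟨r, hr⟩ := hgc.isCompact.isBounded.subset_closedBall (0:R3)
    refine ⟨max r R0 + 1, by have := S.R0_pos; positivity, fun x hx => ⟨?_, S.supp x ?_⟩⟩
    · refine image_eq_zero_of_notMem_tsupport fun h => ?_
      have := hr h
      rw [mem_closedBall_zero_iff] at this
      linarith [le_max_left r R0]
    · linarith [le_max_right r R0]
  set V := volume.real (Metric.closedBall (0:R3) (r + 2)) with hV
  have hV0 : 0 ≤ V := measureReal_nonneg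
  set η := min 1 (δ / 2 / ((2 * G + 1 + 3 * C) * V + 1)) with hη
  have hη0 : 0 < η := by positivity
  have hη1 : η ≤ 1 := min_le_left _ _
  have hηδ : η * ((2 * G + 1 + 3 * C) * V) ≤ δ / 2 := by
    have : η * ((2 * G + 1 + 3 * C) * V + 1) ≤ δ / 2 := by
      rw [← le_div_iff₀ (by positivity)]; exact min_le_right _ _
    linarith
  obtain ⟨k, hk, hkc, hkr, hkg, hkd, hk01⟩ := exists_smooth_C1_approx hg hgc hη0
  have hk01 := hk01 hg01
  have hk1 : ContDiff ℝ 1 k := hk.of_le (by exact_mod_cast le_top)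
  have hr' := hkr r fun x hx => (hr x hx).1
  set q : (R3 → ℝ) → R3 → ℝ := fun g x => ‖fderiv ℝ g x‖ ^ 2 + 1 / 2 * v x * (1 - g x) ^ 2 with hq
  have hq0 : ∀ g x, 0 ≤ q g x := fun g x => by have := S.nonneg x; positivity
  have iq : ∀ h : R3 → ℝ, ContDiff ℝ 1 h → HasCompactSupport h → Integrable (q h) :=
    fun h h1 hc => S.integrable_trial h1 hc
  have hkq : ∫ x, q k x ≤ 4 * π * a + δ := by
    have hsub : ∫ x, (q k x - q g x) ≤ δ / 2 := by
      have hz : ∀ x, x ∉ Metric.closedBall (0:R3) (r + 2) → q k x - q g x = 0 := by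
        intro x hx
        have hx' : r + 2 < ‖x‖ := by simpa using hx
        have z1 : fderiv ℝ k x = 0 := by
          have : k =ᶠ[nhds x] fun _ => 0 := by
            filter_upwards [continuous_norm.continuousAt.eventually (lt_mem_nhds hx')] with y hy
            exact hr' y (by linarith)
          rw [this.fderiv_eq]; simp
        have z2 : fderiv ℝ g x = 0 := by
          have : g =ᶠ[nhds x] fun _ => 0 := by
            filter_upwards [continuous_norm.continuousAt.eventually (lt_mem_nhds hx')] with y hy
            exact (hr y (by linarith)).1
          rw [this.fderiv_eq]; simp
        simp only [hq, z1, z2, (hr x (by linarith)).2]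
        ring
      have hb : ∀ x, q k x - q g x ≤ η * (2 * G + 1 + 3 * C) := by
        intro x
        have h1 : ‖fderiv ℝ k x‖ ≤ ‖fderiv ℝ g x‖ + η := by
          have := norm_sub_norm_le (fderiv ℝ k x) (fderiv ℝ g x)
          linarith [hkd x]
        have h2 : ‖fderiv ℝ k x‖ ^ 2 ≤ (‖fderiv ℝ g x‖ + η) ^ 2 := by gcongr
        have h3 := hG x
        have h4 := abs_le.1 (hkg x)
        have h5 := hk01 x
        have h6 := hg01 x
        have h7 : (1 - k x) ^ 2 - (1 - g x) ^ 2 ≤ 2 * η := by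
          nlinarith [h5.1, h5.2, h6.1, h6.2, h4.1, h4.2]
        have h8 : v x * ((1 - k x) ^ 2 - (1 - g x) ^ 2) ≤ C * (2 * η) := by
          calc _ ≤ v x * (2 * η) := mul_le_mul_of_nonneg_left h7 (S.nonneg x)
            _ ≤ _ := by gcongr; exact hC x
        simp only [hq]
        nlinarith [mul_le_mul_of_nonneg_left h3 hη0.le, mul_nonneg hC0 hη0.le,
          mul_le_mul_of_nonneg_left hη1 hη0.le]
      rw [← setIntegral_eq_integral_of_forall_compl_eq_zero hz]
      calc _ ≤ ∫ x in Metric.closedBall (0:R3) (r + 2), η * (2 * G + 1 + 3 * C) := by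
            refine setIntegral_mono ((iq k hk1 hkc).sub (iq g hg hgc)).integrableOn ?_ hb
            exact integrableOn_const measure_closedBall_lt_top.ne
        _ ≤ _ := by
            rw [setIntegral_const, smul_eq_mul]
            linarith
    rw [integral_sub (iq k hk1 hkc) (iq g hg hgc)] at hsub
    linarith
  have hkn : ContDiff ℝ (⊤ : ℕ∞) fun x => k (-x) := hk.comp contDiff_neg
  set k' : R3 → ℝ := fun x => (k x + k (-x)) / 2 with hk'
  have hk's : ContDiff ℝ (⊤ : ℕ∞) k' := (hk.add hkn).div_const 2
  have hkc' : HasCompactSupport k' := by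
    refine HasCompactSupport.intro (isCompact_closedBall (0:R3) (r + 1)) fun x hx => ?_
    have hx' : r + 1 < ‖x‖ := by simpa using hx
    simp only [hk']
    rw [hr' x hx'.le, hr' (-x) (by rw [norm_neg]; exact hx'.le)]; norm_num
  have d1 : ∀ x, DifferentiableAt ℝ k x := fun x => hk1.differentiable one_ne_zero x
  have d2 : ∀ x, DifferentiableAt ℝ (fun x => k (-x)) x := fun x =>
    (hkn.differentiable (by simp)) x
  have dk' : ∀ x, fderiv ℝ k' x = (1 / 2 : ℝ) • (fderiv ℝ k x - fderiv ℝ k (-x)) := by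
    intro x
    have h1 := ((d1 x).hasFDerivAt.add (d2 x).hasFDerivAt).const_mul (1 / 2 : ℝ)
    have h2 : k' = fun x => 1 / 2 * (k x + k (-x)) := by ext x; simp only [hk']; ring
    rw [h2]
    refine (h1.fderiv).trans ?_
    congr 1
    have h3 : fderiv ℝ (fun x => k (-x)) x = - fderiv ℝ k (-x) := by
      have h4 := (d1 (-x)).hasFDerivAt.comp x (hasFDerivAt_id x).neg
      refine h4.fderiv.trans ?_
      ext y
      simp
    rw [h3, sub_eq_add_neg]
  have hconv : ∀ x, q k' x ≤ 1 / 2 * (q k x + q k (-x)) := by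
    intro x
    have hv : v (-x) = v x := S.radial _ _ (norm_neg x)
    simp only [hq, hv, dk', norm_smul, Real.norm_eq_abs]
    rw [abs_of_pos (by norm_num : (0:ℝ) < 1 / 2)]
    simp only [hk']
    have h1 := norm_sub_le (fderiv ℝ k x) (fderiv ℝ k (-x))
    have h2 : ‖fderiv ℝ k x - fderiv ℝ k (-x)‖ ^ 2 ≤
        (‖fderiv ℝ k x‖ + ‖fderiv ℝ k (-x)‖) ^ 2 := by gcongr
    have h3 := sq_nonneg (‖fderiv ℝ k x‖ - ‖fderiv ℝ k (-x)‖)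
    have h4 := mul_nonneg (S.nonneg x) (sq_nonneg (k x - k (-x)))
    nlinarith
  have hk1' : ContDiff ℝ 1 k' := hk's.of_le (by exact_mod_cast le_top)
  refine ⟨fun x => 1 - k' x, contDiff_const.sub hk's, by simpa using hkc', fun x => ?_,
    fun x => by simp [hk', add_comm], ?_⟩
  · have h1 := hk01 x
    have h2 := hk01 (-x)
    simp only [hk', Set.mem_Icc]
    constructor <;> linarith [h1.1, h1.2, h2.1, h2.2]
  · have e : ∀ x, ‖fderiv ℝ (fun x => 1 - k' x) x‖ ^ 2 + 1 / 2 * v x * (1 - k' x) ^ 2 = q k' x := by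
      intro x
      rw [fderiv_const_sub, norm_neg]
    simp_rw [e]
    have ik := iq k hk1 hkc
    have ikn : Integrable fun x => q k (-x) := ik.comp_neg
    calc ∫ x, q k' x ≤ ∫ x, 1 / 2 * (q k x + q k (-x)) :=
          integral_mono (iq k' hk1' hkc') ((ik.add ikn).const_mul _) hconv
      _ = ∫ x, q k x := by
          rw [integral_const_mul, integral_add ik ikn, integral_neg_eq_self (q k)]
          ring
      _ ≤ _ := hkq

end

section

variable {v φ : R3 → ℝ} {R0 a : ℝ}
variable {ι : Type*} [Fintype ι] [DecidableEq ι]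

/-- Jastrow-type trial function; `r` orders the particles. -/
def jastrow (r : ι → ℕ) (u f : R3 → ℝ) (X : ι → R3) : ℝ :=
  (∏ i, u (X i)) *
    ∏ p ∈ Finset.univ.filter (fun p : ι × ι => r p.1 < r p.2), f (X p.1 - X p.2)

lemma prod_pairs_eq {r : ι → ℕ} (hr : r.Injective) {F : ι → ι → ℝ} (hF : ∀ i j, F i j = F j i)
    (i : ι) :
    ∏ p ∈ Finset.univ.filter (fun p : ι × ι => r p.1 < r p.2), F p.1 p.2 =
      (∏ p ∈ Finset.univ.filter
        (fun p : ι × ι => r p.1 < r p.2 ∧ p.1 ≠ i ∧ p.2 ≠ i), F p.1 p.2) *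
        ∏ j ∈ Finset.univ.erase i, F i j := by
  rw [← Finset.prod_filter_mul_prod_filter_not _ (fun p : ι × ι => p.1 ≠ i ∧ p.2 ≠ i),
    Finset.filter_filter]
  congr 1
  refine Finset.prod_bij' (fun p _ => if p.1 = i then p.2 else p.1)
    (fun j _ => if r i < r j then (i, j) else (j, i)) ?_ ?_ ?_ ?_ ?_
  · rintro ⟨p, q⟩ h
    simp only [Finset.mem_filter, Finset.mem_univ, true_and, Finset.mem_erase] at h ⊢
    grind
  · intro j h
    have : j ≠ i := by simpa using h
    have := hr.ne this
    simp only [Finset.mem_filter, Finset.mem_univ, true_and]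
    grind
  · rintro ⟨p, q⟩ h
    simp only [Finset.mem_filter, Finset.mem_univ, true_and] at h ⊢
    grind
  · intro j h
    have : j ≠ i := by simpa using h
    grind
  · rintro ⟨p, q⟩ h
    simp only [Finset.mem_filter, Finset.mem_univ, true_and] at h ⊢
    grind

lemma jastrow_update {r : ι → ℕ} (hr : r.Injective) {u f : R3 → ℝ} (hf : ∀ x, f (-x) = f x)
    (hf01 : ∀ x, f x ∈ Set.Icc (0 : ℝ) 1) (i : ι) (X : ι → R3) :
    ∃ C, C ^ 2 ≤ ∏ j ∈ Finset.univ.erase i, u (X j) ^ 2 ∧ ∀ y,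
      jastrow r u f (Function.update X i y) =
        C * (u y * ∏ j ∈ Finset.univ.erase i, f (y - X j)) := by
  set W := ∏ p ∈ Finset.univ.filter
        (fun p : ι × ι => r p.1 < r p.2 ∧ p.1 ≠ i ∧ p.2 ≠ i), f (X p.1 - X p.2) with hW
  have hW0 : 0 ≤ W := Finset.prod_nonneg fun p _ => (hf01 _).1
  have hW1 : W ≤ 1 := Finset.prod_le_one (fun p _ => (hf01 _).1) fun p _ => (hf01 _).2
  refine ⟨(∏ j ∈ Finset.univ.erase i, u (X j)) * W, ?_, fun y => ?_⟩
  · rw [mul_pow, Finset.prod_pow]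
    exact mul_le_of_le_one_right (sq_nonneg _) (pow_le_one₀ hW0 hW1)
  · have hsym : ∀ j k, f (Function.update X i y j - Function.update X i y k) =
        f (Function.update X i y k - Function.update X i y j) := fun j k => by
      rw [← hf, neg_sub]
    rw [jastrow, prod_pairs_eq hr hsym i,
      ← Finset.mul_prod_erase Finset.univ _ (Finset.mem_univ i), Function.update_self]
    have h1 : ∏ j ∈ Finset.univ.erase i, u (Function.update X i y j) =
        ∏ j ∈ Finset.univ.erase i, u (X j) := Finset.prod_congr rfl fun j hj => by
      rw [Function.update_of_ne (Finset.ne_of_mem_erase hj)]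
    have h2 : ∏ j ∈ Finset.univ.erase i, f (y - Function.update X i y j) =
        ∏ j ∈ Finset.univ.erase i, f (y - X j) := Finset.prod_congr rfl fun j hj => by
      rw [Function.update_of_ne (Finset.ne_of_mem_erase hj)]
    have h3 : ∏ p ∈ Finset.univ.filter
        (fun p : ι × ι => r p.1 < r p.2 ∧ p.1 ≠ i ∧ p.2 ≠ i),
          f (Function.update X i y p.1 - Function.update X i y p.2) = W :=
      Finset.prod_congr rfl fun p hp => by
        simp only [Finset.mem_filter] at hp
        rw [Function.update_of_ne hp.2.2.1, Function.update_of_ne hp.2.2.2]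
    rw [h1, h2, h3]
    ring

lemma contDiff_jastrow {r : ι → ℕ} {u f : R3 → ℝ} {n : WithTop ℕ∞} (hu : ContDiff ℝ n u)
    (hf : ContDiff ℝ n f) : ContDiff ℝ n (jastrow (ι := ι) r u f) := by
  unfold jastrow
  refine ContDiff.mul (contDiff_prod fun i _ => hu.comp (contDiff_apply ℝ R3 i))
    (contDiff_prod fun p _ => hf.comp ((contDiff_apply ℝ R3 p.1).sub (contDiff_apply ℝ R3 p.2)))

lemma norm_fderiv_mul_prod_le {κ : Type*} [DecidableEq κ] {u f : R3 → ℝ} (hu : ContDiff ℝ 1 u)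
    (hf : ContDiff ℝ 1 f) (hf01 : ∀ x, f x ∈ Set.Icc (0 : ℝ) 1) (J : Finset κ) (z : κ → R3)
    {η : ℝ} (hη : 0 < η) (y : R3) :
    ‖fderiv ℝ (fun y => u y * ∏ j ∈ J, f (y - z j)) y‖ ^ 2 ≤
      (1 + 1 / η) * ‖fderiv ℝ u y‖ ^ 2 + (1 + η) * (u y ^ 2 *
        (∑ j ∈ J, ‖fderiv ℝ f (y - z j)‖ ^ 2 + ∑ j ∈ J, ∑ k ∈ J.erase j,
          ‖fderiv ℝ f (y - z j)‖ * ‖fderiv ℝ f (y - z k)‖)) := by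
  have hfj : ∀ j, HasFDerivAt (fun y => f (y - z j)) (fderiv ℝ f (y - z j)) y := fun j => by
    have := (hf.differentiable one_ne_zero (y - z j)).hasFDerivAt.comp y
      ((hasFDerivAt_id y).sub_const (z j))
    exact this
  have hF := HasFDerivAt.finsetProd (u := J) (fun j _ => hfj j)
  have hu' := (hu.differentiable one_ne_zero y).hasFDerivAt
  have huF : fderiv ℝ (fun y => u y * ∏ j ∈ J, f (y - z j)) y = _ := (hu'.mul hF).fderiv
  rw [huF]
  set S := ∑ j ∈ J, ‖fderiv ℝ f (y - z j)‖ with hS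
  have hP0 : 0 ≤ ∏ j ∈ J, f (y - z j) := Finset.prod_nonneg fun j _ => (hf01 _).1
  have hP1 : ∏ j ∈ J, f (y - z j) ≤ 1 :=
    Finset.prod_le_one (fun j _ => (hf01 _).1) fun j _ => (hf01 _).2
  have h1 : ‖∑ j ∈ J, (∏ k ∈ J.erase j, f (y - z k)) • fderiv ℝ f (y - z j)‖ ≤ S := by
    refine norm_sum_le_of_le _ fun j _ => ?_
    rw [norm_smul, Real.norm_of_nonneg (Finset.prod_nonneg fun j _ => (hf01 _).1)]
    exact mul_le_of_le_one_left (norm_nonneg _)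
      (Finset.prod_le_one (fun j _ => (hf01 _).1) fun j _ => (hf01 _).2)
  have h2 : ‖u y • (∑ j ∈ J, (∏ k ∈ J.erase j, f (y - z k)) • fderiv ℝ f (y - z j)) +
      (∏ j ∈ J, f (y - z j)) • fderiv ℝ u y‖ ≤ |u y| * S + ‖fderiv ℝ u y‖ := by
    refine (norm_add_le _ _).trans (add_le_add ?_ ?_)
    · rw [norm_smul, Real.norm_eq_abs]
      exact mul_le_mul_of_nonneg_left h1 (abs_nonneg _)
    · rw [norm_smul, Real.norm_of_nonneg hP0]
      exact mul_le_of_le_one_left (norm_nonneg _) hP1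
  have h3 : S ^ 2 = ∑ j ∈ J, ‖fderiv ℝ f (y - z j)‖ ^ 2 + ∑ j ∈ J, ∑ k ∈ J.erase j,
          ‖fderiv ℝ f (y - z j)‖ * ‖fderiv ℝ f (y - z k)‖ := by
    rw [sq, hS, Finset.sum_mul_sum, ← Finset.sum_add_distrib]
    refine Finset.sum_congr rfl fun j hj => ?_
    rw [← Finset.add_sum_erase J _ hj, sq]
  rw [← h3]
  refine (pow_le_pow_left₀ (norm_nonneg _) h2 2).trans ?_
  set A := |u y| * S
  have hA : u y ^ 2 * S ^ 2 = A ^ 2 := by rw [mul_pow, sq_abs]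
  rw [hA]
  set B := ‖fderiv ℝ u y‖
  have h4 : 0 ≤ (η * A - B) ^ 2 / η := by positivity
  have h5 : (η * A - B) ^ 2 / η = η * A ^ 2 - 2 * A * B + 1 / η * B ^ 2 := by field_simp; ring
  nlinarith

section weights

variable {w : R3 → ENNReal}

lemma lintegral_weight_mul_le (hw : Measurable w) (hw1 : ∫⁻ y, w y = 1) {A : ENNReal}
    (hA : ∀ y, w y ≤ A) {g : R3 → ENNReal} (hg : Measurable g) {M : (ι → R3) → ENNReal}
    (hM : Measurable M) {i j : ι} (hij : i ≠ j) (hMj : ∀ X y, M (Function.update X j y) = M X) :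
    ∫⁻ X : ι → R3, (∏ l, w (X l)) * (M X * g (X i - X j)) ≤
      A * (∫⁻ y, g y) * ∫⁻ X : ι → R3, (∏ l, w (X l)) * M X := by
  have hP : Measurable fun X : ι → R3 => ∏ l, w (X l) :=
    Finset.measurable_prod _ fun l _ => hw.comp (measurable_pi_apply l)
  have hPM : Measurable fun X : ι → R3 => (∏ l, w (X l)) * M X := hP.mul hM
  rw [← lintegral_const_mul _ hPM]
  refine lintegral_le_of_slice (fun _ => volume) j
    (hP.mul (hM.mul (hg.comp ((measurable_pi_apply i).sub (measurable_pi_apply j)))))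
    (hPM.const_mul _) fun X => ?_
  have e : ∀ y, ∏ l, w (Function.update X j y l) =
      w y * ∏ l ∈ Finset.univ.erase j, w (X l) := fun y => by
    rw [← Finset.mul_prod_erase Finset.univ _ (Finset.mem_univ j), Function.update_self]
    congr 1
    exact Finset.prod_congr rfl fun l hl => by
      rw [Function.update_of_ne (Finset.ne_of_mem_erase hl)]
  simp only [hMj, Function.update_of_ne hij, Function.update_self, Pi.mul_apply, e]
  set Q := ∏ l ∈ Finset.univ.erase j, w (X l)
  calc ∫⁻ y, w y * Q * (M X * g (X i - y))
      ≤ ∫⁻ y, (A * Q * M X) * g (X i - y) := lintegral_mono fun y => by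
        rw [← mul_assoc]; gcongr; exact hA y
    _ = A * Q * M X * ∫⁻ y, g y := by
        have hgs : Measurable fun y => g (X i - y) :=
          hg.comp (measurable_const.sub measurable_id)
        rw [lintegral_const_mul _ hgs, lintegral_sub_left_eq_self]
    _ = A * (∫⁻ y, g y) * Q * M X * ∫⁻ y, w y := by rw [hw1]; ring
    _ = ∫⁻ y, A * (∫⁻ y, g y) * Q * M X * w y := (lintegral_const_mul _ hw).symm
    _ = _ := lintegral_congr fun y => by ring

lemma lintegral_weight_pair_le (hw : Measurable w) (hw1 : ∫⁻ y, w y = 1)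
    (hW : ∫⁻ X : ι → R3, ∏ l, w (X l) = 1) {A : ENNReal}
    (hA : ∀ y, w y ≤ A) {g : R3 → ENNReal} (hg : Measurable g) {i j : ι} (hij : i ≠ j) :
    ∫⁻ X : ι → R3, (∏ l, w (X l)) * g (X i - X j) ≤ A * ∫⁻ y, g y := by
  have := lintegral_weight_mul_le hw hw1 hA hg (measurable_const (a := (1 : ENNReal))) hij
    fun _ _ => rfl
  simpa [hW] using this

lemma lintegral_weight_triple_le (hw : Measurable w) (hw1 : ∫⁻ y, w y = 1)
    (hW : ∫⁻ X : ι → R3, ∏ l, w (X l) = 1) {A : ENNReal}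
    (hA : ∀ y, w y ≤ A) {g : R3 → ENNReal} (hg : Measurable g) {i j k : ι} (hij : i ≠ j)
    (hik : i ≠ k) (hjk : j ≠ k) :
    ∫⁻ X : ι → R3, (∏ l, w (X l)) * (g (X i - X j) * g (X i - X k)) ≤
      (A * ∫⁻ y, g y) ^ 2 := by
  refine (lintegral_weight_mul_le hw hw1 hA hg
    (hg.comp ((measurable_pi_apply i).sub (measurable_pi_apply j))) hik fun X y => ?_).trans ?_
  · simp [Function.update_of_ne hik, Function.update_of_ne hjk]
  · rw [sq]
    gcongr
    exact lintegral_weight_pair_le hw hw1 hW hA hg hij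

lemma lintegral_weight_erase_le (hw : Measurable w) (hw1 : ∫⁻ y, w y = 1)
    (hW : ∫⁻ X : ι → R3, ∏ l, w (X l) = 1) {t : R3 → ENNReal}
    (ht : Measurable t) (i : ι) :
    ∫⁻ X : ι → R3, (∏ l ∈ Finset.univ.erase i, w (X l)) * t (X i) ≤ ∫⁻ y, t y := by
  have hP : Measurable fun X : ι → R3 => ∏ l, w (X l) :=
    Finset.measurable_prod _ fun l _ => hw.comp (measurable_pi_apply l)
  have hQ : Measurable fun X : ι → R3 => ∏ l ∈ Finset.univ.erase i, w (X l) :=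
    Finset.measurable_prod _ fun l _ => hw.comp (measurable_pi_apply l)
  calc _ ≤ ∫⁻ X : ι → R3, (∫⁻ y, t y) * ∏ l, w (X l) := by
        refine lintegral_le_of_slice (fun _ => volume) i
          (hQ.mul (ht.comp (measurable_pi_apply i))) (hP.const_mul _) fun X => ?_
        have e : ∀ y, ∏ l ∈ Finset.univ.erase i, w (Function.update X i y l) =
            ∏ l ∈ Finset.univ.erase i, w (X l) := fun y =>
          Finset.prod_congr rfl fun l hl => by
            rw [Function.update_of_ne (Finset.ne_of_mem_erase hl)]
        simp only [Pi.mul_apply, Function.comp, Function.update_self, e,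
          ← Finset.mul_prod_erase Finset.univ _ (Finset.mem_univ i)]
        rw [lintegral_const_mul _ ht]
        simp_rw [mul_comm (w _), ← mul_assoc]
        rw [lintegral_const_mul _ hw, hw1, mul_one, mul_comm]
    _ = _ := by rw [lintegral_const_mul _ hP, hW, mul_one]

end weights

lemma jastrow_aux {C P K F U Sv S1 S2 S3 T e d : ℝ} (hC : C ^ 2 ≤ P) (he : 0 ≤ e) (hd : 0 ≤ d)
    (hT : 0 ≤ T) (h1 : 0 ≤ S1) (h2 : 0 ≤ S2) (h3 : 0 ≤ S3)
    (hk : K ≤ e * T + d * (U ^ 2 * (S1 + S2))) (hpot : 1 / 2 * Sv * F ^ 2 ≤ d * S3) :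
    C ^ 2 * K + 1 / 2 * Sv * (C * (U * F)) ^ 2 ≤
      e * (P * T) + d * (U ^ 2 * P * (S1 + S3) + U ^ 2 * P * S2) := by
  have hB : 0 ≤ e * T + d * (U ^ 2 * (S1 + S3 + S2)) := by positivity
  calc _ = C ^ 2 * (K + U ^ 2 * (1 / 2 * Sv * F ^ 2)) := by ring
    _ ≤ C ^ 2 * (e * T + d * (U ^ 2 * (S1 + S3 + S2))) := by
        refine mul_le_mul_of_nonneg_left ?_ (sq_nonneg C)
        have := mul_le_mul_of_nonneg_left hpot (sq_nonneg U)
        linarith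
    _ ≤ P * (e * T + d * (U ^ 2 * (S1 + S3 + S2))) := mul_le_mul_of_nonneg_right hC hB
    _ = _ := by ring

lemma energyDensity_jastrow_le (hv : ∀ x, 0 ≤ v x) {r : ι → ℕ} (hr : r.Injective) {u f : R3 → ℝ}
    (hu : ContDiff ℝ 1 u) (hf1 : ContDiff ℝ 1 f) (hf : ∀ x, f (-x) = f x)
    (hf01 : ∀ x, f x ∈ Set.Icc (0 : ℝ) 1) {η : ℝ} (hη : 0 < η) (X : ι → R3) :
    energyDensity v (jastrow r u f) X ≤ ∑ i, ((1 + 1 / η) *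
      ((∏ l ∈ Finset.univ.erase i, u (X l) ^ 2) * ‖fderiv ℝ u (X i)‖ ^ 2) +
      (1 + η) * (∑ j ∈ Finset.univ.erase i, (∏ l, u (X l) ^ 2) *
        (‖fderiv ℝ f (X i - X j)‖ ^ 2 + 1 / 2 * v (X i - X j) * f (X i - X j) ^ 2) +
        ∑ j ∈ Finset.univ.erase i, ∑ k ∈ (Finset.univ.erase i).erase j, (∏ l, u (X l) ^ 2) *
          (‖fderiv ℝ f (X i - X j)‖ * ‖fderiv ℝ f (X i - X k)‖))) := by
  rw [energyDensity, pairPot, Finset.sum_mul, ← Finset.sum_add_distrib]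
  refine Finset.sum_le_sum fun i _ => ?_
  obtain ⟨C, hC, hCy⟩ := jastrow_update (u := u) hr hf hf01 i X
  set J := Finset.univ.erase i
  set F : ℝ := ∏ j ∈ J, f (X i - X j) with hF
  have hF0 : 0 ≤ F := Finset.prod_nonneg fun j _ => (hf01 _).1
  have hψ : jastrow r u f X = C * (u (X i) * F) := by
    rw [← hCy, Function.update_eq_self]
  have hkin : kin i (jastrow r u f) X =
      C ^ 2 * ‖fderiv ℝ (fun y => u y * ∏ j ∈ J, f (y - X j)) (X i)‖ ^ 2 := by
    have hd : DifferentiableAt ℝ (fun y => u y * ∏ j ∈ J, f (y - X j)) (X i) :=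
      (hu.mul (contDiff_prod fun j _ =>
        hf1.comp (contDiff_id.sub contDiff_const))).differentiable one_ne_zero _
    rw [kin, funext hCy, fderiv_const_mul hd, norm_smul, mul_pow, Real.norm_eq_abs, sq_abs]
  have hk := norm_fderiv_mul_prod_le hu hf1 hf01 J X hη (X i)
  have hP : ∏ l, u (X l) ^ 2 = u (X i) ^ 2 * ∏ l ∈ J, u (X l) ^ 2 :=
    (Finset.mul_prod_erase Finset.univ _ (Finset.mem_univ i)).symm
  have hpot : 1 / 2 * (∑ j ∈ J, v (X i - X j)) * F ^ 2 ≤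
      (1 + η) * ∑ j ∈ J, 1 / 2 * v (X i - X j) * f (X i - X j) ^ 2 := by
    have h1 : 1 / 2 * (∑ j ∈ J, v (X i - X j)) * F ^ 2 ≤
        ∑ j ∈ J, 1 / 2 * v (X i - X j) * f (X i - X j) ^ 2 := by
      rw [Finset.mul_sum, Finset.sum_mul]
      refine Finset.sum_le_sum fun j hj => ?_
      have h2 : F ≤ f (X i - X j) := by
        rw [hF, ← Finset.mul_prod_erase J _ hj]
        exact mul_le_of_le_one_right (hf01 _).1
          (Finset.prod_le_one (fun j _ => (hf01 _).1) fun j _ => (hf01 _).2)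
      have := hv (X i - X j)
      gcongr
    have h3 : 0 ≤ ∑ j ∈ J, 1 / 2 * v (X i - X j) * f (X i - X j) ^ 2 :=
      Finset.sum_nonneg fun j _ => mul_nonneg (mul_nonneg (by norm_num) (hv _)) (sq_nonneg _)
    nlinarith
  rw [hkin, hψ, hP]
  simp only [← Finset.mul_sum]
  rw [Finset.sum_add_distrib]
  have hS12 : ∀ j, ∑ k ∈ J.erase j, ‖fderiv ℝ f (X i - X j)‖ * ‖fderiv ℝ f (X i - X k)‖ =
      ‖fderiv ℝ f (X i - X j)‖ * ∑ k ∈ J.erase j, ‖fderiv ℝ f (X i - X k)‖ := fun j =>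
    (Finset.mul_sum _ _ _).symm
  simp only [hS12] at hk
  refine jastrow_aux hC (by positivity) (by positivity) (sq_nonneg _) ?_ ?_ ?_ hk hpot
  · exact Finset.sum_nonneg fun _ _ => sq_nonneg _
  · exact Finset.sum_nonneg fun _ _ => mul_nonneg (norm_nonneg _)
      (Finset.sum_nonneg fun _ _ => norm_nonneg _)
  · exact Finset.sum_nonneg fun j _ => mul_nonneg (mul_nonneg (by norm_num) (hv _)) (sq_nonneg _)

lemma integrable_sq_of_hasCompactSupport {u : R3 → ℝ} (hu : Continuous u)
    (huc : HasCompactSupport u) : Integrable fun y => u y ^ 2 := by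
  refine (hu.pow 2).integrable_of_hasCompactSupport (huc.mono fun x hx => ?_)
  rw [Function.mem_support] at hx ⊢
  exact fun h => hx (by simp [h])

lemma lintegral_prod_sq {u : R3 → ℝ} (hu : Continuous u) (huc : HasCompactSupport u)
    (hu1 : ∫ y, u y ^ 2 = 1) : ∫⁻ X : ι → R3, ∏ l, ENNReal.ofReal (u (X l) ^ 2) = 1 := by
  have hi := integrable_sq_of_hasCompactSupport hu huc
  have h := integral_fintype_prod_volume_eq_prod (ι := ι) (𝕜 := ℝ) (E := fun _ => R3)
    (fun _ y => u y ^ 2)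
  simp only [hu1, Finset.prod_const_one] at h
  have hI : Integrable fun X : ι → R3 => ∏ l, u (X l) ^ 2 := Integrable.fintype_prod fun _ => hi
  rw [← ENNReal.ofReal_one, ← h, ofReal_integral_eq_lintegral_ofReal hI
    (ae_of_all _ fun X => Finset.prod_nonneg fun l _ => sq_nonneg _)]
  exact lintegral_congr fun X => (ENNReal.ofReal_prod_of_nonneg fun l _ => sq_nonneg _).symm

lemma lintegral_ofReal_sq {u : R3 → ℝ} (hu : Continuous u) (huc : HasCompactSupport u)
    (hu1 : ∫ y, u y ^ 2 = 1) : ∫⁻ y, ENNReal.ofReal (u y ^ 2) = 1 := by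
  have hi := integrable_sq_of_hasCompactSupport hu huc
  rw [← ENNReal.ofReal_one, ← hu1,
    ofReal_integral_eq_lintegral_ofReal hi (ae_of_all _ fun y => sq_nonneg _)]

set_option maxHeartbeats 1000000 in
lemma lintegral_energyDensity_jastrow_le (hvm : Measurable v) (hv : ∀ x, 0 ≤ v x) {r : ι → ℕ}
    (hr : r.Injective) {u f : R3 → ℝ}
    (hu : ContDiff ℝ 1 u) (huc : HasCompactSupport u) (hu1 : ∫ y, u y ^ 2 = 1)
    (hf1 : ContDiff ℝ 1 f) (hf : ∀ x, f (-x) = f x)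
    (hf01 : ∀ x, f x ∈ Set.Icc (0 : ℝ) 1) {η : ℝ} (hη : 0 < η) {A : ENNReal}
    (hA : ∀ y, ENNReal.ofReal (u y ^ 2) ≤ A) :
    ∫⁻ X : ι → R3, ENNReal.ofReal (energyDensity v (jastrow r u f) X) ≤
      Fintype.card ι * (ENNReal.ofReal (1 + 1 / η) * (∫⁻ y, ENNReal.ofReal (‖fderiv ℝ u y‖ ^ 2)) +
        ENNReal.ofReal (1 + η) * (Fintype.card ι *
          (A * ∫⁻ y, ENNReal.ofReal (‖fderiv ℝ f y‖ ^ 2 + 1 / 2 * v y * f y ^ 2)) +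
          Fintype.card ι * (Fintype.card ι * (A * ∫⁻ y, ENNReal.ofReal ‖fderiv ℝ f y‖) ^ 2))) := by
  set w : R3 → ENNReal := fun y => ENNReal.ofReal (u y ^ 2) with hwd
  set t : R3 → ENNReal := fun y => ENNReal.ofReal (‖fderiv ℝ u y‖ ^ 2) with ht
  set q : R3 → ENNReal := fun y =>
    ENNReal.ofReal (‖fderiv ℝ f y‖ ^ 2 + 1 / 2 * v y * f y ^ 2) with hq
  set g : R3 → ENNReal := fun y => ENNReal.ofReal ‖fderiv ℝ f y‖ with hg
  have hw : Measurable w := (hu.continuous.pow 2).measurable.ennreal_ofReal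
  have htm : Measurable t :=
    ((hu.continuous_fderiv one_ne_zero).norm.pow 2).measurable.ennreal_ofReal
  have hgm : Measurable g := (hf1.continuous_fderiv one_ne_zero).norm.measurable.ennreal_ofReal
  have hqm : Measurable q :=
    (((hf1.continuous_fderiv one_ne_zero).norm.pow 2).measurable.add
      ((hvm.const_mul _).mul (hf1.continuous.pow 2).measurable)).ennreal_ofReal
  have hw1 : ∫⁻ y, w y = 1 := lintegral_ofReal_sq hu.continuous huc hu1
  have hW : ∫⁻ X : ι → R3, ∏ l, w (X l) = 1 := lintegral_prod_sq hu.continuous huc hu1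
  have hPm : Measurable fun X : ι → R3 => ∏ l, w (X l) :=
    Finset.measurable_prod _ fun l _ => hw.comp (measurable_pi_apply l)
  have hQm : ∀ i, Measurable fun X : ι → R3 => ∏ l ∈ Finset.univ.erase i, w (X l) := fun i =>
    Finset.measurable_prod _ fun l _ => hw.comp (measurable_pi_apply l)
  have hd : ∀ {h : R3 → ENNReal}, Measurable h → ∀ i j : ι,
      Measurable fun X : ι → R3 => h (X i - X j) := fun hh i j =>
    hh.comp ((measurable_pi_apply i).sub (measurable_pi_apply j))
  have m1 : ∀ i, Measurable fun X : ι → R3 =>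
      (∏ l ∈ Finset.univ.erase i, w (X l)) * t (X i) := fun i =>
    (hQm i).mul (htm.comp (measurable_pi_apply i))
  have m2 : ∀ i j, Measurable fun X : ι → R3 => (∏ l, w (X l)) * q (X i - X j) := fun i j =>
    hPm.mul (hd hqm i j)
  have m3 : ∀ i j k, Measurable fun X : ι → R3 =>
      (∏ l, w (X l)) * (g (X i - X j) * g (X i - X k)) := fun i j k =>
    hPm.mul ((hd hgm i j).mul (hd hgm i k))
  have m4 : ∀ i j, Measurable fun X : ι → R3 => ∑ k ∈ (Finset.univ.erase i).erase j,
      (∏ l, w (X l)) * (g (X i - X j) * g (X i - X k)) := fun i j =>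
    Finset.measurable_sum _ fun k _ => m3 i j k
  have m5 : ∀ i, Measurable fun X : ι → R3 => ∑ j ∈ Finset.univ.erase i,
      ∑ k ∈ (Finset.univ.erase i).erase j,
      (∏ l, w (X l)) * (g (X i - X j) * g (X i - X k)) := fun i =>
    Finset.measurable_sum _ fun j _ => m4 i j
  have m6 : ∀ i, Measurable fun X : ι → R3 => ∑ j ∈ Finset.univ.erase i,
      (∏ l, w (X l)) * q (X i - X j) := fun i =>
    Finset.measurable_sum _ fun j _ => m2 i j
  calc _ ≤ ∫⁻ X : ι → R3, ∑ i, (ENNReal.ofReal (1 + 1 / η) *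
      ((∏ l ∈ Finset.univ.erase i, w (X l)) * t (X i)) +
      ENNReal.ofReal (1 + η) * (∑ j ∈ Finset.univ.erase i, (∏ l, w (X l)) * q (X i - X j) +
        ∑ j ∈ Finset.univ.erase i, ∑ k ∈ (Finset.univ.erase i).erase j, (∏ l, w (X l)) *
          (g (X i - X j) * g (X i - X k)))) := by
        refine lintegral_mono fun X => ?_
        refine (ENNReal.ofReal_le_ofReal
          (energyDensity_jastrow_le hv hr hu hf1 hf hf01 hη X)).trans (le_of_eq ?_)
        have hp : ∀ s : Finset ι, ENNReal.ofReal (∏ l ∈ s, u (X l) ^ 2) = ∏ l ∈ s, w (X l) :=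
          fun s => ENNReal.ofReal_prod_of_nonneg fun l _ => sq_nonneg _
        have hp0 : ∀ s : Finset ι, 0 ≤ ∏ l ∈ s, u (X l) ^ 2 :=
          fun s => Finset.prod_nonneg fun l _ => sq_nonneg _
        have hq0 : ∀ y, 0 ≤ ‖fderiv ℝ f y‖ ^ 2 + 1 / 2 * v y * f y ^ 2 := fun y => by
          have := hv y; positivity
        have n1 : ∀ i, 0 ≤ ∑ j ∈ Finset.univ.erase i, (∏ l, u (X l) ^ 2) *
            (‖fderiv ℝ f (X i - X j)‖ ^ 2 + 1 / 2 * v (X i - X j) * f (X i - X j) ^ 2) := fun i =>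
          Finset.sum_nonneg fun j _ => mul_nonneg (hp0 _) (hq0 _)
        have n2 : ∀ i j, 0 ≤ ∑ k ∈ (Finset.univ.erase i).erase j, (∏ l, u (X l) ^ 2) *
          (‖fderiv ℝ f (X i - X j)‖ * ‖fderiv ℝ f (X i - X k)‖) := fun i j =>
          Finset.sum_nonneg fun k _ => mul_nonneg (hp0 _) (by positivity)
        have n3 : ∀ i, 0 ≤ ∑ j ∈ Finset.univ.erase i, ∑ k ∈ (Finset.univ.erase i).erase j,
          (∏ l, u (X l) ^ 2) *
          (‖fderiv ℝ f (X i - X j)‖ * ‖fderiv ℝ f (X i - X k)‖) := fun i =>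
          Finset.sum_nonneg fun j _ => n2 i j
        have n4 : ∀ i, 0 ≤ (1 + 1 / η) *
          ((∏ l ∈ Finset.univ.erase i, u (X l) ^ 2) * ‖fderiv ℝ u (X i)‖ ^ 2) := fun i =>
          mul_nonneg (by positivity) (mul_nonneg (hp0 _) (sq_nonneg _))
        have n5 := fun i => mul_nonneg (by positivity : 0 ≤ 1 + η) (add_nonneg (n1 i) (n3 i))
        rw [ENNReal.ofReal_sum_of_nonneg fun i _ => add_nonneg (n4 i) (n5 i)]
        refine Finset.sum_congr rfl fun i _ => ?_
        rw [ENNReal.ofReal_add (n4 i) (n5 i), ENNReal.ofReal_mul (by positivity),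
          ENNReal.ofReal_mul (hp0 _), hp, ENNReal.ofReal_mul (by positivity),
          ENNReal.ofReal_add (n1 i) (n3 i),
          ENNReal.ofReal_sum_of_nonneg fun j _ => mul_nonneg (hp0 _) (hq0 _),
          ENNReal.ofReal_sum_of_nonneg fun j _ => n2 i j]
        congr 3
        · exact Finset.sum_congr rfl fun j _ => by rw [ENNReal.ofReal_mul (hp0 _), hp]
        · refine Finset.sum_congr rfl fun j _ => ?_
          rw [ENNReal.ofReal_sum_of_nonneg fun k _ => mul_nonneg (hp0 _) (by positivity)]
          exact Finset.sum_congr rfl fun k _ => by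
            rw [ENNReal.ofReal_mul (hp0 _), hp, ENNReal.ofReal_mul (norm_nonneg _)]
    _ = ∑ i, (ENNReal.ofReal (1 + 1 / η) *
      (∫⁻ X : ι → R3, (∏ l ∈ Finset.univ.erase i, w (X l)) * t (X i)) +
      ENNReal.ofReal (1 + η) * (∑ j ∈ Finset.univ.erase i,
        (∫⁻ X : ι → R3, (∏ l, w (X l)) * q (X i - X j)) +
        ∑ j ∈ Finset.univ.erase i, ∑ k ∈ (Finset.univ.erase i).erase j,
          ∫⁻ X : ι → R3, (∏ l, w (X l)) * (g (X i - X j) * g (X i - X k)))) := by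
        have m7 : ∀ i, Measurable fun X : ι → R3 => ∑ j ∈ Finset.univ.erase i,
            (∏ l, w (X l)) * q (X i - X j) + ∑ j ∈ Finset.univ.erase i,
            ∑ k ∈ (Finset.univ.erase i).erase j,
            (∏ l, w (X l)) * (g (X i - X j) * g (X i - X k)) := fun i => (m6 i).add (m5 i)
        refine (lintegral_finsetSum _ fun i _ => ((m1 i).const_mul _).add
          ((m7 i).const_mul _)).trans (Finset.sum_congr rfl fun i _ => ?_)
        refine (lintegral_add_left ((m1 i).const_mul _) _).trans ?_
        rw [lintegral_const_mul _ (m1 i), lintegral_const_mul _ (m7 i), lintegral_add_left (m6 i),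
          lintegral_finsetSum _ fun j _ => m2 i j, lintegral_finsetSum _ fun j _ => m4 i j]
        congr 3
        exact Finset.sum_congr rfl fun j _ => lintegral_finsetSum _ fun k _ => m3 i j k
    _ ≤ ∑ i : ι, (ENNReal.ofReal (1 + 1 / η) * (∫⁻ y, t y) +
        ENNReal.ofReal (1 + η) * (Fintype.card ι * (A * ∫⁻ y, q y) +
          Fintype.card ι * (Fintype.card ι * (A * ∫⁻ y, g y) ^ 2))) := by
        refine Finset.sum_le_sum fun i _ => ?_
        have b1 := lintegral_weight_erase_le hw hw1 hW htm i
        have b2 : ∑ j ∈ Finset.univ.erase i,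
            (∫⁻ X : ι → R3, (∏ l, w (X l)) * q (X i - X j)) ≤
              Fintype.card ι * (A * ∫⁻ y, q y) := by
          refine (Finset.sum_le_card_nsmul _ _ (A * ∫⁻ y, q y) fun j hj =>
            lintegral_weight_pair_le hw hw1 hW hA hqm (Finset.ne_of_mem_erase hj).symm).trans ?_
          rw [nsmul_eq_mul]
          gcongr
          exact Finset.card_le_univ _
        have b3 : ∑ j ∈ Finset.univ.erase i, ∑ k ∈ (Finset.univ.erase i).erase j,
            (∫⁻ X : ι → R3, (∏ l, w (X l)) * (g (X i - X j) * g (X i - X k))) ≤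
            Fintype.card ι * (Fintype.card ι * (A * ∫⁻ y, g y) ^ 2) := by
          refine (Finset.sum_le_card_nsmul _ _
            (Fintype.card ι * (A * ∫⁻ y, g y) ^ 2) fun j hj => ?_).trans ?_
          · refine (Finset.sum_le_card_nsmul _ _ ((A * ∫⁻ y, g y) ^ 2) fun k hk => ?_).trans ?_
            · exact lintegral_weight_triple_le hw hw1 hW hA hgm (Finset.ne_of_mem_erase hj).symm
                (Finset.ne_of_mem_erase (Finset.mem_of_mem_erase hk)).symm
                (Finset.ne_of_mem_erase hk).symm
            · rw [nsmul_eq_mul]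
              gcongr
              exact Finset.card_le_univ _
          · rw [nsmul_eq_mul]
            gcongr
            exact Finset.card_le_univ _
        exact add_le_add (mul_le_mul_right b1 _) (mul_le_mul_right (add_le_add b2 b3) _)
    _ = _ := by rw [Finset.sum_const, nsmul_eq_mul, Finset.card_univ]

lemma one_sub_sum_le_prod {κ : Type*} (s : Finset κ) {x : κ → ℝ}
    (hx : ∀ k ∈ s, x k ∈ Set.Icc (0 : ℝ) 1) : 1 - ∑ k ∈ s, (1 - x k) ≤ ∏ k ∈ s, x k := by
  classical
  induction s using Finset.induction_on with
  | empty => simp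
  | insert k s hk ih =>
    have h1 := ih fun j hj => hx j (Finset.mem_insert_of_mem hj)
    have h2 := hx k (Finset.mem_insert_self k s)
    have h3 : ∏ k ∈ s, x k ≤ 1 := Finset.prod_le_one
      (fun j hj => (hx j (Finset.mem_insert_of_mem hj)).1)
      fun j hj => (hx j (Finset.mem_insert_of_mem hj)).2
    rw [Finset.sum_insert hk, Finset.prod_insert hk]
    nlinarith [h2.1, h2.2]

lemma lintegral_jastrow_sq_ge {r : ι → ℕ} {u f : R3 → ℝ}
    (hu : ContDiff ℝ 1 u) (huc : HasCompactSupport u) (hu1 : ∫ y, u y ^ 2 = 1)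
    (hf1 : ContDiff ℝ 1 f) (hf01 : ∀ x, f x ∈ Set.Icc (0 : ℝ) 1) {A : ENNReal}
    (hA : ∀ y, ENNReal.ofReal (u y ^ 2) ≤ A) :
    1 ≤ (∫⁻ X : ι → R3, ENNReal.ofReal (jastrow r u f X ^ 2)) +
      Fintype.card ι * (Fintype.card ι * (A * ∫⁻ y, ENNReal.ofReal (1 - f y ^ 2))) := by
  set w : R3 → ENNReal := fun y => ENNReal.ofReal (u y ^ 2) with hwd
  set q : R3 → ENNReal := fun y => ENNReal.ofReal (1 - f y ^ 2) with hq
  have hw : Measurable w := (hu.continuous.pow 2).measurable.ennreal_ofReal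
  have hqm : Measurable q :=
    (continuous_const.sub (hf1.continuous.pow 2)).measurable.ennreal_ofReal
  have hw1 : ∫⁻ y, w y = 1 := lintegral_ofReal_sq hu.continuous huc hu1
  have hW : ∫⁻ X : ι → R3, ∏ l, w (X l) = 1 := lintegral_prod_sq hu.continuous huc hu1
  have hPm : Measurable fun X : ι → R3 => ∏ l, w (X l) :=
    Finset.measurable_prod _ fun l _ => hw.comp (measurable_pi_apply l)
  have m2 : ∀ i j, Measurable fun X : ι → R3 => (∏ l, w (X l)) * q (X i - X j) := fun i j =>
    hPm.mul (hqm.comp ((measurable_pi_apply i).sub (measurable_pi_apply j)))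
  have hψm : Measurable fun X : ι → R3 => ENNReal.ofReal (jastrow r u f X ^ 2) :=
    ((contDiff_jastrow hu hf1).continuous.pow 2).measurable.ennreal_ofReal
  set S := Finset.univ.filter (fun p : ι × ι => r p.1 < r p.2) with hS
  have key : ∀ X : ι → R3, ∏ l, w (X l) ≤ ENNReal.ofReal (jastrow r u f X ^ 2) +
      ∑ p ∈ S, (∏ l, w (X l)) * q (X p.1 - X p.2) := by
    intro X
    have hp : ENNReal.ofReal (∏ l, u (X l) ^ 2) = ∏ l, w (X l) :=
      ENNReal.ofReal_prod_of_nonneg fun l _ => sq_nonneg _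
    have hp0 : 0 ≤ ∏ l, u (X l) ^ 2 := Finset.prod_nonneg fun l _ => sq_nonneg _
    have hq0 : ∀ y, 0 ≤ 1 - f y ^ 2 := fun y => by
      nlinarith [(hf01 y).1, (hf01 y).2]
    have h1 : 1 - ∑ p ∈ S, (1 - f (X p.1 - X p.2) ^ 2) ≤ ∏ p ∈ S, f (X p.1 - X p.2) ^ 2 := by
      exact one_sub_sum_le_prod S fun p _ => ⟨sq_nonneg _, by nlinarith [hq0 (X p.1 - X p.2)]⟩
    rw [← hp]
    have h2 : ∏ l, u (X l) ^ 2 ≤ jastrow r u f X ^ 2 +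
        ∑ p ∈ S, (∏ l, u (X l) ^ 2) * (1 - f (X p.1 - X p.2) ^ 2) := by
      rw [jastrow, mul_pow, ← Finset.prod_pow, ← Finset.prod_pow, ← Finset.mul_sum]
      nlinarith [mul_le_mul_of_nonneg_left h1 hp0]
    refine (ENNReal.ofReal_le_ofReal h2).trans (le_of_eq ?_)
    rw [ENNReal.ofReal_add (sq_nonneg _)
      (Finset.sum_nonneg fun p _ => mul_nonneg hp0 (hq0 _)),
      ENNReal.ofReal_sum_of_nonneg fun p _ => mul_nonneg hp0 (hq0 _)]
    congr 1
    exact Finset.sum_congr rfl fun p _ => ENNReal.ofReal_mul hp0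
  rw [← hW]
  refine (lintegral_mono key).trans ?_
  rw [lintegral_add_left hψm, lintegral_finsetSum _ fun p _ => m2 p.1 p.2]
  refine add_le_add le_rfl ?_
  refine (Finset.sum_le_card_nsmul S _ (A * ∫⁻ y, q y) fun p hp => ?_).trans ?_
  · refine lintegral_weight_pair_le hw hw1 hW hA hqm fun h => ?_
    rw [hS, Finset.mem_filter, h] at hp
    exact lt_irrefl _ hp.2
  · rw [nsmul_eq_mul, ← mul_assoc (Fintype.card ι : ENNReal)]
    gcongr
    have : S.card ≤ Fintype.card ι * Fintype.card ι := by
      rw [← Fintype.card_prod]; exact Finset.card_le_univ _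
    exact_mod_cast this

/-- The particles assigned to block `b`. -/
def block {B : Type*} [DecidableEq B] (β : ι → B) (b : B) : Finset ι :=
  Finset.univ.filter fun i => β i = b

/-- Product of wave functions of disjoint blocks of particles. -/
def blockProd {B : Type*} [Fintype B] [DecidableEq B] (β : ι → B)
    (ψ : ∀ b, (block β b → R3) → ℝ) (X : ι → R3) : ℝ :=
  ∏ b, ψ b fun i => X i

section blocks

variable {B : Type*} [Fintype B] [DecidableEq B] {β : ι → B} {ψ : ∀ b, (block β b → R3) → ℝ}

lemma blockProd_updateFinset (b : B) (X : ι → R3) (Y : block β b → R3) :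
    blockProd β ψ (Function.updateFinset X (block β b) Y) =
      (∏ c ∈ Finset.univ.erase b, ψ c fun i => X i) * ψ b Y := by
  rw [blockProd, ← Finset.mul_prod_erase Finset.univ _ (Finset.mem_univ b), mul_comm]
  congr 1
  · refine Finset.prod_congr rfl fun c hc => ?_
    congr 1
    ext1 i
    have hi : (i : ι) ∉ block β b := fun h => by
      have h1 := i.2
      simp only [block, Finset.mem_filter, Finset.mem_univ, true_and] at h h1
      exact Finset.ne_of_mem_erase hc (h1.symm.trans h)
    simp [Function.updateFinset, hi]
  · congr 1
    ext1 i
    simp [Function.updateFinset]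

lemma energyDensity_const_mul {Φ : (ι → R3) → ℝ} (hΦ : ContDiff ℝ 1 Φ) (K : ℝ) (X : ι → R3) :
    energyDensity v (fun X => K * Φ X) X = K ^ 2 * energyDensity v Φ X := by
  have hk : ∀ i, kin i (fun X => K * Φ X) X = K ^ 2 * kin i Φ X := fun i => by
    have hd := (contDiff_comp_update hΦ X i).differentiable one_ne_zero (X i)
    rw [kin, kin, fderiv_const_mul hd, norm_smul, mul_pow, Real.norm_eq_abs, sq_abs]
  simp only [energyDensity, hk, ← Finset.mul_sum]
  ring

lemma contDiff_blockProd {n : WithTop ℕ∞} (hψ : ∀ b, ContDiff ℝ n (ψ b)) :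
    ContDiff ℝ n (blockProd β ψ) := by
  unfold blockProd
  refine contDiff_prod fun b _ => (hψ b).comp ?_
  exact contDiff_pi.2 fun i => contDiff_apply ℝ R3 (i : ι)

lemma lintegral_clusterEnergy_blockProd_le (hv : Measurable v)
    (hψ : ∀ b, ContDiff ℝ 1 (ψ b)) {w : ENNReal} (b : B)
    (hw : ∫⁻ Y, ENNReal.ofReal (energyDensity v (ψ b) Y) ≤ w * ∫⁻ Y, ENNReal.ofReal (ψ b Y ^ 2)) :
    ∫⁻ X, ENNReal.ofReal (clusterEnergy v (block β b) (blockProd β ψ) X) ≤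
      w * ∫⁻ X, ENNReal.ofReal (blockProd β ψ X ^ 2) := by
  have hΨ := contDiff_blockProd hψ
  have hΨm : Measurable fun X => ENNReal.ofReal (blockProd β ψ X ^ 2) :=
    (hΨ.continuous.pow 2).measurable.ennreal_ofReal
  have hψm : Measurable fun X => ENNReal.ofReal (ψ b X ^ 2) :=
    ((hψ b).continuous.pow 2).measurable.ennreal_ofReal
  have hem : Measurable fun X => ENNReal.ofReal (energyDensity v (ψ b) X) := by
    have hkm : ∀ i, Measurable (kin i (ψ b)) := fun i => (continuous_kin (hψ b) i).measurable
    have hpm := measurable_pairPot (ι := block β b) hv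
    have := (hψ b).continuous.measurable
    unfold energyDensity
    fun_prop
  rw [← lintegral_const_mul _ hΨm]
  refine lintegral_le_of_lmarginal_le (block β b) (μ := fun _ => volume)
    (measurable_clusterEnergy hv _ hΨ).ennreal_ofReal (hΨm.const_mul w) fun X => ?_
  simp only [lmarginal, ← energyDensity_updateFinset, blockProd_updateFinset]
  set K := ∏ c ∈ Finset.univ.erase b, ψ c fun i => X i
  simp_rw [energyDensity_const_mul (hψ b), mul_pow, ENNReal.ofReal_mul (sq_nonneg K)]
  rw [lintegral_const_mul _ hem, lintegral_const_mul _ (hψm.const_mul _),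
    lintegral_const_mul _ hψm]
  calc _ ≤ ENNReal.ofReal (K ^ 2) * (w * ∫⁻ Y, ENNReal.ofReal (ψ b Y ^ 2)) := by
        gcongr; exact hw
    _ = _ := by rw [← volume_pi]; ring

lemma energyDensity_le_sum_clusterEnergy (Φ : (ι → R3) → ℝ)
    (X : ι → R3) (hX : Φ X ≠ 0 → ∀ i j, β i ≠ β j → v (X i - X j) = 0) :
    energyDensity v Φ X = ∑ b, clusterEnergy v (block β b) Φ X := by
  have h : ∑ b, clusterEnergy v (block β b) Φ X = ∑ b, ∑ i ∈ block β b, (kin i Φ X +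
      1 / 2 * (∑ j ∈ Finset.univ.erase i, v (X i - X j)) * Φ X ^ 2) := by
    refine Finset.sum_congr rfl fun b _ => Finset.sum_congr rfl fun i hi => ?_
    by_cases h0 : Φ X = 0
    · simp [h0]
    · congr 3
      refine Finset.sum_subset (Finset.erase_subset_erase _ (Finset.subset_univ _))
        fun j hj hj' => hX h0 i j fun hij => hj' ?_
      simp only [block, Finset.mem_filter, Finset.mem_univ, true_and] at hi
      simp only [block, Finset.mem_erase, Finset.mem_filter, Finset.mem_univ, true_and]
      exact ⟨Finset.ne_of_mem_erase hj, hij ▸ hi⟩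
  rw [h, energyDensity, pairPot, Finset.sum_mul, ← Finset.sum_add_distrib]
  exact (Finset.sum_fiberwise _ β _).symm

lemma lintegral_energyDensity_blockProd_le (hv : Measurable v) (hv0 : ∀ x, 0 ≤ v x)
    (hψ : ∀ b, ContDiff ℝ 1 (ψ b)) {w : ENNReal}
    (hw : ∀ b, ∫⁻ Y, ENNReal.ofReal (energyDensity v (ψ b) Y) ≤
      w * ∫⁻ Y, ENNReal.ofReal (ψ b Y ^ 2))
    (hsep : ∀ X, blockProd β ψ X ≠ 0 → ∀ i j, β i ≠ β j → v (X i - X j) = 0) :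
    ∫⁻ X, ENNReal.ofReal (energyDensity v (blockProd β ψ) X) ≤
      Fintype.card B * w * ∫⁻ X, ENNReal.ofReal (blockProd β ψ X ^ 2) := by
  simp_rw [fun X => energyDensity_le_sum_clusterEnergy (β := β) (blockProd β ψ) X (hsep X),
    ENNReal.ofReal_sum_of_nonneg fun b _ => clusterEnergy_nonneg hv0 _ _ _]
  rw [lintegral_finsetSum _ fun b _ =>
    (measurable_clusterEnergy hv _ (contDiff_blockProd hψ)).ennreal_ofReal]
  refine (Finset.sum_le_card_nsmul _ _ _ fun b _ =>
    lintegral_clusterEnergy_blockProd_le hv hψ b (hw b)).trans (le_of_eq ?_)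
  rw [Finset.card_univ, nsmul_eq_mul, mul_assoc]

lemma exists_blockProd_ne_zero (h : ∀ b, ∃ Y, ψ b Y ≠ 0) : ∃ X, blockProd β ψ X ≠ 0 := by
  choose Y hY using h
  refine ⟨fun i => Y (β i) ⟨i, by simp [block]⟩, Finset.prod_ne_zero_iff.2 fun b _ => ?_⟩
  have hYb : (fun i : block β b => Y (β i) ⟨i, by simp [block]⟩) = Y b := by
    ext1 i
    obtain ⟨i, hi⟩ := i
    have hb : β i = b := by simpa [block] using hi
    subst hb
    rfl
  rw [hYb]
  exact hY b

end blocks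

lemma energyForm_nonneg (hv : ∀ x, 0 ≤ v x) {N : ℕ} (Ψ : (Fin N → R3) → ℂ) :
    0 ≤ energyForm N v Ψ := by
  refine integral_nonneg fun X => add_nonneg (Finset.sum_nonneg fun i _ =>
    Finset.sum_nonneg fun j _ => sq_nonneg _) (Finset.sum_nonneg fun i _ =>
    Finset.sum_nonneg fun j _ => ?_)
  split_ifs
  · exact mul_nonneg (hv _) (sq_nonneg _)
  · exact le_rfl

lemma exists_bosonicState (hvm : Measurable v) (hv0 : ∀ x, 0 ≤ v x) (hvb : ∃ C, ∀ x, v x ≤ C)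
    (hrad : ∀ x y : R3, ‖x‖ = ‖y‖ → v x = v y) {N : ℕ} {L w : ℝ} (hw : 0 ≤ w)
    {Φ : (Fin N → R3) → ℝ} (hΦ : ContDiff ℝ (⊤ : ℕ∞) Φ) (hc : HasCompactSupport Φ)
    (hs : tsupport Φ ⊆ {X | ∀ i, X i ∈ openCube L}) (hne : ∃ X, Φ X ≠ 0)
    (hE : ∫⁻ X, ENNReal.ofReal (energyDensity v Φ X) ≤
      ENNReal.ofReal w * ∫⁻ X, ENNReal.ofReal (Φ X ^ 2)) :
    ∃ Ψ, IsBosonicState N L Ψ ∧ energyForm N v Ψ ≤ w := by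
  have hΦ1 : ContDiff ℝ 1 Φ := hΦ.of_le (by exact_mod_cast le_top)
  have hc2 : HasCompactSupport fun X => Φ X ^ 2 := by
    refine hc.mono fun x hx => ?_
    rw [Function.mem_support] at hx ⊢
    exact fun h => hx (by simp [h])
  have hI : Integrable fun X => Φ X ^ 2 :=
    (hΦ.continuous.pow 2).integrable_of_hasCompactSupport hc2
  have hIe := integrable_energyDensity hvm hv0 hvb hΦ1 hc
  set A := ∫ X, Φ X ^ 2 with hA
  have hA0 : 0 < A := by
    obtain ⟨X, hX⟩ := hne
    exact (hΦ.continuous.pow 2).integral_pos_of_hasCompactSupport_nonneg_nonzero hc2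
      (fun X => sq_nonneg _) (x := X) (pow_ne_zero 2 hX)
  have hE' : ∫ X, energyDensity v Φ X ≤ w * A := by
    rw [← ofReal_integral_eq_lintegral_ofReal hIe (ae_of_all _ (energyDensity_nonneg hv0 Φ)),
      ← ofReal_integral_eq_lintegral_ofReal hI (ae_of_all _ fun X => sq_nonneg _),
      ← ENNReal.ofReal_mul hw, ENNReal.ofReal_le_ofReal_iff (by positivity)] at hE
    exact hE
  set k := (√A)⁻¹ with hk
  have hk2 : k ^ 2 = A⁻¹ := by rw [hk, inv_pow, Real.sq_sqrt hA0.le]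
  set Ψ : (Fin N → R3) → ℂ := fun X => ((k * Φ X : ℝ) : ℂ) with hΨ
  have hΨs : ContDiff ℝ (⊤ : ℕ∞) Ψ :=
    Complex.ofRealCLM.contDiff.comp (contDiff_const.mul hΦ)
  refine ⟨Ψ, ⟨hΨs, ?_, ?_⟩, ?_⟩
  · refine subset_trans (closure_mono fun X hX => ?_) hs
    rw [Function.mem_support] at hX ⊢
    exact fun h => hX (by simp [hΨ, h])
  · have : ∀ X, ‖Ψ X‖ ^ 2 = A⁻¹ * Φ X ^ 2 := fun X => by
      rw [hΨ, Complex.norm_real, Real.norm_eq_abs, sq_abs, mul_pow, hk2]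
    simp_rw [this]
    rw [integral_const_mul, ← hA, inv_mul_cancel₀ hA0.ne']
  · have : ∀ X, ((∑ i, gradSq (fun y => Ψ (Function.update X i y)) (X i)) +
      ∑ i, ∑ j, if i < j then v (X i - X j) * ‖Ψ X‖ ^ 2 else 0) =
      A⁻¹ * energyDensity v Φ X := fun X => by
      rw [energyForm_integrand_eq hrad (hΨs.differentiable (by simp))]
      simp only [hΨ, Complex.ofReal_re, Complex.ofReal_im]
      rw [energyDensity_const_mul hΦ1, hk2]
      have h0 : energyDensity v (fun _ : Fin N → R3 => (0 : ℝ)) X = 0 := by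
        simp [energyDensity, kin]
      rw [h0, add_zero]
    rw [energyForm]
    simp_rw [this]
    rw [integral_const_mul, ← div_eq_inv_mul, div_le_iff₀ hA0]
    exact hE'

lemma groundEnergyB_le (hv : ∀ x, 0 ≤ v x) {N : ℕ} {L w : ℝ}
    (h : ∃ Ψ, IsBosonicState N L Ψ ∧ energyForm N v Ψ ≤ w) : groundEnergyB N L v ≤ w := by
  obtain ⟨Ψ, hΨ, hw⟩ := h
  have hb : BddBelow {E | ∃ Ψ, IsBosonicState N L Ψ ∧ energyForm N v Ψ = E} := by
    refine ⟨0, ?_⟩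
    rintro _ ⟨Ψ, -, rfl⟩
    exact energyForm_nonneg hv Ψ
  exact (csInf_le hb ⟨Ψ, hΨ, rfl⟩).trans hw

end

section

variable {v φ : R3 → ℝ} {R0 a : ℝ}

lemma isCompact_setOf_mem_Icc (f g : Fin 3 → ℝ) :
    IsCompact {x : R3 | ∀ j, x j ∈ Set.Icc (f j) (g j)} := by
  have h : IsCompact (Set.univ.pi fun j => Set.Icc (f j) (g j)) :=
    isCompact_univ_pi fun _ => isCompact_Icc
  have e : {x : R3 | ∀ j, x j ∈ Set.Icc (f j) (g j)} =
      (PiLp.homeomorph 2 fun _ : Fin 3 => ℝ) ⁻¹' Set.univ.pi fun j => Set.Icc (f j) (g j) := by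
    ext x
    simp only [Set.mem_ofPred_eq, Set.mem_preimage, Set.mem_univ_pi]
    rfl
  rw [e, Homeomorph.isCompact_preimage]
  exact h

/-- A smooth cutoff on the unit interval. -/
def intervalCutoff (θ t : ℝ) : ℝ :=
  smoothTransition (t / θ - 1) * smoothTransition ((1 - t) / θ - 1)

lemma intervalCutoff_nonneg (θ t : ℝ) : 0 ≤ intervalCutoff θ t :=
  mul_nonneg (smoothTransition.nonneg _) (smoothTransition.nonneg _)

lemma intervalCutoff_le_one (θ t : ℝ) : intervalCutoff θ t ≤ 1 :=
  mul_le_one₀ (smoothTransition.le_one _) (smoothTransition.nonneg _) (smoothTransition.le_one _)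

lemma mem_Icc_of_intervalCutoff_ne_zero {θ t : ℝ} (hθ : 0 < θ) (h : intervalCutoff θ t ≠ 0) :
    t ∈ Set.Icc θ (1 - θ) := by
  contrapose! h
  rw [Set.mem_Icc, not_and_or, not_le, not_le] at h
  rcases h with h | h
  · have : t / θ - 1 ≤ 0 := by rw [sub_nonpos, div_le_one hθ]; exact h.le
    simp [intervalCutoff, smoothTransition.zero_of_nonpos this]
  · have : (1 - t) / θ - 1 ≤ 0 := by rw [sub_nonpos, div_le_one hθ]; linarith
    simp [intervalCutoff, smoothTransition.zero_of_nonpos this]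

lemma intervalCutoff_eq_one {θ t : ℝ} (hθ : 0 < θ) (h1 : 2 * θ ≤ t) (h2 : t ≤ 1 - 2 * θ) :
    intervalCutoff θ t = 1 := by
  have h3 : 1 ≤ t / θ - 1 := by rw [le_sub_iff_add_le, le_div_iff₀ hθ]; linarith
  have h4 : 1 ≤ (1 - t) / θ - 1 := by rw [le_sub_iff_add_le, le_div_iff₀ hθ]; linarith
  rw [intervalCutoff, smoothTransition.one_of_one_le h3, smoothTransition.one_of_one_le h4, one_mul]

lemma contDiff_intervalCutoff (θ : ℝ) : ContDiff ℝ (⊤ : ℕ∞) (intervalCutoff θ) := by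
  unfold intervalCutoff
  exact (smoothTransition.contDiff.comp ((contDiff_id.div_const _).sub contDiff_const)).mul
    (smoothTransition.contDiff.comp
      (((contDiff_const.sub contDiff_id).div_const _).sub contDiff_const))

/-- A smooth cutoff on the unit cube. -/
def cubeCutoff (θ : ℝ) (x : R3) : ℝ := ∏ j, intervalCutoff θ (x j)

lemma contDiff_cubeCutoff (θ : ℝ) : ContDiff ℝ (⊤ : ℕ∞) (cubeCutoff θ) := by
  unfold cubeCutoff
  refine contDiff_prod fun j _ => (contDiff_intervalCutoff θ).comp ?_
  exact (EuclideanSpace.proj (𝕜 := ℝ) j).contDiff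

lemma cubeCutoff_nonneg (θ : ℝ) (x : R3) : 0 ≤ cubeCutoff θ x :=
  Finset.prod_nonneg fun _ _ => intervalCutoff_nonneg _ _

lemma cubeCutoff_le_one (θ : ℝ) (x : R3) : cubeCutoff θ x ≤ 1 :=
  Finset.prod_le_one (fun _ _ => intervalCutoff_nonneg _ _) fun _ _ => intervalCutoff_le_one _ _

lemma mem_Icc_of_cubeCutoff_ne_zero {θ : ℝ} {x : R3} (hθ : 0 < θ) (h : cubeCutoff θ x ≠ 0)
    (j : Fin 3) : x j ∈ Set.Icc θ (1 - θ) :=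
  mem_Icc_of_intervalCutoff_ne_zero hθ (Finset.prod_ne_zero_iff.1 h j (Finset.mem_univ j))

lemma hasCompactSupport_cubeCutoff {θ : ℝ} (hθ : 0 < θ) : HasCompactSupport (cubeCutoff θ) :=
  HasCompactSupport.of_support_subset_isCompact
    (isCompact_setOf_mem_Icc (fun _ => θ) fun _ => 1 - θ)
    fun _ hx j => mem_Icc_of_cubeCutoff_ne_zero hθ hx j

lemma le_integral_cubeCutoff_sq {θ : ℝ} (hθ : 0 < θ) (hθ' : θ < 1 / 4) :
    (1 - 4 * θ) ^ 3 ≤ ∫ x, cubeCutoff θ x ^ 2 := by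
  have hs : cube (WithLp.toLp 2 fun _ => 2 * θ) (1 - 4 * θ) ⊆ {x | cubeCutoff θ x = 1} := by
    intro x hx
    refine Finset.prod_eq_one fun j _ => ?_
    have := hx j
    simp only [Set.mem_Ico] at this
    exact intervalCutoff_eq_one hθ this.1 (by linarith [this.2])
  have hI := integrable_sq_of_hasCompactSupport (contDiff_cubeCutoff θ).continuous
    (hasCompactSupport_cubeCutoff hθ)
  calc (1 - 4 * θ) ^ 3
      = ∫ x in cube (WithLp.toLp 2 fun _ => 2 * θ) (1 - 4 * θ), (1 : ℝ) := by
        rw [setIntegral_const, smul_eq_mul, mul_one, Measure.real, volume_cube _ (by linarith),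
          ENNReal.toReal_ofReal (by have : 0 < 1 - 4 * θ := by linarith
                                    positivity)]
    _ = ∫ x in cube (WithLp.toLp 2 fun _ => 2 * θ) (1 - 4 * θ), cubeCutoff θ x ^ 2 :=
        setIntegral_congr_fun (measurableSet_cube _ _) fun x hx => by
          have : cubeCutoff θ x = 1 := hs hx
          simp [this]
    _ ≤ _ := setIntegral_le_integral hI (ae_of_all _ fun x => sq_nonneg _)

/-- One-particle trial functions for boxes: nearly constant densities which vanish near the
boundary. -/
lemma exists_boxFunction {δ : ℝ} (hδ : 0 < δ) : ∃ θ > 0, ∃ C ≥ 0, ∀ (c : R3) (ℓ : ℝ), 0 < ℓ →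
    ∃ u : R3 → ℝ, ContDiff ℝ (⊤ : ℕ∞) u ∧
      (∀ x, u x ≠ 0 → ∀ j, x j ∈ Set.Icc (c j + θ * ℓ) (c j + ℓ - θ * ℓ)) ∧
      HasCompactSupport u ∧ ∫ x, u x ^ 2 = 1 ∧ (∀ x, u x ^ 2 ≤ (1 + δ) / ℓ ^ 3) ∧
      ∫⁻ x, ENNReal.ofReal (‖fderiv ℝ u x‖ ^ 2) = ENNReal.ofReal (C / ℓ ^ 2) := by
  set θ := δ / (24 * (1 + δ)) with hθd
  have hθ : 0 < θ := by positivity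
  have hθe : 24 * θ * (1 + δ) = δ := by rw [hθd]; field_simp
  have hθ' : θ < 1 / 4 := by nlinarith
  set w := cubeCutoff θ with hw
  have hws : ContDiff ℝ (⊤ : ℕ∞) w := contDiff_cubeCutoff θ
  have hwc : HasCompactSupport w := hasCompactSupport_cubeCutoff hθ
  set I := ∫ x, w x ^ 2 with hI
  have hI1 : (1 - 4 * θ) ^ 3 ≤ I := le_integral_cubeCutoff_sq hθ hθ'
  have hI0 : 0 < I := lt_of_lt_of_le (pow_pos (by linarith) 3) hI1
  have hI2 : 1 ≤ (1 + δ) * I := by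
    have h1 : 1 - 12 * θ ≤ I := le_trans (by nlinarith [sq_nonneg θ]) hI1
    nlinarith
  set J := ∫ x, ‖fderiv ℝ w x‖ ^ 2 with hJ
  have hJ0 : 0 ≤ J := integral_nonneg fun x => sq_nonneg _
  refine ⟨θ, hθ, J / I, by positivity, fun c ℓ hℓ => ?_⟩
  set k := √((ℓ ^ 3 * I)⁻¹) with hk
  have hk2 : k ^ 2 = (ℓ ^ 3 * I)⁻¹ := Real.sq_sqrt (by positivity)
  have hscale : ∀ g : R3 → ℝ, ∫ x, g (ℓ⁻¹ • (x - c)) = ℓ ^ 3 * ∫ x, g x := fun g => by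
    rw [integral_sub_right_eq_self (fun x => g (ℓ⁻¹ • x)) c, Measure.integral_comp_inv_smul]
    simp [abs_of_pos hℓ]
  set u : R3 → ℝ := fun x => k * w (ℓ⁻¹ • (x - c)) with hu
  have hus : ContDiff ℝ (⊤ : ℕ∞) u :=
    contDiff_const.mul (hws.comp ((contDiff_id.sub contDiff_const).const_smul ℓ⁻¹))
  have hsupp : ∀ x, u x ≠ 0 → ∀ j, x j ∈ Set.Icc (c j + θ * ℓ) (c j + ℓ - θ * ℓ) := by
    intro x hx j
    have := mem_Icc_of_cubeCutoff_ne_zero hθ (right_ne_zero_of_mul hx) j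
    simp only [PiLp.smul_apply, PiLp.sub_apply, smul_eq_mul, Set.mem_Icc, inv_mul_eq_div,
      le_div_iff₀ hℓ, div_le_iff₀ hℓ] at this
    constructor <;> linarith [this.1, this.2]
  have huc : HasCompactSupport u :=
    HasCompactSupport.of_support_subset_isCompact (isCompact_setOf_mem_Icc _ _) hsupp
  have hfd : ∀ x, ‖fderiv ℝ u x‖ ^ 2 = k ^ 2 * ℓ⁻¹ ^ 2 * ‖fderiv ℝ w (ℓ⁻¹ • (x - c))‖ ^ 2 := by
    intro x
    have hw1 : HasFDerivAt w (fderiv ℝ w (ℓ⁻¹ • (x - c))) (ℓ⁻¹ • (x - c)) :=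
      (hws.differentiable (by simp) _).hasFDerivAt
    have h2 : HasFDerivAt (fun x => ℓ⁻¹ • (x - c)) (ℓ⁻¹ • ContinuousLinearMap.id ℝ R3) x :=
      ((hasFDerivAt_id x).sub_const c).const_smul ℓ⁻¹
    have h3 : fderiv ℝ u x = k • ℓ⁻¹ • fderiv ℝ w (ℓ⁻¹ • (x - c)) := by
      have h4 : HasFDerivAt u _ x := (hw1.comp x h2).const_mul k
      rw [h4.fderiv, ContinuousLinearMap.comp_smul, ContinuousLinearMap.comp_id]
    rw [h3, norm_smul, norm_smul, mul_pow, mul_pow, Real.norm_eq_abs, Real.norm_eq_abs, sq_abs,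
      sq_abs, mul_assoc]
  refine ⟨u, hus, hsupp, huc, ?_, fun x => ?_, ?_⟩
  · simp only [hu, mul_pow]
    rw [integral_const_mul, hscale (fun x => w x ^ 2), ← hI, hk2]
    field_simp
  · have h1 : w (ℓ⁻¹ • (x - c)) ^ 2 ≤ 1 :=
      pow_le_one₀ (cubeCutoff_nonneg _ _) (cubeCutoff_le_one _ _)
    have h2 : (ℓ ^ 3 * I)⁻¹ ≤ (1 + δ) / ℓ ^ 3 := by
      rw [mul_inv, div_eq_inv_mul]
      gcongr
      rw [inv_le_iff_one_le_mul₀ hI0]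
      exact hI2
    simp only [hu, mul_pow, hk2]
    calc _ ≤ (ℓ ^ 3 * I)⁻¹ * 1 := by gcongr
      _ ≤ _ := by rwa [mul_one]
  · rw [← ofReal_integral_eq_lintegral_ofReal _ (ae_of_all _ fun x => sq_nonneg _)]
    · simp_rw [hfd]
      rw [integral_const_mul, hscale (fun x => ‖fderiv ℝ w x‖ ^ 2), ← hJ, hk2]
      congr 1
      field_simp
    · have hc : Continuous fun x => ‖fderiv ℝ u x‖ := (hus.continuous_fderiv (by simp)).norm
      exact integrable_sq_of_hasCompactSupport hc (huc.fderiv (𝕜 := ℝ)).norm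

end

section

variable {v φ : R3 → ℝ} {R0 a : ℝ}
variable {ι : Type*} [Fintype ι] [DecidableEq ι]

lemma jastrow_energy_le (hvm : Measurable v) (hv : ∀ x, 0 ≤ v x) {r : ι → ℕ} (hr : r.Injective)
    {u f : R3 → ℝ} (hu : ContDiff ℝ 1 u) (huc : HasCompactSupport u) (hu1 : ∫ y, u y ^ 2 = 1)
    (hf1 : ContDiff ℝ 1 f) (hf : ∀ x, f (-x) = f x) (hf01 : ∀ x, f x ∈ Set.Icc (0 : ℝ) 1)
    {n : ℕ} (hn : Fintype.card ι = n) {η α D M γ κ : ℝ}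
    (hη : 0 < η) (hα : 0 ≤ α) (hD : 0 ≤ D) (hM : 0 ≤ M) (hγ : 0 ≤ γ) (hκ : 0 ≤ κ)
    (huα : ∀ y, u y ^ 2 ≤ α)
    (huD : ∫⁻ y, ENNReal.ofReal (‖fderiv ℝ u y‖ ^ 2) = ENNReal.ofReal D)
    (hfM : ∫⁻ y, ENNReal.ofReal (‖fderiv ℝ f y‖ ^ 2 + 1 / 2 * v y * f y ^ 2) ≤ ENNReal.ofReal M)
    (hfγ : ∫⁻ y, ENNReal.ofReal ‖fderiv ℝ f y‖ ≤ ENNReal.ofReal γ)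
    (hfκ : ∫⁻ y, ENNReal.ofReal (1 - f y ^ 2) ≤ ENNReal.ofReal κ)
    (hq : n * (n * (α * κ)) < 1) :
    (∫⁻ X : ι → R3, ENNReal.ofReal (energyDensity v (jastrow r u f) X) ≤
      ENNReal.ofReal (n * ((1 + 1 / η) * D + (1 + η) * (n * (α * M) + n * (n * (α * γ) ^ 2))) /
        (1 - n * (n * (α * κ)))) * ∫⁻ X, ENNReal.ofReal (jastrow r u f X ^ 2)) ∧
      ∃ X, jastrow r u f X ≠ 0 := by
  have hA : ∀ y, ENNReal.ofReal (u y ^ 2) ≤ ENNReal.ofReal α := fun y =>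
    ENNReal.ofReal_le_ofReal (huα y)
  have hq' : 0 < 1 - n * (n * (α * κ)) := by linarith
  have hnn : (n : ENNReal) = ENNReal.ofReal n := (ENNReal.ofReal_natCast n).symm
  set T : ENNReal := ∫⁻ X : ι → R3, ENNReal.ofReal (jastrow r u f X ^ 2) with hT
  have hT1 : ENNReal.ofReal (1 - n * (n * (α * κ))) ≤ T := by
    have h := lintegral_jastrow_sq_ge (r := r) hu huc hu1 hf1 hf01 hA
    have h2 : (Fintype.card ι : ENNReal) * (Fintype.card ι *
        (ENNReal.ofReal α * ∫⁻ y, ENNReal.ofReal (1 - f y ^ 2))) ≤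
        ENNReal.ofReal (n * (n * (α * κ))) := by
      rw [ENNReal.ofReal_mul (by positivity), ENNReal.ofReal_mul (by positivity),
        ENNReal.ofReal_mul (by positivity), hn, hnn]
      gcongr
    rw [ENNReal.ofReal_sub _ (by positivity), ENNReal.ofReal_one]
    exact tsub_le_iff_right.2 (h.trans (by gcongr))
  constructor
  · have h := lintegral_energyDensity_jastrow_le (ι := ι) hvm hv hr hu huc hu1 hf1 hf hf01 hη hA
    set E := n * ((1 + 1 / η) * D + (1 + η) * (n * (α * M) + n * (n * (α * γ) ^ 2))) with hE
    have hE0 : 0 ≤ E := by positivity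
    calc _ ≤ ENNReal.ofReal E := by
          refine h.trans ?_
          rw [hE, ENNReal.ofReal_mul (by positivity),
            ENNReal.ofReal_add (p := (1 + 1 / η) * D) (by positivity) (by positivity),
            ENNReal.ofReal_mul (p := 1 + 1 / η) (by positivity),
            ENNReal.ofReal_mul (p := 1 + η) (by positivity),
            ENNReal.ofReal_add (p := n * (α * M)) (by positivity) (by positivity),
            ENNReal.ofReal_mul (p := (n : ℝ)) (by positivity),
            ENNReal.ofReal_mul (p := α) (by positivity),
            ENNReal.ofReal_mul (p := (n : ℝ)) (by positivity),
            ENNReal.ofReal_mul (p := (n : ℝ)) (by positivity),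
            ENNReal.ofReal_pow (by positivity), ENNReal.ofReal_mul (p := α) (by positivity),
            hn, hnn, huD]
          gcongr
      _ = ENNReal.ofReal (E / (1 - n * (n * (α * κ)))) *
          ENNReal.ofReal (1 - n * (n * (α * κ))) := by
          rw [← ENNReal.ofReal_mul (by positivity), div_mul_cancel₀ _ hq'.ne']
      _ ≤ _ := by gcongr
  · by_contra! h
    rw [hT] at hT1
    simp [h] at hT1
    linarith

lemma card_block_fst {B : Type*} [Fintype B] [DecidableEq B] {n : ℕ} (e : ι ≃ B × Fin n) (b : B) :
    (block (fun i => (e i).1) b).card = n := by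
  refine Eq.trans ?_ (Finset.card_fin n)
  refine Finset.card_bij' (fun i _ => (e i).2) (fun k _ => e.symm (b, k)) ?_ ?_ ?_ ?_
  · simp
  · simp [block]
  · intro i hi
    have hb : (e i).1 = b := by simpa [block] using hi
    subst hb
    simp
  · simp

/-- Points in the shrunken cells with different corners are far apart. -/
lemma lt_norm_sub_of_corner_ne {m : ℕ} {θ ℓ : ℝ} (hℓ : 0 < ℓ) (hR : R0 < 2 * θ * ℓ)
    {b b' : Fin 3 → Fin m} (hb : b ≠ b') {x y : R3}
    (hx : ∀ j, x j ∈ Set.Icc (corner ℓ b j + θ * ℓ) (corner ℓ b j + ℓ - θ * ℓ))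
    (hy : ∀ j, y j ∈ Set.Icc (corner ℓ b' j + θ * ℓ) (corner ℓ b' j + ℓ - θ * ℓ)) :
    R0 < ‖x - y‖ := by
  obtain ⟨j, hj⟩ := Function.ne_iff.1 hb
  have h1 := hx j
  have h2 := hy j
  have h3 : |x j - y j| ≤ ‖x - y‖ := by
    simpa using PiLp.norm_apply_le (x - y) j
  refine lt_of_lt_of_le ?_ h3
  simp only [corner, Set.mem_Icc] at h1 h2
  rcases lt_or_gt_of_ne hj with h | h
  · have h4 : ((b j : ℕ) : ℝ) + 1 ≤ (b' j : ℕ) := by exact_mod_cast h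
    have h5 := mul_le_mul_of_nonneg_right h4 hℓ.le
    refine lt_of_lt_of_le ?_ (neg_le_abs _)
    linarith [h1.2, h2.1]
  · have h4 : ((b' j : ℕ) : ℝ) + 1 ≤ (b j : ℕ) := by exact_mod_cast h
    have h5 := mul_le_mul_of_nonneg_right h4 hℓ.le
    refine lt_of_lt_of_le ?_ (le_abs_self _)
    linarith [h1.1, h2.2]

lemma ScatteringData.exists_upper_bound (S : ScatteringData v φ R0 a) {δ : ℝ} (hδ : 0 < δ) :
    ∃ θ > 0, ∃ C ≥ 0, ∃ γ ≥ 0, ∃ κ ≥ 0, ∀ (η : ℝ) (n m : ℕ) (ℓ : ℝ), 0 < η → 0 < ℓ →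
      R0 < 2 * θ * ℓ → n * (n * ((1 + δ) / ℓ ^ 3 * κ)) < 1 →
      (∃ Ψ, IsBosonicState (n * m ^ 3) (m * ℓ) Ψ) ∧
      groundEnergyB (n * m ^ 3) (m * ℓ) v ≤ m ^ 3 * (n * ((1 + 1 / η) * (C / ℓ ^ 2) +
        (1 + η) * (n * ((1 + δ) / ℓ ^ 3 * (4 * π * a + δ)) +
          n * (n * ((1 + δ) / ℓ ^ 3 * γ) ^ 2))) / (1 - n * (n * ((1 + δ) / ℓ ^ 3 * κ)))) := by
  obtain ⟨f, hfs, hfc, hf01, hfe, hfM⟩ := S.exists_trial hδ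
  obtain ⟨θ, hθ, C, hC, hbox⟩ := exists_boxFunction hδ
  have hf1 : ContDiff ℝ 1 f := hfs.of_le (by exact_mod_cast le_top)
  have hfd : ∀ x, fderiv ℝ (fun y => 1 - f y) x = -fderiv ℝ f x := fun x => by
    rw [fderiv_const_sub]
  have hM0 : 0 ≤ 4 * π * a + δ := by have := S.a_nonneg; positivity
  have hMi : Integrable fun x => ‖fderiv ℝ f x‖ ^ 2 + 1 / 2 * v x * f x ^ 2 := by
    have := S.integrable_trial (contDiff_const.sub hf1 : ContDiff ℝ 1 fun y => 1 - f y) hfc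
    simpa [hfd] using this
  have hM : ∫⁻ y, ENNReal.ofReal (‖fderiv ℝ f y‖ ^ 2 + 1 / 2 * v y * f y ^ 2) ≤
      ENNReal.ofReal (4 * π * a + δ) := by
    rw [← ofReal_integral_eq_lintegral_ofReal hMi (ae_of_all _ fun y => by
      have := S.nonneg y
      positivity)]
    exact ENNReal.ofReal_le_ofReal hfM
  have hγi : Integrable fun x => ‖fderiv ℝ f x‖ := by
    refine (hf1.continuous_fderiv one_ne_zero).norm.integrable_of_hasCompactSupport ?_
    have := (hfc.fderiv (𝕜 := ℝ)).norm
    refine this.mono fun x hx => ?_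
    rw [Function.mem_support] at hx ⊢
    rwa [hfd, norm_neg]
  have hγ := (ofReal_integral_eq_lintegral_ofReal hγi (ae_of_all _ fun y => norm_nonneg _)).ge
  have hκi : Integrable fun x => 1 - f x ^ 2 := by
    refine (continuous_const.sub (hf1.continuous.pow 2)).integrable_of_hasCompactSupport ?_
    refine hfc.mono fun x hx => ?_
    rw [Function.mem_support] at hx ⊢
    intro h
    have : f x = 1 := by linarith
    exact hx (by simp [this])
  have hκ0 : ∀ x, 0 ≤ 1 - f x ^ 2 := fun x => by nlinarith [(hf01 x).1, (hf01 x).2]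
  have hκ := (ofReal_integral_eq_lintegral_ofReal hκi (ae_of_all _ hκ0)).ge
  set γ := ∫ x, ‖fderiv ℝ f x‖
  set κ := ∫ x, (1 - f x ^ 2)
  have hγ0 : 0 ≤ γ := integral_nonneg fun x => norm_nonneg _
  have hκ0 : 0 ≤ κ := integral_nonneg hκ0
  refine ⟨θ, hθ, C, hC, γ, hγ0, κ, hκ0, fun η n m ℓ hη hℓ hR hq => ?_⟩
  have hcard : Fintype.card (Fin (n * m ^ 3)) = Fintype.card ((Fin 3 → Fin m) × Fin n) := by
    simp [mul_comm]
  set e := Fintype.equivOfCardEq hcard with he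
  set β : Fin (n * m ^ 3) → Fin 3 → Fin m := fun i => (e i).1 with hβ
  choose! u hus husupp huc hu1 huα huD using
    fun b : Fin 3 → Fin m => hbox (corner ℓ b) ℓ hℓ
  set r : ∀ b, block β b → ℕ := fun b i => ((i : Fin (n * m ^ 3)) : ℕ) with hr
  have hrinj : ∀ b, (r b).Injective := fun b => Fin.val_injective.comp Subtype.val_injective
  set ψ : ∀ b, (block β b → R3) → ℝ := fun b => jastrow (r b) (u b) f with hψ
  have hψs : ∀ b, ContDiff ℝ (⊤ : ℕ∞) (ψ b) := fun b => contDiff_jastrow (hus b) hfs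
  have hblock := fun b => jastrow_energy_le S.meas S.nonneg (hrinj b)
    ((hus b).of_le (by exact_mod_cast le_top)) (huc b) (hu1 b) hf1 hfe hf01
    (n := n) (by rw [Fintype.card_coe]; exact card_block_fst e b) hη
    (by positivity) (by positivity) hM0 hγ0 hκ0 (huα b) (huD b) hM hγ hκ hq
  have hne : ∀ X, blockProd β ψ X ≠ 0 → ∀ i, ∀ j, X i j ∈
      Set.Icc (corner ℓ (β i) j + θ * ℓ) (corner ℓ (β i) j + ℓ - θ * ℓ) := by
    intro X hX i
    have h1 := Finset.prod_ne_zero_iff.1 hX (β i) (Finset.mem_univ _)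
    have h2 := Finset.prod_ne_zero_iff.1 (left_ne_zero_of_mul h1) ⟨i, by simp [block]⟩
      (Finset.mem_univ _)
    exact husupp (β i) (X i) h2
  set K : Set (Fin (n * m ^ 3) → R3) := Set.univ.pi fun _ =>
    {x : R3 | ∀ j, x j ∈ Set.Icc (θ * ℓ) (m * ℓ - θ * ℓ)} with hK
  have hKc : IsCompact K := isCompact_univ_pi fun _ => isCompact_setOf_mem_Icc _ _
  have hsub : Function.support (blockProd β ψ) ⊆ K := by
    intro X hX i _ j
    have h1 := hne X hX i j
    have h2 : ((β i j : ℕ) : ℝ) + 1 ≤ m := by exact_mod_cast (β i j).2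
    have h3 := mul_le_mul_of_nonneg_right h2 hℓ.le
    have h4 : 0 ≤ ((β i j : ℕ) : ℝ) * ℓ := by positivity
    simp only [corner, Set.mem_Icc] at h1 ⊢
    constructor <;> linarith [h1.1, h1.2]
  have hKo : K ⊆ {X | ∀ i, X i ∈ openCube (m * ℓ)} := by
    intro X hX i j
    have h1 := hX i (Set.mem_univ i) j
    have h2 : 0 < θ * ℓ := by positivity
    constructor <;> linarith [h1.1, h1.2]
  have hw0 : 0 < 1 - n * (n * ((1 + δ) / ℓ ^ 3 * κ)) := by linarith
  have hst := exists_bosonicState (N := n * m ^ 3) (L := m * ℓ) S.meas S.nonneg S.bdd S.radial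
    (w := m ^ 3 * (n * ((1 + 1 / η) * (C / ℓ ^ 2) +
        (1 + η) * (n * ((1 + δ) / ℓ ^ 3 * (4 * π * a + δ)) +
          n * (n * ((1 + δ) / ℓ ^ 3 * γ) ^ 2))) /
            (1 - n * (n * ((1 + δ) / ℓ ^ 3 * κ)))))
    (by positivity) (contDiff_blockProd hψs) (HasCompactSupport.of_support_subset_isCompact hKc hsub)
    ((closure_minimal hsub hKc.isClosed).trans hKo)
    (exists_blockProd_ne_zero fun b => (hblock b).2) (by
      refine (lintegral_energyDensity_blockProd_le S.meas S.nonneg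
        (fun b => (hψs b).of_le (by exact_mod_cast le_top)) (fun b => (hblock b).1)
        fun X hX i j hij => S.supp _ (lt_norm_sub_of_corner_ne hℓ hR hij
          (hne X hX i) (hne X hX j))).trans (le_of_eq ?_)
      rw [ENNReal.ofReal_mul (by positivity)]
      congr 2
      rw [Fintype.card_fun, Fintype.card_fin, Fintype.card_fin,
        ENNReal.ofReal_pow (by positivity), ENNReal.ofReal_natCast, Nat.cast_pow])
  exact ⟨hst.imp fun _ h => h.1, groundEnergyB_le S.nonneg hst⟩

end

section

variable {v φ : R3 → ℝ} {R0 a : ℝ}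

/-- The thermodynamic limit along boxes made of cells which contain `p` particles each. -/
lemma tendsto_groundEnergyB_cells {ρ e ℓ : ℝ} (hℓ : 0 < ℓ) {p : ℕ} (hp : ρ * ℓ ^ 3 = p)
    (h : Tendsto (fun L : ℝ => groundEnergyB ⌊ρ * L ^ 3⌋₊ L v / L ^ 3) atTop (nhds e)) :
    Tendsto (fun m : ℕ => groundEnergyB (p * m ^ 3) (m * ℓ) v / (m * ℓ) ^ 3) atTop (nhds e) := by
  have hL : Tendsto (fun m : ℕ => (m : ℝ) * ℓ) atTop atTop :=
    tendsto_natCast_atTop_atTop.atTop_mul_const hℓ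
  refine (h.comp hL).congr fun m => ?_
  have : ρ * ((m : ℝ) * ℓ) ^ 3 = ((p * m ^ 3 : ℕ) : ℝ) := by
    push_cast
    rw [← hp]
    ring
  simp only [Function.comp_apply]
  rw [this, Nat.floor_natCast]

lemma ScatteringData.groundEnergyB_limit_ge (S : ScatteringData v φ R0 a) {δ : ℝ} (hδ : 0 < δ)
    (hδ1 : δ < 1) {p : ℕ} (hp : 0 < p) : ∀ᶠ ℓ in atTop, ∀ ρ e : ℝ, ρ * ℓ ^ 3 = p →
      Tendsto (fun L : ℝ => groundEnergyB ⌊ρ * L ^ 3⌋₊ L v / L ^ 3) atTop (nhds e) →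
      4 * π * a * (1 - δ) * (1 - 1 / p) * ρ ^ 2 ≤ e := by
  obtain ⟨θ, hθ, C, hC, γ, hγ, κ, hκ, hup⟩ := S.exists_upper_bound one_pos
  obtain ⟨ℓ₀, hℓ₀, hlow⟩ := S.exists_lower_bound hp hδ hδ1
  have h1 : ∀ᶠ ℓ : ℝ in atTop, R0 < 2 * θ * ℓ :=
    (tendsto_id.const_mul_atTop (by positivity : 0 < 2 * θ)).eventually_gt_atTop R0
  have h2 : ∀ᶠ ℓ : ℝ in atTop, p * (p * ((1 + 1) / ℓ ^ 3 * κ)) < (1 : ℝ) := by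
    have : Tendsto (fun ℓ : ℝ => p * (p * ((1 + 1) / ℓ ^ 3 * κ))) atTop (nhds (p * (p * (0 * κ)))) :=
      (((tendsto_const_nhds.div_atTop (tendsto_pow_atTop three_ne_zero)).mul_const κ).const_mul
        (p : ℝ)).const_mul (p : ℝ)
    exact this.eventually_lt_const (by simp)
  filter_upwards [h1, h2, eventually_ge_atTop ℓ₀] with ℓ h1 h2 h3 ρ e hρ he
  have hℓ : 0 < ℓ := hℓ₀.trans_le h3
  have hp' : (0 : ℝ) < p := by exact_mod_cast hp
  refine ge_of_tendsto (tendsto_groundEnergyB_cells hℓ hρ he) ?_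
  filter_upwards [eventually_gt_atTop 0] with m hm
  have hm' : (0 : ℝ) < m := by exact_mod_cast hm
  have hst := (hup 1 p m ℓ one_pos hℓ h1 h2).1
  have hb : 4 * π * a * (1 - δ) / ℓ ^ 3 * (p * (p - 1) * m ^ 3) ≤
      groundEnergyB (p * m ^ 3) (m * ℓ) v := by
    obtain ⟨Ψ₀, hΨ₀⟩ := hst
    refine le_csInf ⟨_, Ψ₀, hΨ₀, rfl⟩ ?_
    rintro _ ⟨Ψ, hΨ, rfl⟩
    exact S.energyForm_ge (fun Φ hΦ => hlow ℓ h3 m (Fin (p * m ^ 3)) (by simp) Φ hΦ) hΨ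
  rw [le_div_iff₀ (by positivity)]
  refine le_trans (le_of_eq ?_) hb
  have : ρ = p / ℓ ^ 3 := by rw [eq_div_iff (by positivity), hρ]
  rw [this]
  field_simp

lemma upper_bound_aux {n ρ ℓ η δ C M γ κ K s : ℝ} (hs : 0 < s) (hρ : ρ = s ^ 2) (hℓ : 0 < ℓ)
    (hK : 0 < K) (hη : 0 < η) (hδ : 0 < δ) (hC : 0 ≤ C) (hM : 0 ≤ M) (hκ : 0 ≤ κ)
    (hn : ρ * ℓ ^ 3 = n) (hKℓ : K / s ≤ ℓ) (hnK : n ≤ K ^ 3 / s + 1)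
    (hq : (K ^ 3 * s + s ^ 2) * ((1 + δ) * κ) < 1) :
    n * (n * ((1 + δ) / ℓ ^ 3 * κ)) < 1 ∧
    n * ((1 + 1 / η) * (C / ℓ ^ 2) +
        (1 + η) * (n * ((1 + δ) / ℓ ^ 3 * M) + n * (n * ((1 + δ) / ℓ ^ 3 * γ) ^ 2))) /
          (1 - n * (n * ((1 + δ) / ℓ ^ 3 * κ))) / ℓ ^ 3 ≤
      ((1 + 1 / η) * (C / K ^ 2) + (1 + η) * ((1 + δ) * M + s ^ 2 * ((1 + δ) * γ) ^ 2)) /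
        (1 - (K ^ 3 * s + s ^ 2) * ((1 + δ) * κ)) * ρ ^ 2 := by
  have hρ0 : 0 < ρ := by rw [hρ]; positivity
  have hq1 : n * (n * ((1 + δ) / ℓ ^ 3 * κ)) = n * ρ * ((1 + δ) * κ) := by
    rw [← hn]; field_simp
  have hnρ : n * ρ ≤ K ^ 3 * s + s ^ 2 := by
    calc n * ρ ≤ (K ^ 3 / s + 1) * ρ := by gcongr
      _ = _ := by rw [hρ]; field_simp
  have hq2 : n * ρ * ((1 + δ) * κ) ≤ (K ^ 3 * s + s ^ 2) * ((1 + δ) * κ) := by gcongr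
  have hℓ2 : C / ℓ ^ 2 ≤ C / K ^ 2 * ρ := by
    have h : K ^ 2 / ρ ≤ ℓ ^ 2 := by
      have := pow_le_pow_left₀ (by positivity) hKℓ 2
      rwa [div_pow, ← hρ] at this
    calc C / ℓ ^ 2 ≤ C / (K ^ 2 / ρ) := by gcongr
      _ = _ := by field_simp
  rw [hq1]
  refine ⟨hq2.trans_lt hq, ?_⟩
  have hX : n * ((1 + 1 / η) * (C / ℓ ^ 2) +
        (1 + η) * (n * ((1 + δ) / ℓ ^ 3 * M) + n * (n * ((1 + δ) / ℓ ^ 3 * γ) ^ 2))) / ℓ ^ 3 ≤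
      ((1 + 1 / η) * (C / K ^ 2) + (1 + η) * ((1 + δ) * M + s ^ 2 * ((1 + δ) * γ) ^ 2)) *
        ρ ^ 2 := by
    have e : n * ((1 + 1 / η) * (C / ℓ ^ 2) +
        (1 + η) * (n * ((1 + δ) / ℓ ^ 3 * M) + n * (n * ((1 + δ) / ℓ ^ 3 * γ) ^ 2))) / ℓ ^ 3 =
        ρ * ((1 + 1 / η) * (C / ℓ ^ 2) +
        (1 + η) * (ρ * ((1 + δ) * M) + (ρ * ((1 + δ) * γ)) ^ 2)) := by
      rw [← hn]; field_simp
    rw [e]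
    calc _ ≤ ρ * ((1 + 1 / η) * (C / K ^ 2 * ρ) +
        (1 + η) * (ρ * ((1 + δ) * M) + (ρ * ((1 + δ) * γ)) ^ 2)) := by gcongr
      _ = _ := by rw [← hρ]; ring
  have hq' : 0 < 1 - (K ^ 3 * s + s ^ 2) * ((1 + δ) * κ) := by linarith
  have hq'' : 1 - (K ^ 3 * s + s ^ 2) * ((1 + δ) * κ) ≤ 1 - n * ρ * ((1 + δ) * κ) := by linarith
  exact (div_right_comm _ _ _).trans_le
    ((div_le_div₀ (by positivity) hX hq' hq'').trans_eq (mul_div_right_comm _ _ _))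

/-- Cells of side `ℓ` with `n` particles, at density `s ^ 2`. -/
lemma exists_cells {K s : ℝ} (hK : 0 < K) (hs : 0 < s) : ∃ (n : ℕ) (ℓ : ℝ), 0 < ℓ ∧
    s ^ 2 * ℓ ^ 3 = n ∧ K / s ≤ ℓ ∧ n ≤ K ^ 3 / s + 1 := by
  set n := ⌈K ^ 3 / s⌉₊ with hn
  have h1 : K ^ 3 / s ≤ n := Nat.le_ceil _
  have h2 : (n : ℝ) ≤ K ^ 3 / s + 1 := (Nat.ceil_lt_add_one (by positivity)).le
  have h0 : 0 < K ^ 3 / s := by positivity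
  have hℓ : (((n : ℝ) / s ^ 2) ^ (3⁻¹ : ℝ)) ^ 3 = n / s ^ 2 := by
    have := Real.rpow_inv_natCast_pow (x := (n : ℝ) / s ^ 2) (by positivity) three_ne_zero
    simpa using this
  have hn0 : (0 : ℝ) < n := h0.trans_le h1
  refine ⟨n, ((n : ℝ) / s ^ 2) ^ (3⁻¹ : ℝ), by positivity, ?_, ?_, h2⟩
  · rw [hℓ]; field_simp
  · refine le_of_pow_le_pow_left₀ three_ne_zero (by positivity) ?_
    rw [hℓ]
    calc (K / s) ^ 3 = K ^ 3 / s / s ^ 2 := by field_simp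
      _ ≤ _ := by gcongr

lemma ScatteringData.groundEnergyB_limit_le (S : ScatteringData v φ R0 a) {ε : ℝ} (hε : 0 < ε) :
    ∀ᶠ s in nhdsWithin (0 : ℝ) (Set.Ioi 0), ∀ e : ℝ,
      Tendsto (fun L : ℝ => groundEnergyB ⌊s ^ 2 * L ^ 3⌋₊ L v / L ^ 3) atTop (nhds e) →
      e ≤ (4 * π * a + ε) * (s ^ 2) ^ 2 := by
  have hT : 0 ≤ 4 * π * a := by have := S.a_nonneg; positivity
  set T := 4 * π * a
  obtain ⟨η, hη, hη1⟩ : ∃ η > 0, (1 + η) * ((1 + η) * (T + η)) < T + ε / 2 := by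
    have hc : Continuous fun η : ℝ => (1 + η) * ((1 + η) * (T + η)) := by fun_prop
    have h := (hc.tendsto 0).eventually_lt_const (u := T + ε / 2) (by simp; linarith)
    obtain ⟨η, h1, h2⟩ := ((h.filter_mono nhdsWithin_le_nhds).and
      (self_mem_nhdsWithin : Set.Ioi (0 : ℝ) ∈ nhdsWithin 0 (Set.Ioi 0))).exists
    exact ⟨η, h2, h1⟩
  obtain ⟨θ, hθ, C, hC, γ, hγ, κ, hκ, hup⟩ := S.exists_upper_bound hη
  obtain ⟨K, hK, hK1⟩ : ∃ K > 0, (1 + 1 / η) * (C / K ^ 2) < ε / 2 := by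
    have h : Tendsto (fun K : ℝ => (1 + 1 / η) * (C / K ^ 2)) atTop (nhds ((1 + 1 / η) * 0)) :=
      (tendsto_const_nhds.div_atTop (tendsto_pow_atTop two_ne_zero)).const_mul _
    obtain ⟨K, h1, h2⟩ := ((h.eventually_lt_const (u := ε / 2) (by simp; linarith)).and
      (eventually_gt_atTop 0)).exists
    exact ⟨K, h2, h1⟩
  have hq : ∀ᶠ s in nhds (0 : ℝ), (K ^ 3 * s + s ^ 2) * ((1 + η) * κ) < 1 := by
    have hc : Continuous fun s : ℝ => (K ^ 3 * s + s ^ 2) * ((1 + η) * κ) := by fun_prop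
    exact (hc.tendsto 0).eventually_lt_const (by simp)
  have hG : ∀ᶠ s in nhds (0 : ℝ), ((1 + 1 / η) * (C / K ^ 2) +
      (1 + η) * ((1 + η) * (T + η) + s ^ 2 * ((1 + η) * γ) ^ 2)) /
        (1 - (K ^ 3 * s + s ^ 2) * ((1 + η) * κ)) < T + ε := by
    have hc : ContinuousAt (fun s : ℝ => ((1 + 1 / η) * (C / K ^ 2) +
        (1 + η) * ((1 + η) * (T + η) + s ^ 2 * ((1 + η) * γ) ^ 2)) /
          (1 - (K ^ 3 * s + s ^ 2) * ((1 + η) * κ))) 0 :=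
      ContinuousAt.div (by fun_prop) (by fun_prop) (by simp)
    refine hc.eventually_lt_const ?_
    simp only [ne_eq, OfNat.ofNat_ne_zero, not_false_eq_true, zero_pow, mul_zero, add_zero,
      zero_mul, sub_zero, div_one]
    linarith
  have hR : ∀ᶠ s in nhdsWithin (0 : ℝ) (Set.Ioi 0), R0 < 2 * θ * (K / s) := by
    have : Tendsto (fun s : ℝ => 2 * θ * (K / s)) (nhdsWithin 0 (Set.Ioi 0)) atTop := by
      simp_rw [div_eq_mul_inv]
      exact (tendsto_inv_nhdsGT_zero.const_mul_atTop hK).const_mul_atTop (by positivity)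
    exact this.eventually_gt_atTop R0
  filter_upwards [hq.filter_mono nhdsWithin_le_nhds, hG.filter_mono nhdsWithin_le_nhds, hR,
    self_mem_nhdsWithin] with s hq hG hR hs e he
  have hs : 0 < s := hs
  obtain ⟨n, ℓ, hℓ, hn, hKℓ, hnK⟩ := exists_cells hK hs
  obtain ⟨h1, h2⟩ := upper_bound_aux (γ := γ) hs rfl hℓ hK hη hη hC (add_nonneg hT hη.le) hκ hn hKℓ
    hnK hq
  refine le_of_tendsto (tendsto_groundEnergyB_cells hℓ hn he) ?_
  filter_upwards [eventually_gt_atTop 0] with m hm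
  have hm' : (0 : ℝ) < m := by exact_mod_cast hm
  have hb := (hup η n m ℓ hη hℓ (hR.trans_le (by gcongr)) h1).2
  refine le_trans ?_ (h2.trans (by gcongr))
  rw [mul_pow, div_le_iff₀ (by positivity)]
  refine hb.trans (le_of_eq ?_)
  have hW : ∀ W : ℝ, (m : ℝ) ^ 3 * W = W / ℓ ^ 3 * ((m : ℝ) ^ 3 * ℓ ^ 3) := fun W => by field_simp
  exact hW _

theorem ScatteringData.eventually_abs_sub_le (S : ScatteringData v φ R0 a) {eB : ℝ → ℝ}
    (heB : ∀ ρ : ℝ, 0 < ρ →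
      Tendsto (fun L : ℝ => groundEnergyB (⌊ρ * L ^ 3⌋₊) L v / L ^ 3) atTop (nhds (eB ρ)))
    {ε : ℝ} (hε : 0 < ε) :
    ∀ᶠ ρ in nhdsWithin (0 : ℝ) (Set.Ioi 0), |eB ρ - 4 * π * a * ρ ^ 2| ≤ ε * ρ ^ 2 := by
  have hT : 0 ≤ 4 * π * a := by have := S.a_nonneg; positivity
  have hup : ∀ᶠ ρ in nhdsWithin (0 : ℝ) (Set.Ioi 0), eB ρ ≤ (4 * π * a + ε) * ρ ^ 2 := by
    have hsqrt : Tendsto Real.sqrt (nhdsWithin 0 (Set.Ioi 0)) (nhdsWithin 0 (Set.Ioi 0)) := by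
      refine tendsto_nhdsWithin_of_tendsto_nhds_of_eventually_within _ ?_ ?_
      · simpa using (Real.continuous_sqrt.tendsto 0).mono_left nhdsWithin_le_nhds
      · filter_upwards [self_mem_nhdsWithin] with ρ hρ using Real.sqrt_pos.2 hρ
    filter_upwards [hsqrt.eventually (S.groundEnergyB_limit_le hε), self_mem_nhdsWithin]
      with ρ h hρ
    have hρ : 0 < ρ := hρ
    rw [Real.sq_sqrt hρ.le] at h
    exact h _ (heB ρ hρ)
  have hlow : ∀ᶠ ρ in nhdsWithin (0 : ℝ) (Set.Ioi 0), (4 * π * a - ε) * ρ ^ 2 ≤ eB ρ := by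
    have hlim : Tendsto (fun p : ℕ => 4 * π * a * (1 - 1 / (p : ℝ)) * (1 - 1 / (p : ℝ))) atTop
        (nhds (4 * π * a * (1 - 0) * (1 - 0))) :=
      ((tendsto_const_nhds.sub tendsto_one_div_atTop_nhds_zero_nat).const_mul _).mul
        (tendsto_const_nhds.sub tendsto_one_div_atTop_nhds_zero_nat)
    obtain ⟨p, hp1, hp⟩ := ((hlim.eventually_const_lt (u := 4 * π * a - ε) (by linarith)).and
      (eventually_gt_atTop 1)).exists
    have hp' : (1 : ℝ) < p := by exact_mod_cast hp
    have h := S.groundEnergyB_limit_ge (δ := 1 / p) (by positivity)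
      (by rw [div_lt_one] <;> linarith) (zero_lt_one.trans hp)
    have hℓ : Tendsto (fun ρ : ℝ => (p * ρ⁻¹) ^ (3⁻¹ : ℝ)) (nhdsWithin 0 (Set.Ioi 0)) atTop :=
      (tendsto_rpow_atTop (by norm_num)).comp
        (tendsto_inv_nhdsGT_zero.const_mul_atTop (by positivity))
    filter_upwards [hℓ.eventually h, self_mem_nhdsWithin] with ρ h hρ
    have hρ : 0 < ρ := hρ
    have h3 : ((p * ρ⁻¹) ^ (3⁻¹ : ℝ)) ^ 3 = p * ρ⁻¹ := by
      have := Real.rpow_inv_natCast_pow (x := p * ρ⁻¹) (by positivity) three_ne_zero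
      simpa using this
    refine le_trans ?_ (h ρ (eB ρ) (by rw [h3]; field_simp) (heB ρ hρ))
    gcongr
  filter_upwards [hup, hlow] with ρ h1 h2
  rw [abs_le]
  constructor <;> linarith

end

theorem dilute_bose_gas
    (v φ : R3 → ℝ) (R0 a : ℝ) (hR0 : 0 < R0)
    (hv_meas : Measurable v)
    (hv_nonneg : ∀ x, 0 ≤ v x)
    (hv_bdd : ∃ C, ∀ x, v x ≤ C)
    (hv_radial : ∀ x y : R3, ‖x‖ = ‖y‖ → v x = v y)
    (hv_supp : ∀ x : R3, R0 < ‖x‖ → v x = 0)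
    (hφ_C1 : ContDiff ℝ 1 φ)
    (hφ_nonneg : ∀ x, 0 ≤ φ x)
    (hφ_le_one : ∀ x, φ x ≤ 1)
    (hφ_eq : ∀ x : R3, R0 ≤ ‖x‖ → φ x = 1 - a / ‖x‖)
    (hφ_scatt : ∀ g : R3 → ℝ, ContDiff ℝ (⊤ : ℕ∞) g → HasCompactSupport g →
      (∫ x : R3, ⟪gradient φ x, gradient g x⟫) + (1/2) * ∫ x : R3, v x * φ x * g x = 0)
    -- the thermodynamic limit `e^B(ρ)` is assumed to exist:
    (eB : ℝ → ℝ)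
    (heB : ∀ ρ : ℝ, 0 < ρ →
      Tendsto (fun L : ℝ => groundEnergyB (⌊ρ * L ^ 3⌋₊) L v / L ^ 3) atTop (nhds (eB ρ))) :
    ∀ ε > (0:ℝ), ∃ ρ₀ > (0:ℝ), ∀ ρ : ℝ, 0 < ρ → ρ < ρ₀ →
      |eB ρ - 4 * π * a * ρ ^ 2| ≤ ε * ρ ^ 2 := by
  intro ε hε
  have S : ScatteringData v φ R0 a := ⟨hR0, hv_meas, hv_nonneg, hv_bdd, hv_radial, hv_supp, hφ_C1,
    hφ_nonneg, hφ_le_one, hφ_eq, hφ_scatt⟩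
  obtain ⟨ρ₀, hρ₀, h⟩ := mem_nhdsGT_iff_exists_Ioo_subset.1 (S.eventually_abs_sub_le heB hε)
  exact ⟨ρ₀, hρ₀, fun ρ h0 h1 => h ⟨h0, h1⟩⟩
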